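/- The Riemann Hypothesis holds if and only if γ_r > e^{−γ} for every integer r ≥ 0. -/

import Mathlib

open Filter

/-- Generalized Euler constant for a finite set of primes `P`:
`γ(P) = ∏_{p∈P}(1 - 1/p) * (γ + ∑_{p∈P} log p / (p-1))`. -/
noncomputable def gammaP (P : Finset ℕ) : ℝ :=
  (∏ p ∈ P, (1 - 1 / (p : ℝ))) *
    (Real.eulerMascheroniConstant + ∑ p ∈ P, Real.log p / ((p : ℝ) - 1))

/-- `γ_r = γ({p_1, …, p_r})`, the generalized Euler constant for the first `r` primes. -/
noncomputable def gammaR (r : ℕ) : ℝ :=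
  gammaP ((Finset.range r).image (Nat.nth Nat.Prime))

namespace GammaRH

open Real MeasureTheory intervalIntegral Set Topology

local notation "Λ" => ArithmeticFunction.vonMangoldt
local notation "γ₀" => eulerMascheroniConstant

section Abel

/-- The summatory function of `c` on a logarithmic scale. -/
noncomputable def csum (c : ℕ → ℝ) (v : ℝ) : ℝ := ∑ n ∈ Finset.Icc 1 ⌊exp v⌋₊, c n

theorem le_floor_exp_iff {n : ℕ} (hn : 1 ≤ n) (v : ℝ) : n ≤ ⌊exp v⌋₊ ↔ log n ≤ v := by
  rw [Nat.le_floor_iff (exp_pos v).le, log_le_iff_le_exp (by exact_mod_cast hn)]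

theorem csum_eq_of_le (c : ℕ → ℝ) {v u : ℝ} (h : v ≤ u) :
    csum c v = ∑ n ∈ Finset.Icc 1 ⌊exp u⌋₊, if log n ≤ v then c n else 0 := by
  rw [csum, ← Finset.sum_filter]
  congr 1
  ext n
  simp only [Finset.mem_Icc, Finset.mem_filter]
  constructor
  · rintro ⟨h1, h2⟩
    have := (le_floor_exp_iff h1 v).1 h2
    exact ⟨⟨h1, (le_floor_exp_iff h1 u).2 (this.trans h)⟩, this⟩
  · rintro ⟨⟨h1, _⟩, h3⟩
    exact ⟨h1, (le_floor_exp_iff h1 v).2 h3⟩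

theorem measurable_csum (c : ℕ → ℝ) : Measurable (csum c) := by
  have : csum c = (fun N : ℕ => ∑ n ∈ Finset.Icc 1 N, c n) ∘ fun v => ⌊exp v⌋₊ := rfl
  rw [this]
  exact (measurable_from_nat).comp (Nat.measurable_floor.comp measurable_exp)

theorem csum_nonneg {c : ℕ → ℝ} (hc : ∀ n, 0 ≤ c n) (v : ℝ) : 0 ≤ csum c v :=
  Finset.sum_nonneg fun i _ => hc i

theorem csum_mono {c : ℕ → ℝ} (hc : ∀ n, 0 ≤ c n) : Monotone (csum c) := by
  intro v u h
  apply Finset.sum_le_sum_of_subset_of_nonneg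
  · exact Finset.Icc_subset_Icc_right (Nat.floor_mono (exp_le_exp.2 h))
  · exact fun i _ _ => hc i

theorem csum_intervalIntegrable {c : ℕ → ℝ} {a u : ℝ} {g : ℝ → ℝ} (hau : a ≤ u)
    (hg : ContinuousOn g (Icc a u)) :
    IntervalIntegrable (fun v => csum c v * g v) volume a u := by
  have h1 : IntervalIntegrable g volume a u := hg.intervalIntegrable_of_Icc hau
  rw [intervalIntegrable_iff] at h1 ⊢
  refine Integrable.bdd_mul (c := ∑ n ∈ Finset.Icc 1 ⌊exp u⌋₊, |c n|) h1
    (measurable_csum c).aestronglyMeasurable ?_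
  filter_upwards [ae_restrict_mem measurableSet_uIoc] with v hv
  rw [uIoc_of_le hau] at hv
  rw [csum_eq_of_le c hv.2, Real.norm_eq_abs]
  refine (Finset.abs_sum_le_sum_abs _ _).trans (Finset.sum_le_sum fun n _ => ?_)
  split_ifs <;> simp

/-- Partial summation on a logarithmic scale. -/
theorem abel_sum (c : ℕ → ℝ) {a u : ℝ} {g g' : ℝ → ℝ} (hau : a ≤ u)
    (hg : ∀ v ∈ Icc a u, HasDerivAt g (g' v) v) (hg' : ContinuousOn g' (Icc a u)) :
    ∑ n ∈ Finset.Ioc ⌊exp a⌋₊ ⌊exp u⌋₊, c n * g (log n) =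
      csum c u * g u - csum c a * g a - ∫ v in a..u, csum c v * g' v := by
  have hpiece : ∀ t ∈ Icc a u, ∫ v in t..u, g' v = g u - g t := by
    intro t ht
    have hsub : Icc t u ⊆ Icc a u := Icc_subset_Icc_left ht.1
    apply integral_eq_sub_of_hasDerivAt
    · intro v hv
      rw [uIcc_of_le ht.2] at hv
      exact hg v (hsub hv)
    · exact (hg'.mono hsub).intervalIntegrable_of_Icc ht.2
  have hterm : ∀ n ∈ Finset.Icc 1 ⌊exp u⌋₊,
      ∫ v in a..u, (if log n ≤ v then c n else 0) * g' v =
        c n * (g u - g (max a (log n))) := by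
    intro n hn
    rw [Finset.mem_Icc] at hn
    have hlu : log n ≤ u := (le_floor_exp_iff hn.1 u).1 hn.2
    have hm : max a (log n) ∈ Icc a u := ⟨le_max_left _ _, max_le hau hlu⟩
    rw [← hpiece _ hm, ← intervalIntegral.integral_const_mul]
    rw [integral_of_le hau, integral_of_le hm.2]
    have : (fun v => (if log n ≤ v then c n else 0) * g' v) =
        (Ici (log n)).indicator (fun v => c n * g' v) := by
      ext v
      by_cases h : log n ≤ v <;> simp [h]
    rw [this, setIntegral_indicator measurableSet_Ici]
    apply setIntegral_congr_set
    have h2 : (Ioc a u ∩ Ici (log n) : Set ℝ) =ᵐ[volume] (Ioc a u ∩ Ioi (log n) : Set ℝ) :=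
      (ae_eq_refl _).inter Ioi_ae_eq_Ici.symm
    refine h2.trans ?_
    have h3 : Ioc a u ∩ Ioi (log n) = Ioc (max a (log n)) u := by
      ext v; simp only [mem_inter_iff, mem_Ioc, mem_Ioi, max_lt_iff]; tauto
    rw [h3]
    exact ae_eq_refl _
  have hint : ∫ v in a..u, csum c v * g' v =
      ∑ n ∈ Finset.Icc 1 ⌊exp u⌋₊, c n * (g u - g (max a (log n))) := by
    rw [← Finset.sum_congr rfl hterm, ← intervalIntegral.integral_finsetSum]
    · apply integral_congr
      intro v hv
      rw [uIcc_of_le hau] at hv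
      simp only
      rw [csum_eq_of_le c hv.2, Finset.sum_mul]
    · intro n hn
      have h1 : IntervalIntegrable g' volume a u := hg'.intervalIntegrable_of_Icc hau
      rw [intervalIntegrable_iff] at h1 ⊢
      refine Integrable.bdd_mul (c := |c n|) h1 ?_ ?_
      · exact (Measurable.ite measurableSet_Ici measurable_const
          measurable_const).aestronglyMeasurable
      · filter_upwards with v
        split_ifs <;> simp
  have hsplit : Finset.Icc 1 ⌊exp u⌋₊ =
      Finset.Icc 1 ⌊exp a⌋₊ ∪ Finset.Ioc ⌊exp a⌋₊ ⌊exp u⌋₊ := by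
    have := Nat.floor_mono (exp_le_exp.2 hau)
    ext n
    simp only [Finset.mem_Icc, Finset.mem_union, Finset.mem_Ioc]
    omega
  have hdisj : Disjoint (Finset.Icc 1 ⌊exp a⌋₊) (Finset.Ioc ⌊exp a⌋₊ ⌊exp u⌋₊) := by
    rw [Finset.disjoint_left]
    intro n h1 h2
    simp only [Finset.mem_Icc, Finset.mem_Ioc] at h1 h2
    omega
  have e1 : ∑ n ∈ Finset.Icc 1 ⌊exp a⌋₊, c n * (g u - g (max a (log n))) =
      csum c a * (g u - g a) := by
    rw [csum, Finset.sum_mul]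
    refine Finset.sum_congr rfl fun n hn => ?_
    rw [Finset.mem_Icc] at hn
    rw [max_eq_left ((le_floor_exp_iff hn.1 a).1 hn.2)]
  have e2 : ∑ n ∈ Finset.Ioc ⌊exp a⌋₊ ⌊exp u⌋₊, c n * (g u - g (max a (log n))) =
      (csum c u - csum c a) * g u - ∑ n ∈ Finset.Ioc ⌊exp a⌋₊ ⌊exp u⌋₊, c n * g (log n) := by
    have : csum c u - csum c a = ∑ n ∈ Finset.Ioc ⌊exp a⌋₊ ⌊exp u⌋₊, c n := by
      rw [csum, csum, hsplit, Finset.sum_union hdisj]; ring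
    rw [this, Finset.sum_mul, ← Finset.sum_sub_distrib]
    refine Finset.sum_congr rfl fun n hn => ?_
    rw [Finset.mem_Ioc] at hn
    rw [max_eq_right]
    · ring
    · have h1 : 1 ≤ n := by omega
      by_contra h
      have := (le_floor_exp_iff h1 a).2 (not_le.1 h).le
      omega
  rw [hint, hsplit, Finset.sum_union hdisj, e1, e2]
  ring

end Abel

section Mertens

/-- `∑_{n ≤ exp v} Λ(n)/n`. -/
noncomputable def lamSum (v : ℝ) : ℝ := csum (fun n => Λ n / n) v

/-- The error term in Mertens' first theorem for `Λ`. -/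
noncomputable def err (v : ℝ) : ℝ := lamSum v - v + γ₀

theorem lam_div_nonneg (n : ℕ) : 0 ≤ Λ n / (n : ℝ) :=
  div_nonneg ArithmeticFunction.vonMangoldt_nonneg (Nat.cast_nonneg _)

theorem lamSum_mono : Monotone lamSum := csum_mono lam_div_nonneg

theorem lamSum_nonneg (v : ℝ) : 0 ≤ lamSum v := by
  unfold lamSum csum
  exact Finset.sum_nonneg fun n _ => lam_div_nonneg n

theorem measurable_lamSum : Measurable lamSum := measurable_csum _

theorem measurable_err : Measurable err := (measurable_lamSum.sub measurable_id).add_const _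

theorem sum_lam_floor (N : ℕ) :
    ∑ d ∈ Finset.Icc 1 N, Λ d * (N / d : ℕ) = log (N.factorial) := by
  have h := ArithmeticFunction.sum_Ioc_mul_zeta_eq_sum (Λ) N
  rw [ArithmeticFunction.vonMangoldt_mul_zeta] at h
  have h2 : ∑ n ∈ Finset.Ioc 0 N, (ArithmeticFunction.log n : ℝ) = log (N.factorial) := by
    rw [← Finset.prod_Ico_id_eq_factorial, Nat.cast_prod, log_prod]
    · rfl
    · intro i hi
      rw [Finset.mem_Ico] at hi
      have : i ≠ 0 := by omega
      exact_mod_cast this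
  rw [← h2, h]
  rfl

theorem lamSum_log_nat (N : ℕ) (hN : 1 ≤ N) :
    lamSum (log N) = ∑ d ∈ Finset.Icc 1 N, Λ d / (d : ℝ) := by
  have : (0 : ℝ) < N := by exact_mod_cast hN
  rw [lamSum, csum, exp_log this, Nat.floor_natCast]

theorem lamSum_eq_log_floor {v : ℝ} (hv : 0 ≤ v) : lamSum v = lamSum (log ⌊exp v⌋₊) := by
  have h1 : 1 ≤ ⌊exp v⌋₊ := Nat.one_le_floor_iff _ |>.2 (one_le_exp hv)
  rw [lamSum_log_nat _ h1, lamSum, csum]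

theorem lamSum_log_ge (N : ℕ) (hN : 1 ≤ N) : log N - 1 ≤ lamSum (log N) := by
  have hN0 : (0 : ℝ) < N := by exact_mod_cast hN
  rw [lamSum_log_nat N hN]
  have h1 : log (N.factorial) ≤ N * ∑ d ∈ Finset.Icc 1 N, Λ d / (d : ℝ) := by
    rw [← sum_lam_floor, Finset.mul_sum]
    refine Finset.sum_le_sum fun d _ => ?_
    have : ((N / d : ℕ) : ℝ) ≤ N / d := Nat.cast_div_le
    calc Λ d * ((N / d : ℕ) : ℝ) ≤ Λ d * (N / d) :=
          mul_le_mul_of_nonneg_left this ArithmeticFunction.vonMangoldt_nonneg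
      _ = _ := by ring
  have h2 := Stirling.le_log_factorial_stirling (n := N) (by omega)
  have h3 : 0 ≤ log N := log_nonneg (by exact_mod_cast hN)
  have h4 : 0 ≤ log (2 * π) := log_nonneg (by linarith [pi_gt_three])
  have : N * (log N - 1) ≤ N * ∑ d ∈ Finset.Icc 1 N, Λ d / (d : ℝ) := by linarith
  exact le_of_mul_le_mul_left this hN0

theorem lamSum_log_le (N : ℕ) (hN : 1 ≤ N) : lamSum (log N) ≤ log N + (log 4 + 4) := by
  have hN0 : (0 : ℝ) < N := by exact_mod_cast hN
  rw [lamSum_log_nat N hN]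
  have h1 : N * ∑ d ∈ Finset.Icc 1 N, Λ d / (d : ℝ) ≤ log (N.factorial) + Chebyshev.psi N := by
    rw [← sum_lam_floor, Finset.mul_sum, Chebyshev.psi, Nat.floor_natCast]
    have : Finset.Ioc 0 N = Finset.Icc 1 N := rfl
    rw [this, ← Finset.sum_add_distrib]
    refine Finset.sum_le_sum fun d hd => ?_
    have : (N : ℝ) / d ≤ ((N / d : ℕ) : ℝ) + 1 := by
      rw [← Nat.floor_div_eq_div (K := ℝ)]
      exact (Nat.lt_floor_add_one _).le
    calc N * (Λ d / (d : ℝ)) = Λ d * (N / d) := by ring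
      _ ≤ Λ d * (((N / d : ℕ) : ℝ) + 1) :=
          mul_le_mul_of_nonneg_left this ArithmeticFunction.vonMangoldt_nonneg
      _ = _ := by ring
  have h2 := Chebyshev.psi_le_const_mul_self (x := N) hN0.le
  have h3 : log (N.factorial) ≤ N * log N := by
    rw [← log_pow]
    exact log_le_log (by exact_mod_cast N.factorial_pos) (by exact_mod_cast N.factorial_le_pow)
  have : N * ∑ d ∈ Finset.Icc 1 N, Λ d / (d : ℝ) ≤ N * (log N + (log 4 + 4)) := by linarith
  exact le_of_mul_le_mul_left this hN0

theorem exists_err_bound : ∃ C, 1 ≤ C ∧ ∀ v, 0 ≤ v → |err v| ≤ C := by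
  refine ⟨log 4 + 6, by linarith [log_nonneg (x := 4) (by norm_num)], fun v hv => ?_⟩
  have h1 : 1 ≤ ⌊exp v⌋₊ := Nat.one_le_floor_iff _ |>.2 (one_le_exp hv)
  have h2 : log ⌊exp v⌋₊ ≤ v := (le_floor_exp_iff h1 v).1 le_rfl
  have h3 : v ≤ log ⌊exp v⌋₊ + 1 := by
    have hp : (0 : ℝ) < ⌊exp v⌋₊ := by exact_mod_cast h1
    have h5 : (1 : ℝ) ≤ ⌊exp v⌋₊ := by exact_mod_cast h1
    rw [← log_exp 1, ← log_mul hp.ne' (exp_pos _).ne', le_log_iff_exp_le (by positivity)]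
    have := (Nat.lt_floor_add_one (exp v)).le
    nlinarith [add_one_le_exp (1 : ℝ)]
  have h4 := lamSum_log_ge _ h1
  have h5 := lamSum_log_le _ h1
  have h6 := one_half_lt_eulerMascheroniConstant
  have h7 := eulerMascheroniConstant_lt_two_thirds
  have h8 : 0 ≤ log 4 := log_nonneg (by norm_num)
  rw [err, lamSum_eq_log_floor hv, abs_le]
  constructor <;> linarith

end Mertens

section Laplace

theorem laplace_integrable {φ : ℝ → ℝ} (hφ : Measurable φ) {a A b : ℝ}
    (hb : ∀ v, a < v → |φ v| ≤ A * exp (b * v)) {s : ℂ} (hs : b < s.re) :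
    IntegrableOn (fun v : ℝ => (φ v : ℂ) * Complex.exp (-s * v)) (Ioi a) := by
  have h1 : IntegrableOn (fun v : ℝ => A * exp ((b - s.re) * v)) (Ioi a) :=
    (integrableOn_exp_mul_Ioi (by linarith) a).const_mul A
  refine Integrable.mono' h1 ?_ ?_
  · exact (Measurable.mul (Complex.measurable_ofReal.comp hφ) (by fun_prop)).aestronglyMeasurable
  · filter_upwards [ae_restrict_mem measurableSet_Ioi] with v hv
    rw [norm_mul, Complex.norm_real, Complex.norm_exp, Real.norm_eq_abs]
    have : (-s * v).re = -(s.re * v) := by simp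
    rw [this]
    calc |φ v| * exp (-(s.re * v)) ≤ A * exp (b * v) * exp (-(s.re * v)) :=
          mul_le_mul_of_nonneg_right (hb v hv) (exp_pos _).le
      _ = _ := by rw [mul_assoc, ← exp_add]; ring_nf

theorem linear_le_exp {A b v : ℝ} (hb : 0 < b) (hA : 0 ≤ A) (hv : 0 ≤ v) :
    v + A ≤ (1 / b + A) * exp (b * v) := by
  have h1 := add_one_le_exp (b * v)
  have h3 : 1 ≤ exp (b * v) := one_le_exp (by positivity)
  have : v ≤ 1 / b * exp (b * v) := by
    rw [div_mul_eq_mul_div, one_mul, le_div_iff₀ hb]; linarith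
  nlinarith

theorem csum_le_of_log {c : ℕ → ℝ} {A : ℝ}
    (hA : ∀ N : ℕ, 1 ≤ N → ∑ n ∈ Finset.Icc 1 N, c n ≤ log N + A) {v : ℝ} (hv : 0 ≤ v) :
    csum c v ≤ v + A := by
  have h1 : 1 ≤ ⌊exp v⌋₊ := Nat.one_le_floor_iff _ |>.2 (one_le_exp hv)
  have h2 : log ⌊exp v⌋₊ ≤ v := (le_floor_exp_iff h1 v).1 le_rfl
  linarith [hA _ h1, show csum c v = ∑ n ∈ Finset.Icc 1 ⌊exp v⌋₊, c n from rfl]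

theorem laplace_csum_integrable {c : ℕ → ℝ} (hc : ∀ n, 0 ≤ c n) {A : ℝ} (hA0 : 0 ≤ A)
    (hA : ∀ N : ℕ, 1 ≤ N → ∑ n ∈ Finset.Icc 1 N, c n ≤ log N + A) {s : ℂ} (hs : 0 < s.re) :
    IntegrableOn (fun v : ℝ => (csum c v : ℂ) * Complex.exp (-s * v)) (Ioi 0) := by
  refine laplace_integrable (measurable_csum c) (A := 1 / (s.re / 2) + A) (b := s.re / 2) ?_
    (by linarith)
  intro v hv
  rw [abs_of_nonneg (show 0 ≤ csum c v from Finset.sum_nonneg fun n _ => hc n)]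
  exact (csum_le_of_log hA hv.le).trans (linear_le_exp (by linarith) hA0 hv.le)

theorem laplace_csum {c : ℕ → ℝ} (hc : ∀ n, 0 ≤ c n) {A : ℝ} (hA0 : 0 ≤ A)
    (hA : ∀ N : ℕ, 1 ≤ N → ∑ n ∈ Finset.Icc 1 N, c n ≤ log N + A) {s : ℂ} (hs : 0 < s.re) :
    ∫ v in Ioi (0 : ℝ), (csum c v : ℂ) * Complex.exp (-s * v) = LSeries (fun n => c n) s / s := by
  have hs0 : s ≠ 0 := fun h => by simp [h] at hs
  have hO : (fun n ↦ ∑ k ∈ Finset.Icc 1 n, c k) =O[atTop] fun n ↦ (n : ℝ) ^ (s.re / 2) := by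
    refine Asymptotics.IsBigO.of_bound (1 / (s.re / 2) + A) ?_
    filter_upwards [eventually_ge_atTop 1] with N hN
    have hNp : (0 : ℝ) < N := by exact_mod_cast hN
    rw [norm_of_nonneg (Finset.sum_nonneg fun n _ => hc n), norm_of_nonneg (by positivity),
      rpow_def_of_pos hNp, mul_comm (log _)]
    exact (hA N hN).trans (linear_le_exp (by linarith) hA0 (log_nonneg (by exact_mod_cast hN)))
  rw [LSeries_eq_mul_integral_of_nonneg c (r := s.re / 2) (by linarith) (by linarith) hO hc,
    mul_div_cancel_left₀ _ hs0]
  rw [← Real.exp_zero, ← integral_comp_exp_Ioi]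
  refine setIntegral_congr_fun measurableSet_Ioi fun v _ => ?_
  simp only [csum, Complex.ofReal_sum, Complex.real_smul]
  have h1 : ((exp v : ℝ) : ℂ) ^ (-(s + 1)) = Complex.exp (v * -(s + 1)) := by
    rw [Complex.cpow_def_of_ne_zero (by exact_mod_cast (exp_pos v).ne'), ← Complex.ofReal_log
      (exp_pos v).le, Real.log_exp]
  rw [h1, mul_left_comm, Complex.ofReal_exp, ← Complex.exp_add]
  ring_nf

theorem integral_cexp {s : ℂ} (hs : 0 < s.re) :
    ∫ v in Ioi (0 : ℝ), Complex.exp (-s * v) = 1 / s := by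
  have := integral_exp_mul_complex_Ioi (a := -s) (by simpa using hs) 0
  simpa using this

theorem integrable_cexp {s : ℂ} (hs : 0 < s.re) (a : ℝ) :
    IntegrableOn (fun v : ℝ => Complex.exp (-s * v)) (Ioi a) :=
  integrableOn_exp_mul_complex_Ioi (a := -s) (by simpa using hs) a

theorem integrable_mul_cexp {s : ℂ} (hs : 0 < s.re) :
    IntegrableOn (fun v : ℝ => (v : ℂ) * Complex.exp (-s * v)) (Ioi 0) := by
  refine laplace_integrable measurable_id (A := 1 / (s.re / 2) + 0) (b := s.re / 2) ?_
    (by linarith)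
  intro v hv
  rw [id, abs_of_nonneg hv.le]
  simpa using linear_le_exp (A := 0) (b := s.re / 2) (by linarith) le_rfl hv.le

theorem tendsto_cexp {s : ℂ} (hs : 0 < s.re) :
    Tendsto (fun v : ℝ => Complex.exp (-s * v)) atTop (𝓝 0) := by
  rw [Complex.tendsto_exp_nhds_zero_iff]
  have : (fun v : ℝ => (-s * v).re) = fun v : ℝ => -(s.re * v) := by ext v; simp
  rw [this]
  exact tendsto_neg_atBot_iff.2 (tendsto_id.const_mul_atTop hs)

theorem tendsto_mul_cexp {s : ℂ} (hs : 0 < s.re) :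
    Tendsto (fun v : ℝ => (v : ℂ) * Complex.exp (-s * v)) atTop (𝓝 0) := by
  rw [tendsto_zero_iff_norm_tendsto_zero]
  have h := tendsto_rpow_mul_exp_neg_mul_atTop_nhds_zero 1 s.re hs
  refine h.congr' ?_
  filter_upwards [eventually_ge_atTop 0] with v hv
  rw [norm_mul, Complex.norm_real, Complex.norm_exp, norm_of_nonneg hv, rpow_one]
  simp

theorem integral_mul_cexp {s : ℂ} (hs : 0 < s.re) :
    ∫ v in Ioi (0 : ℝ), (v : ℂ) * Complex.exp (-s * v) = 1 / s ^ 2 := by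
  have hs0 : s ≠ 0 := fun h => by simp [h] at hs
  have hd : ∀ v : ℝ, HasDerivAt (fun v : ℝ => -((v : ℂ) * Complex.exp (-s * v) / s) -
      Complex.exp (-s * v) / s ^ 2) ((v : ℂ) * Complex.exp (-s * v)) v := by
    intro v
    have h1 : HasDerivAt (fun v : ℝ => (v : ℂ)) 1 v := Complex.ofRealCLM.hasDerivAt
    have h2 : HasDerivAt (fun v : ℝ => Complex.exp (-s * v)) (Complex.exp (-s * v) * (-s * 1)) v :=
      (h1.const_mul (-s)).cexp
    refine (((h1.mul h2).div_const s).neg.sub (h2.div_const (s ^ 2))).congr_deriv ?_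
    have : Complex.exp (-s * v) * (-s * 1) / s ^ 2 = -(Complex.exp (-s * v) / s) := by
      field_simp
    rw [this]
    have h3 : (v : ℂ) * (Complex.exp (-s * v) * (-s * 1)) / s = -(v * Complex.exp (-s * v)) := by
      field_simp
    rw [add_div, h3]
    ring
  have ht : Tendsto (fun v : ℝ => -((v : ℂ) * Complex.exp (-s * v) / s) -
      Complex.exp (-s * v) / s ^ 2) atTop (𝓝 0) := by
    simpa using ((tendsto_mul_cexp hs).div_const s).neg.sub ((tendsto_cexp hs).div_const (s ^ 2))
  rw [integral_Ioi_of_hasDerivAt_of_tendsto' (fun v _ => hd v) (integrable_mul_cexp hs) ht]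
  simp

theorem sum_lam_div_le : ∀ N : ℕ, 1 ≤ N →
    ∑ n ∈ Finset.Icc 1 N, Λ n / (n : ℝ) ≤ log N + (log 4 + 4) := by
  intro N hN
  rw [← lamSum_log_nat N hN]
  exact lamSum_log_le N hN

theorem LSeries_lam_div {s : ℂ} (hs : 0 < s.re) :
    LSeries (fun n => ((Λ n / (n : ℝ) : ℝ) : ℂ)) s =
      -deriv riemannZeta (1 + s) / riemannZeta (1 + s) := by
  rw [← ArithmeticFunction.LSeries_vonMangoldt_eq_deriv_riemannZeta_div (s := 1 + s)
    (by simpa using hs)]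
  refine tsum_congr fun n => ?_
  rcases eq_or_ne n 0 with rfl | hn
  · simp
  · have hn' : (n : ℂ) ≠ 0 := by exact_mod_cast hn
    rw [LSeries.term_of_ne_zero hn, LSeries.term_of_ne_zero hn, Complex.cpow_add _ _ hn',
      Complex.cpow_one]
    push_cast
    rw [div_div]

theorem laplace_lamSum {s : ℂ} (hs : 0 < s.re) :
    ∫ v in Ioi (0 : ℝ), (lamSum v : ℂ) * Complex.exp (-s * v) =
      -deriv riemannZeta (1 + s) / riemannZeta (1 + s) / s := by
  rw [← LSeries_lam_div hs]
  exact laplace_csum lam_div_nonneg (by linarith [log_nonneg (x := 4) (by norm_num)])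
    sum_lam_div_le hs

theorem laplace_lamSum_integrable {s : ℂ} (hs : 0 < s.re) :
    IntegrableOn (fun v : ℝ => (lamSum v : ℂ) * Complex.exp (-s * v)) (Ioi 0) :=
  laplace_csum_integrable lam_div_nonneg (by linarith [log_nonneg (x := 4) (by norm_num)])
    sum_lam_div_le hs

theorem laplace_err {s : ℂ} (hs : 0 < s.re) :
    ∫ v in Ioi (0 : ℝ), (err v : ℂ) * Complex.exp (-s * v) =
      -deriv riemannZeta (1 + s) / riemannZeta (1 + s) / s - 1 / s ^ 2 + γ₀ / s := by
  have h : ∀ v : ℝ, (err v : ℂ) * Complex.exp (-s * v) = (lamSum v : ℂ) * Complex.exp (-s * v) -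
      (v : ℂ) * Complex.exp (-s * v) + γ₀ * Complex.exp (-s * v) := by
    intro v; simp only [err]; push_cast; ring
  simp_rw [h]
  have h1 : IntegrableOn (fun v : ℝ => (lamSum v : ℂ) * Complex.exp (-s * v) -
      (v : ℂ) * Complex.exp (-s * v)) (Ioi 0) :=
    (laplace_lamSum_integrable hs).sub (integrable_mul_cexp hs)
  rw [integral_add h1 ((integrable_cexp hs 0).const_mul _),
      integral_sub (laplace_lamSum_integrable hs)
    (integrable_mul_cexp hs), MeasureTheory.integral_const_mul, integral_cexp hs,
        integral_mul_cexp hs,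
    laplace_lamSum hs]
  ring
end Laplace

section LogZeta

/-- `Λ(n)/(n log n)`. -/
noncomputable def lamLog (n : ℕ) : ℝ := Λ n / n / log n

theorem lamLog_nonneg (n : ℕ) : 0 ≤ lamLog n :=
  div_nonneg (lam_div_nonneg n) (log_natCast_nonneg n)

theorem lamLog_le (n : ℕ) : lamLog n ≤ (n : ℝ)⁻¹ := by
  unfold lamLog
  rw [div_div, mul_comm, ← div_div, inv_eq_one_div]
  exact div_le_div_of_nonneg_right (div_le_one_of_le₀ ArithmeticFunction.vonMangoldt_le_log
    (log_natCast_nonneg n)) (Nat.cast_nonneg _)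

theorem lamLog_mul_log (n : ℕ) : lamLog n * log n = Λ n / n := by
  unfold lamLog
  rcases eq_or_ne (log n) 0 with h | h
  · have : Λ n = 0 := le_antisymm (h ▸ ArithmeticFunction.vonMangoldt_le_log)
      ArithmeticFunction.vonMangoldt_nonneg
    simp [this]
  · exact div_mul_cancel₀ _ h

theorem sum_lamLog_le : ∀ N : ℕ, 1 ≤ N → ∑ n ∈ Finset.Icc 1 N, lamLog n ≤ log N + 1 := by
  intro N _
  have h := harmonic_le_one_add_log N
  rw [harmonic_eq_sum_Icc] at h
  push_cast at h
  linarith [Finset.sum_le_sum fun n (_ : n ∈ Finset.Icc 1 N) => lamLog_le n]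

theorem lamLog_summable {s : ℂ} (hs : 0 < s.re) : LSeriesSummable (fun n => (lamLog n : ℂ)) s := by
  refine LSeriesSummable_of_le_const_mul_rpow (x := 0) hs ⟨1, fun n _ => ?_⟩
  rw [Complex.norm_real, norm_of_nonneg (lamLog_nonneg n), one_mul, zero_sub, rpow_neg_one]
  exact lamLog_le n

theorem lamLog_abscissa : LSeries.abscissaOfAbsConv (fun n => (lamLog n : ℂ)) ≤ (0 : ℝ) :=
  LSeries.abscissaOfAbsConv_le_of_forall_lt_LSeriesSummable fun y hy =>
    lamLog_summable (by simpa using hy)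

theorem lamLog_hasDerivAt {s : ℂ} (hs : 0 < s.re) :
    HasDerivAt (LSeries (fun n => (lamLog n : ℂ)))
      (deriv riemannZeta (1 + s) / riemannZeta (1 + s)) s := by
  have h := LSeries_hasDerivAt (f := fun n => (lamLog n : ℂ)) (s := s)
    (lamLog_abscissa.trans_lt (by exact_mod_cast hs))
  convert h using 1
  have : LSeries.logMul (fun n => (lamLog n : ℂ)) = fun n => ((Λ n / (n : ℝ) : ℝ) : ℂ) := by
    ext n
    rw [LSeries.logMul, ← lamLog_mul_log, ← Complex.natCast_log, ← Complex.ofReal_mul, mul_comm]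
  rw [this, LSeries_lam_div hs]
  ring

theorem one_add_ne_one {s : ℂ} (hs : 0 < s.re) : 1 + s ≠ 1 := by
  intro h
  have : s = 0 := by simpa using h
  simp [this] at hs

theorem tendsto_zeta_atTop : Tendsto (fun x : ℝ => riemannZeta (1 + (x : ℂ))) atTop (𝓝 1) := by
  have h1 : LSeries.abscissaOfAbsConv (1 : ℕ → ℂ) < ⊤ := by
    rw [LSeries.abscissaOfAbsConv_one]; exact_mod_cast EReal.coe_lt_top 1
  have h := (LSeries.tendsto_atTop h1).comp (tendsto_atTop_add_const_left atTop (1 : ℝ) tendsto_id)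
  simp only [Pi.one_apply] at h
  refine h.congr' ?_
  filter_upwards [eventually_gt_atTop 0] with x hx
  simp only [Function.comp, id]
  rw [LSeries_one_eq_riemannZeta (by simpa using hx)]
  simp

theorem exp_LSeries_lamLog {x : ℝ} (hx : 0 < x) :
    Complex.exp (LSeries (fun n => (lamLog n : ℂ)) x) = riemannZeta (1 + x) := by
  set P : ℂ → ℂ := LSeries (fun n => (lamLog n : ℂ)) with hP
  set Q : ℝ → ℂ := fun x => Complex.exp (-P x) * riemannZeta (1 + x) with hQ
  have hd : ∀ x : ℝ, 0 < x → HasDerivAt Q 0 x := by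
    intro x hx
    have hx' : 0 < (x : ℂ).re := by simpa using hx
    have hz : riemannZeta (1 + (x : ℂ)) ≠ 0 := riemannZeta_ne_zero_of_one_lt_re (by simpa using hx)
    have h1 := (lamLog_hasDerivAt hx').comp_ofReal
    have h2 : HasDerivAt (fun z : ℂ => riemannZeta (1 + z)) (deriv riemannZeta (1 + x)) (x : ℂ) :=
      HasDerivAt.comp_const_add 1 (x : ℂ)
        (differentiableAt_riemannZeta (one_add_ne_one hx')).hasDerivAt
    have h3 := (h1.neg.cexp).mul h2.comp_ofReal
    refine h3.congr_deriv ?_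
    field_simp
    ring
  have hconst : ∀ y : ℝ, x ≤ y → Q y = Q x := by
    intro y hy
    refine constant_of_has_deriv_right_zero (a := x) (b := y) ?_ ?_ y ⟨hy, le_rfl⟩
    · intro t ht
      exact (hd t (hx.trans_le ht.1)).continuousAt.continuousWithinAt
    · intro t ht
      exact (hd t (hx.trans_le ht.1)).hasDerivWithinAt
  have hl : Tendsto Q atTop (𝓝 1) := by
    have h1 := LSeries.tendsto_atTop (f := fun n => (lamLog n : ℂ))
      (lamLog_abscissa.trans_lt (by exact_mod_cast EReal.coe_lt_top 0))
    have h2 : Tendsto Q atTop (𝓝 (Complex.exp (-(lamLog 1 : ℂ)) * 1)) :=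
      (h1.neg.cexp).mul tendsto_zeta_atTop
    have h0 : lamLog 1 = 0 := by simp [lamLog]
    simpa [h0] using h2
  have : Q x = 1 := by
    refine tendsto_nhds_unique (f := Q) (l := atTop) ?_ hl
    refine tendsto_const_nhds.congr' ?_
    filter_upwards [eventually_ge_atTop x] with y hy using (hconst y hy).symm
  simp only [hQ] at this
  rw [Complex.exp_neg, inv_mul_eq_one₀ (Complex.exp_ne_zero _)] at this
  exact this

/-- `∑_{n ≤ exp u} Λ(n)/(n log n)`. -/
noncomputable def lamLogSum (u : ℝ) : ℝ := csum lamLog u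

theorem tendsto_laplace_lamLogSum :
    Tendsto (fun x : ℝ => x * (∫ v in Ioi (0 : ℝ), lamLogSum v * exp (-x * v)) + log x)
      (𝓝[>] 0) (𝓝 0) := by
  have key : ∀ x : ℝ, 0 < x → ((x * ∫ v in Ioi (0 : ℝ), lamLogSum v * exp (-x * v) : ℝ) : ℂ) =
      LSeries (fun n => (lamLog n : ℂ)) x := by
    intro x hx
    have h := laplace_csum lamLog_nonneg zero_le_one sum_lamLog_le (s := x) (by simpa using hx)
    rw [eq_div_iff (by exact_mod_cast hx.ne'), mul_comm] at h
    rw [← h, Complex.ofReal_mul, ← integral_complex_ofReal]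
    congr 2
    ext v
    push_cast
    rfl
  have h2 : Tendsto (fun x : ℝ => ((exp (x * (∫ v in Ioi (0 : ℝ), lamLogSum v * exp (-x * v)) +
      log x) : ℝ) : ℂ)) (𝓝[>] 0) (𝓝 1) := by
    have h := riemannZeta_residue_one
    have h3 : Tendsto (fun x : ℝ => 1 + (x : ℂ)) (𝓝[>] 0) (𝓝[≠] 1) := by
      refine tendsto_nhdsWithin_iff.2 ⟨?_, ?_⟩
      · have : Continuous (fun x : ℝ => 1 + (x : ℂ)) := by fun_prop
        have := this.tendsto 0
        simp only [Complex.ofReal_zero, add_zero] at this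
        exact this.mono_left nhdsWithin_le_nhds
      · filter_upwards [self_mem_nhdsWithin] with x hx
        exact one_add_ne_one (by simpa using hx)
    refine (h.comp h3).congr' ?_
    filter_upwards [self_mem_nhdsWithin] with x hx
    simp only [Function.comp]
    rw [exp_add, exp_log hx, Complex.ofReal_mul, Complex.ofReal_exp, key x hx,
      exp_LSeries_lamLog hx]
    ring
  have h4 : Tendsto (fun x : ℝ => exp (x * (∫ v in Ioi (0 : ℝ), lamLogSum v * exp (-x * v)) +
      log x)) (𝓝[>] 0) (𝓝 1) := by
    have := (Complex.continuous_re.tendsto _).comp h2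
    simpa only [Function.comp_def, Complex.ofReal_re, Complex.one_re] using this
  have h5 := h4.log one_ne_zero
  simpa using h5

end LogZeta

section MertensLog

theorem integrable_rpow_mul_exp {a x : ℝ} (ha : -1 < a) (hx : 0 < x) :
    IntegrableOn (fun v : ℝ => v ^ a * exp (-x * v)) (Ioi 0) := by
  have := integrableOn_rpow_mul_exp_neg_mul_rpow (p := 1) ha zero_lt_one hx
  simpa using this

theorem abs_log_le_sqrt {v : ℝ} (hv : 0 < v) :
    |log v| ≤ 2 * (v ^ (-(1 / 2) : ℝ) + v ^ (1 / 2 : ℝ)) := by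
  have h1 : ∀ w : ℝ, 0 < w → log w ≤ 2 * w ^ (1 / 2 : ℝ) := by
    intro w hw
    have h2 := log_le_self (x := w ^ (1 / 2 : ℝ)) (by positivity)
    rw [log_rpow hw] at h2
    linarith
  have hp : 0 < v ^ (-(1 / 2) : ℝ) := by positivity
  have hq : 0 < v ^ (1 / 2 : ℝ) := by positivity
  rw [abs_le]
  constructor
  · have := h1 v⁻¹ (by positivity)
    rw [log_inv, inv_rpow hv.le, ← rpow_neg hv.le] at this
    linarith
  · have := h1 v hv
    linarith

theorem integrable_log_mul_exp {x : ℝ} (hx : 0 < x) :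
    IntegrableOn (fun v : ℝ => log v * exp (-x * v)) (Ioi 0) := by
  have h1 := ((integrable_rpow_mul_exp (a := -(1 / 2)) (by norm_num) hx).add
    (integrable_rpow_mul_exp (a := 1 / 2) (by norm_num) hx)).const_mul 2
  refine Integrable.mono' h1 (by fun_prop) ?_
  filter_upwards [ae_restrict_mem measurableSet_Ioi] with v hv
  rw [norm_mul, Real.norm_eq_abs, Real.norm_eq_abs, abs_of_pos (exp_pos _)]
  simp only [Pi.add_apply]
  calc |log v| * exp (-x * v) ≤ 2 * (v ^ (-(1 / 2) : ℝ) + v ^ (1 / 2 : ℝ)) * exp (-x * v) :=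
        mul_le_mul_of_nonneg_right (abs_log_le_sqrt hv) (exp_pos _).le
    _ = _ := by ring

theorem integral_log_mul_exp_neg : ∫ v in Ioi (0 : ℝ), log v * exp (-v) = -γ₀ := by
  have h1 := Complex.hasDerivAt_GammaIntegral (s := 1) (by simp)
  have h2 := Complex.hasDerivAt_Gamma_one
  have h3 : HasDerivAt Complex.Gamma
      (∫ t : ℝ in Ioi 0, (t : ℂ) ^ ((1 : ℂ) - 1) * (Real.log t * Real.exp (-t))) 1 := by
    refine h1.congr_of_eventuallyEq ?_
    have : IsOpen {z : ℂ | 0 < z.re} := isOpen_lt continuous_const Complex.continuous_re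
    filter_upwards [this.mem_nhds (by simp)] with z hz using Complex.Gamma_eq_integral hz
  have h4 := h3.unique h2
  simp only [sub_self, Complex.cpow_zero, one_mul] at h4
  have h5 : ((∫ v in Ioi (0 : ℝ), log v * exp (-v) : ℝ) : ℂ) = ((-γ₀ : ℝ) : ℂ) := by
    rw [← integral_complex_ofReal]
    push_cast
    push_cast at h4
    exact h4
  exact_mod_cast h5

theorem integral_exp_neg_mul {x : ℝ} (hx : 0 < x) :
    ∫ v in Ioi (0 : ℝ), exp (-x * v) = 1 / x := by
  have := integral_exp_mul_Ioi (a := -x) (by linarith) 0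
  simpa using this

theorem integral_log_mul_exp {x : ℝ} (hx : 0 < x) :
    x * ∫ v in Ioi (0 : ℝ), log v * exp (-x * v) = -γ₀ - log x := by
  have h1 := integral_comp_mul_left_Ioi (fun w => log w * exp (-w)) 0 hx
  rw [mul_zero, integral_log_mul_exp_neg, smul_eq_mul] at h1
  have h2 : ∫ v in Ioi (0 : ℝ), log (x * v) * exp (-(x * v)) =
      (∫ v in Ioi (0 : ℝ), log v * exp (-x * v)) + log x * (1 / x) := by
    rw [← integral_exp_neg_mul hx, ← MeasureTheory.integral_const_mul, ← integral_add
      (integrable_log_mul_exp hx) ((integrableOn_exp_mul_Ioi (by linarith) 0).const_mul _)]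
    refine setIntegral_congr_fun measurableSet_Ioi fun v hv => ?_
    rw [log_mul hx.ne' (ne_of_gt hv), neg_mul]
    ring
  rw [h2] at h1
  field_simp at h1 ⊢
  linarith

/-- `∫_u^∞ err(v)/v² dv`. -/
noncomputable def errTail (u : ℝ) : ℝ := ∫ v in Ioi u, err v / v ^ 2

theorem integrable_err_div_sq {u : ℝ} (hu : 0 < u) :
    IntegrableOn (fun v => err v / v ^ 2) (Ioi u) := by
  obtain ⟨C, hC1, hC⟩ := exists_err_bound
  have h1 : IntegrableOn (fun v : ℝ => C * v ^ (-2 : ℝ)) (Ioi u) :=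
    (integrableOn_Ioi_rpow_of_lt (by norm_num) hu).const_mul C
  refine Integrable.mono' h1 (measurable_err.div (by fun_prop)).aestronglyMeasurable ?_
  filter_upwards [ae_restrict_mem measurableSet_Ioi] with v hv
  have hv0 : 0 < v := hu.trans hv
  rw [norm_div, Real.norm_eq_abs, norm_pow, Real.norm_eq_abs, sq_abs, rpow_neg hv0.le, rpow_two,
    ← div_eq_mul_inv]
  exact div_le_div_of_nonneg_right (hC v hv0.le) (by positivity)

theorem abs_errTail_le {C : ℝ} (hC : ∀ v, 0 ≤ v → |err v| ≤ C) {u : ℝ} (hu : 0 < u) :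
    |errTail u| ≤ C / u := by
  have h1 : IntegrableOn (fun v : ℝ => C * v ^ (-2 : ℝ)) (Ioi u) :=
    (integrableOn_Ioi_rpow_of_lt (by norm_num) hu).const_mul C
  have h2 : ∫ v in Ioi u, C * v ^ (-2 : ℝ) = C / u := by
    rw [MeasureTheory.integral_const_mul, integral_Ioi_rpow_of_lt (by norm_num) hu]
    norm_num
    rw [rpow_neg_one]
    ring
  rw [← h2, errTail, ← Real.norm_eq_abs]
  refine norm_integral_le_of_norm_le h1 ?_
  filter_upwards [ae_restrict_mem measurableSet_Ioi] with v hv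
  have hv0 : 0 < v := hu.trans hv
  rw [norm_div, Real.norm_eq_abs, norm_pow, Real.norm_eq_abs, sq_abs, rpow_neg hv0.le, rpow_two,
    ← div_eq_mul_inv]
  exact div_le_div_of_nonneg_right (hC v hv0.le) (by positivity)

theorem errTail_sub {a u : ℝ} (ha : 0 < a) (hau : a ≤ u) :
    ∫ v in a..u, err v / v ^ 2 = errTail a - errTail u := by
  have h1 := integral_Ioi_sub_Ioi (integrable_err_div_sq ha) hau
  rw [errTail, errTail, h1, integral_of_le hau]

theorem floor_exp_half : ⌊exp (1 / 2)⌋₊ = 1 := by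
  rw [Nat.floor_eq_iff (exp_pos _).le]
  constructor
  · simp
  · have h : exp (1 / 2) ^ 2 = exp 1 := by rw [← exp_nat_mul]; norm_num
    have := exp_one_lt_d9
    have hp := exp_pos (1 / 2)
    norm_num
    nlinarith

theorem csum_half (c : ℕ → ℝ) : csum c (1 / 2) = c 1 := by
  rw [csum, floor_exp_half]; simp

theorem lamLogSum_eq_add_const : ∃ κ : ℝ, ∀ u, 1 / 2 ≤ u →
    lamLogSum u = log u + err u / u - errTail u + κ := by
  refine ⟨1 + errTail (1 / 2) - log (1 / 2) - γ₀ / (1 / 2), fun u hu => ?_⟩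
  have hu0 : 0 < u := by linarith
  have hpos : ∀ v ∈ Icc (1 / 2) u, v ≠ 0 := fun v hv => by
    have := hv.1
    intro h; rw [h] at this; norm_num at this
  have h := abel_sum (fun n => Λ n / n) (g := fun v => v⁻¹) (g' := fun v => -(v ^ 2)⁻¹) hu
    (fun v hv => hasDerivAt_inv (hpos v hv))
    (by
      apply ContinuousOn.neg
      apply ContinuousOn.inv₀ (by fun_prop)
      intro v hv
      exact pow_ne_zero _ (hpos v hv))
  have hL : ∑ n ∈ Finset.Ioc ⌊exp (1 / 2)⌋₊ ⌊exp u⌋₊, Λ n / n * (log n)⁻¹ = lamLogSum u := by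
    rw [floor_exp_half, lamLogSum, csum]
    have h1 : 1 ≤ ⌊exp u⌋₊ := Nat.one_le_floor_iff _ |>.2 (one_le_exp hu0.le)
    rw [← Finset.add_sum_Ioc_eq_sum_Icc h1]
    simp [lamLog, div_eq_mul_inv]
  rw [hL, csum_half] at h
  simp only [ArithmeticFunction.vonMangoldt_apply_one, zero_div, zero_mul, sub_zero] at h
  have hi : ∫ v in (1 / 2)..u, csum (fun n => Λ n / n) v * -(v ^ 2)⁻¹ =
      -((∫ v in (1 / 2)..u, err v / v ^ 2) + (∫ v in (1 / 2)..u, v⁻¹) +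
        (∫ v in (1 / 2)..u, -γ₀ * (v ^ 2)⁻¹)) := by
    have i1 : IntervalIntegrable (fun v => err v / v ^ 2) volume (1 / 2) u := by
      rw [intervalIntegrable_iff, uIoc_of_le hu]
      exact (integrable_err_div_sq (by norm_num)).mono_set Ioc_subset_Ioi_self
    have i2 : IntervalIntegrable (fun v : ℝ => v⁻¹) volume (1 / 2) u := by
      apply ContinuousOn.intervalIntegrable_of_Icc hu
      exact continuousOn_id.inv₀ hpos
    have i3 : IntervalIntegrable (fun v : ℝ => -γ₀ * (v ^ 2)⁻¹) volume (1 / 2) u := by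
      apply ContinuousOn.intervalIntegrable_of_Icc hu
      exact continuousOn_const.mul ((continuousOn_id.pow 2).inv₀ fun v hv =>
          pow_ne_zero _ (hpos v hv))
    rw [← intervalIntegral.integral_add i1 i2, ← intervalIntegral.integral_add (i1.add i2) i3,
      ← intervalIntegral.integral_neg]
    apply integral_congr
    intro v hv
    rw [uIcc_of_le hu] at hv
    have hv0 := hpos v hv
    simp only [err, lamSum]
    field_simp
    ring
  have hi3 : ∫ v in (1 / 2)..u, -γ₀ * (v ^ 2)⁻¹ = γ₀ * u⁻¹ - γ₀ * (1 / 2)⁻¹ := by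
    apply integral_eq_sub_of_hasDerivAt
    · intro v hv
      rw [uIcc_of_le hu] at hv
      exact ((hasDerivAt_inv (hpos v hv)).const_mul γ₀).congr_deriv (by ring)
    · apply ContinuousOn.intervalIntegrable_of_Icc hu
      exact continuousOn_const.mul ((continuousOn_id.pow 2).inv₀ fun v hv =>
          pow_ne_zero _ (hpos v hv))
  rw [hi, errTail_sub (by norm_num) hu, integral_inv_of_pos (by norm_num) hu0, hi3,
    log_div hu0.ne' (by norm_num)] at h
  rw [h]
  have : csum (fun n => Λ n / n) u = err u + u - γ₀ := by simp only [err, lamSum]; ring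
  rw [this]
  field_simp
  ring

theorem lamLogSum_eq {u : ℝ} (hu : 1 / 2 ≤ u) :
    lamLogSum u = log u + γ₀ + err u / u - errTail u := by
  obtain ⟨κ, hκ⟩ := lamLogSum_eq_add_const
  suffices κ = γ₀ by rw [hκ u hu, this]; ring
  obtain ⟨C, hC1, hC⟩ := exists_err_bound
  set δ : ℝ → ℝ := fun v => lamLogSum v - log v - κ with hδ
  have hmeas : Measurable δ := by
    exact ((measurable_csum _).sub measurable_log).sub_const _
  set A := 8 * C + 4 + |κ| with hA
  have hbound : ∀ v, 0 < v → |δ v| ≤ A * v ^ (-(1 / 2) : ℝ) := by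
    intro v hv
    rcases le_or_gt (1 / 2) v with h | h
    · have h1 : δ v = err v / v - errTail v := by simp only [hδ]; rw [hκ v h]; ring
      have h2 : |δ v| ≤ 2 * C / v := by
        rw [h1]
        refine (abs_sub _ _).trans ?_
        have h3 := abs_errTail_le hC hv
        have h4 : |err v / v| ≤ C / v := by
          rw [abs_div, abs_of_pos hv]
          exact div_le_div_of_nonneg_right (hC v hv.le) hv.le
        have : 2 * C / v = C / v + C / v := by ring
        linarith
      refine h2.trans ?_
      have h5 : v⁻¹ ≤ 2 * v ^ (-(1 / 2) : ℝ) := by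
        have h6 : v⁻¹ = v ^ (-(1 / 2) : ℝ) * v ^ (-(1 / 2) : ℝ) := by
          rw [← rpow_add hv, ← rpow_neg_one]; norm_num
        have h7 : v ^ (-(1 / 2) : ℝ) ≤ (1 / 4 : ℝ) ^ (-(1 / 2) : ℝ) :=
          rpow_le_rpow_of_nonpos (by norm_num) (by linarith) (by norm_num)
        have h8 : (1 / 4 : ℝ) ^ (-(1 / 2) : ℝ) = 2 := by
          rw [show (1 / 4 : ℝ) = 2 ^ (-2 : ℝ) by norm_num [rpow_neg], ← rpow_mul (by norm_num)]
          norm_num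
        rw [h6]
        have : 0 < v ^ (-(1 / 2) : ℝ) := by positivity
        nlinarith
      have hp : 0 < v ^ (-(1 / 2) : ℝ) := by positivity
      calc 2 * C / v = 2 * C * v⁻¹ := by ring
        _ ≤ 2 * C * (2 * v ^ (-(1 / 2) : ℝ)) := mul_le_mul_of_nonneg_left h5 (by linarith)
        _ ≤ A * v ^ (-(1 / 2) : ℝ) := by
          rw [hA]
          have : 0 ≤ |κ| := abs_nonneg _
          nlinarith
    · have h1 : lamLogSum v = 0 := by
        have h2 : lamLogSum v ≤ lamLogSum (1 / 2) := csum_mono lamLog_nonneg h.le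
        have h3 : lamLogSum (1 / 2) = 0 := by rw [lamLogSum, csum_half]; simp [lamLog]
        exact le_antisymm (h3 ▸ h2) (csum_nonneg lamLog_nonneg v)
      have h2 := abs_log_le_sqrt hv
      have h3 : v ^ (1 / 2 : ℝ) ≤ v ^ (-(1 / 2) : ℝ) :=
        rpow_le_rpow_of_exponent_ge hv (by linarith) (by norm_num)
      have h4 : 1 ≤ v ^ (-(1 / 2) : ℝ) :=
        one_le_rpow_of_pos_of_le_one_of_nonpos hv (by linarith) (by norm_num)
      have h5 : |δ v| ≤ |log v| + |κ| := by
        simp only [hδ, h1, zero_sub]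
        refine (abs_sub _ _).trans ?_
        rw [abs_neg]
      rw [hA]
      have : 0 ≤ |κ| := abs_nonneg _
      nlinarith
  have hint : ∀ x, 0 < x → IntegrableOn (fun v => A * (v ^ (-(1 / 2) : ℝ) * exp (-x * v)))
      (Ioi 0) :=
    fun x hx => (integrable_rpow_mul_exp (by norm_num) hx).const_mul A
  have hae : ∀ x : ℝ, ∀ᵐ v ∂(volume.restrict (Ioi 0)), ‖δ v * exp (-x * v)‖ ≤
      A * (v ^ (-(1 / 2) : ℝ) * exp (-x * v)) := by
    intro x
    filter_upwards [ae_restrict_mem measurableSet_Ioi] with v hv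
    rw [norm_mul, Real.norm_eq_abs, Real.norm_eq_abs, abs_of_pos (exp_pos _), ← mul_assoc]
    exact mul_le_mul_of_nonneg_right (hbound v hv) (exp_pos _).le
  have hδint : ∀ x, 0 < x → IntegrableOn (fun v => δ v * exp (-x * v)) (Ioi 0) := fun x hx =>
    Integrable.mono' (hint x hx) (by fun_prop) (hae x)
  have hsmall : ∀ x, 0 < x → |x * ∫ v in Ioi 0, δ v * exp (-x * v)| ≤
      A * Gamma (1 / 2) * x ^ (1 / 2 : ℝ) := by
    intro x hx
    have h1 := norm_integral_le_of_norm_le (hint x hx) (hae x)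
    have h2 := integral_rpow_mul_exp_neg_mul_Ioi (a := 1 / 2) (r := x) (by norm_num) hx
    have h3 : ∫ v in Ioi (0 : ℝ), A * (v ^ (-(1 / 2) : ℝ) * exp (-x * v)) =
        A * ((1 / x) ^ (1 / 2 : ℝ) * Gamma (1 / 2)) := by
      rw [MeasureTheory.integral_const_mul, ← h2]
      norm_num
    rw [h3] at h1
    rw [abs_mul, abs_of_pos hx]
    have h4 : x * (1 / x) ^ (1 / 2 : ℝ) = x ^ (1 / 2 : ℝ) := by
      rw [one_div, inv_rpow hx.le, ← rpow_neg hx.le]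
      nth_rewrite 1 [← rpow_one x]
      rw [← rpow_add hx]; norm_num
    calc x * |∫ v in Ioi 0, δ v * exp (-x * v)| ≤ x *
        (A * ((1 / x) ^ (1 / 2 : ℝ) * Gamma (1 / 2))) :=
          mul_le_mul_of_nonneg_left h1 hx.le
      _ = A * Gamma (1 / 2) * (x * (1 / x) ^ (1 / 2 : ℝ)) := by ring
      _ = _ := by rw [h4]
  have hzero : Tendsto (fun x : ℝ => x * ∫ v in Ioi 0, δ v * exp (-x * v)) (𝓝[>] 0) (𝓝 0) := by
    have hc : Tendsto (fun x : ℝ => A * Gamma (1 / 2) * x ^ (1 / 2 : ℝ)) (𝓝[>] 0) (𝓝 0) := by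
      have : Continuous (fun x : ℝ => A * Gamma (1 / 2) * x ^ (1 / 2 : ℝ)) :=
        continuous_const.mul (continuous_rpow_const (by norm_num))
      have := this.tendsto 0
      rw [zero_rpow (by norm_num), mul_zero] at this
      exact this.mono_left nhdsWithin_le_nhds
    refine squeeze_zero_norm' ?_ hc
    filter_upwards [self_mem_nhdsWithin] with x hx using hsmall x hx
  have hlim : Tendsto (fun x : ℝ => x * ∫ v in Ioi 0, δ v * exp (-x * v)) (𝓝[>] 0)
      (𝓝 (γ₀ - κ)) := by
    have := tendsto_laplace_lamLogSum.add_const (γ₀ - κ)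
    rw [zero_add] at this
    refine this.congr' ?_
    filter_upwards [self_mem_nhdsWithin] with x hx
    have hx : 0 < x := hx
    have e1 : ∫ v in Ioi (0 : ℝ), lamLogSum v * exp (-x * v) =
        (∫ v in Ioi 0, δ v * exp (-x * v)) + (∫ v in Ioi 0, log v * exp (-x * v)) + κ *
            (1 / x) := by
      have i3 : IntegrableOn (fun v => κ * exp (-x * v)) (Ioi 0) :=
        (integrableOn_exp_mul_Ioi (by linarith) 0).const_mul _
      have i12 : IntegrableOn (fun v => δ v * exp (-x * v) + log v * exp (-x * v)) (Ioi 0) :=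
        (hδint x hx).add (integrable_log_mul_exp hx)
      rw [← integral_exp_neg_mul hx, ← MeasureTheory.integral_const_mul,
        ← integral_add (hδint x hx) (integrable_log_mul_exp hx), ← integral_add i12 i3]
      congr 1
      ext v
      simp only [hδ]
      ring
    have e2 := integral_log_mul_exp hx
    rw [e1, mul_add, mul_add, e2]
    field_simp
    ring
  have := tendsto_nhds_unique hzero hlim
  linarith

end MertensLog

section PrimeSums

theorem sum_vonMangoldt_mul (N : ℕ) (g : ℕ → ℝ) :
    ∑ n ∈ Finset.Icc 1 N, Λ n * g n =
      ∑ p ∈ Nat.primesLE N, ∑ k ∈ Finset.Icc 1 (Nat.log p N), Real.log p * g (p ^ k) := calc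
  _ = ∑ m ∈ ((Finset.Icc 1 N).filter Nat.Prime).biUnion
        fun p => Finset.image (p ^ ·) (Finset.Icc 1 (Nat.log p N)), Λ m * g m := by
    refine (Finset.sum_subset (fun q hq => ?_) fun x hx => ?_).symm
    · simp only [Finset.mem_biUnion, Finset.mem_filter, Finset.mem_Icc, Finset.mem_image] at hq ⊢
      obtain ⟨p, _, k, ⟨_, hk⟩, rfl⟩ := hq
      exact ⟨by grind, Nat.pow_le_of_le_log (by linarith) hk⟩
    · intro h
      rw [mul_eq_zero]
      left
      revert h
      simp only [Finset.mem_biUnion, Finset.mem_filter, Finset.mem_Icc, Finset.mem_image,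
          not_exists, not_and,
        and_imp, ArithmeticFunction.vonMangoldt_eq_zero_iff, isPrimePow_nat_iff]
      contrapose!
      rintro ⟨p, k, hp, hk, rfl⟩
      simp only [Finset.mem_Icc] at hx
      have hpn : p ≤ N := (Nat.le_of_dvd (by lia) (dvd_pow_self p hk.ne')).trans hx.2
      exact ⟨p, hp.one_le, hpn, hp, k, by lia, Nat.le_log_of_pow_le hp.one_lt hx.2, rfl⟩
  _ = ∑ p ∈ Finset.Icc 1 N with p.Prime,
        ∑ q ∈ Finset.image (fun k => p ^ k) (Finset.Icc 1 (Nat.log p N)), Λ q * g q := by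
      rw [Finset.sum_biUnion <| by rw [Finset.pairwiseDisjoint_iff]; grind [Nat.Prime.pow_inj']]
  _ = ∑ p ∈ Nat.primesLE N, ∑ k ∈ Finset.Icc 1 (Nat.log p N), Λ (p ^ k) * g (p ^ k) := by
      refine Finset.sum_congr (Nat.primesLE_eq_filter_Icc_one N).symm fun p hp => ?_
      exact Finset.sum_image fun a _ b _ hab =>
          Nat.pow_right_injective (Nat.two_le_of_mem_primesLE hp) hab
  _ = _ := by
      refine Finset.sum_congr rfl fun p hp => Finset.sum_congr rfl fun k hk => ?_
      rw [ArithmeticFunction.vonMangoldt_apply_pow (by grind),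
          ArithmeticFunction.vonMangoldt_apply_prime <| Nat.prime_of_mem_primesLE hp]

/-- The excess of `∑_{p ≤ N} log p / (p - 1)` over `∑_{n ≤ N} Λ(n) / n`. -/
noncomputable def powTail (N : ℕ) : ℝ :=
  ∑ p ∈ Nat.primesLE N, log p / ((p : ℝ) - 1) - lamSum (log N)

/-- The contribution at `p` of prime powers exceeding `N` to `log (gammaP (primesLE N))`. -/
noncomputable def gainAt (N p : ℕ) : ℝ :=
  log p / ((p : ℝ) - 1) / log N + log (1 - 1 / p) -
    ∑ k ∈ Finset.range (Nat.log p N), (log p / log N - 1 / ((k : ℝ) + 1)) / (p : ℝ) ^ (k + 1)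

noncomputable def gain (N : ℕ) : ℝ := ∑ p ∈ Nat.primesLE N, gainAt N p

theorem lamSum_log_eq {N : ℕ} (hN : 1 ≤ N) : lamSum (log N) =
    ∑ p ∈ Nat.primesLE N, ∑ k ∈ Finset.range (Nat.log p N), log p / (p : ℝ) ^ (k + 1) := by
  rw [lamSum_log_nat N hN]
  have := sum_vonMangoldt_mul N (fun n => 1 / (n : ℝ))
  simp only [mul_one_div] at this
  rw [this]
  refine Finset.sum_congr rfl fun p hp => ?_
  rw [Finset.range_eq_Ico, Finset.sum_Ico_add' (fun k => log (p : ℝ) / (p : ℝ) ^ k) 0 _ 1]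
  push_cast
  rfl

theorem lamLogSum_log_eq {N : ℕ} (hN : 1 ≤ N) : lamLogSum (log N) =
    ∑ p ∈ Nat.primesLE N, ∑ k ∈ Finset.range (Nat.log p N),
        1 / ((k : ℝ) + 1) / (p : ℝ) ^ (k + 1) := by
  rw [lamLogSum, csum, exp_log (by positivity), Nat.floor_natCast]
  have := sum_vonMangoldt_mul N (fun n => 1 / (n : ℝ) / log n)
  simp only [← mul_div_assoc, mul_one] at this
  rw [show ∑ n ∈ Finset.Icc 1 N, lamLog n = ∑ n ∈ Finset.Icc 1 N, Λ n / n / log n from rfl, this]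
  refine Finset.sum_congr rfl fun p hp => ?_
  rw [Finset.range_eq_Ico]
  have h := Finset.sum_Ico_add' (fun k : ℕ => 1 / (k : ℝ) / (p : ℝ) ^ k) 0 (Nat.log p N) 1
  push_cast at h
  rw [h]
  refine Finset.sum_congr rfl fun k hk => ?_
  have hp1 : (1 : ℝ) < p := by exact_mod_cast (Nat.prime_of_mem_primesLE hp).one_lt
  have hl := log_pos hp1
  have hk1 : 1 ≤ k := (Finset.mem_Ico.1 hk).1
  have hk0 : (0 : ℝ) < k := by exact_mod_cast hk1
  push_cast
  rw [log_pow]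
  field_simp

theorem gain_eq {N : ℕ} (hN : 2 ≤ N) : gain N =
    (∑ p ∈ Nat.primesLE N, log p / ((p : ℝ) - 1)) / log N +
      ∑ p ∈ Nat.primesLE N, log (1 - 1 / (p : ℝ)) - lamSum (log N) / log N + lamLogSum (log N) := by
  rw [lamSum_log_eq (by lia), lamLogSum_log_eq (by lia), gain, Finset.sum_div, Finset.sum_div,
    ← Finset.sum_add_distrib, ← Finset.sum_sub_distrib, ← Finset.sum_add_distrib]
  refine Finset.sum_congr rfl fun p hp => ?_
  rw [gainAt, Finset.sum_div, sub_add, ← Finset.sum_sub_distrib]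
  congr 1
  refine Finset.sum_congr rfl fun k _ => ?_
  ring

theorem log_gammaP {N : ℕ} (hN : 2 ≤ N) : log (gammaP (Nat.primesLE N)) + γ₀ =
    log (1 + (err (log N) + powTail N) / log N) - (err (log N) + powTail N) / log N +
      gain N + errTail (log N) := by
  have hN2 : (2 : ℝ) ≤ N := by exact_mod_cast hN
  have hu : 1 / 2 ≤ log N := by
    have := log_two_gt_d9
    have h2 := log_le_log (by norm_num) hN2
    linarith
  have hu0 : 0 < log N := by linarith
  have hprod : ∀ p ∈ Nat.primesLE N, (0 : ℝ) < 1 - 1 / (p : ℝ) := by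
    intro p hp
    have hp1 : (1 : ℝ) < p := by exact_mod_cast (Nat.prime_of_mem_primesLE hp).one_lt
    rw [sub_pos, div_lt_one (by linarith)]
    exact hp1
  have hsum : 0 ≤ ∑ p ∈ Nat.primesLE N, log p / ((p : ℝ) - 1) := by
    refine Finset.sum_nonneg fun p hp => ?_
    have hp1 : (1 : ℝ) < p := by exact_mod_cast (Nat.prime_of_mem_primesLE hp).one_lt
    exact div_nonneg (log_pos hp1).le (by linarith)
  have hγ := one_half_lt_eulerMascheroniConstant
  have hL : 1 + (err (log N) + powTail N) / log N =
      (γ₀ + ∑ p ∈ Nat.primesLE N, log p / ((p : ℝ) - 1)) / log N := by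
    rw [powTail, err]; field_simp; ring
  have hT := lamLogSum_eq hu
  have hg := gain_eq hN
  rw [hT] at hg
  rw [hL, log_div (by linarith) hu0.ne', gammaP,
    log_mul (Finset.prod_pos hprod).ne' (by linarith), log_prod (fun p hp => (hprod p hp).ne'), hg,
    powTail]
  field_simp
  ring

theorem hasSum_gain {N p : ℕ} (hp : p.Prime) :
    HasSum (fun k : ℕ => (log p / log N - 1 / ((k : ℝ) + 1)) / (p : ℝ) ^ (k + 1))
      (log p / ((p : ℝ) - 1) / log N + log (1 - 1 / p)) := by
  have hp1 : (1 : ℝ) < p := by exact_mod_cast hp.one_lt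
  have hx1 : |(1 : ℝ) / p| < 1 := by
    rw [abs_of_pos (by positivity), div_lt_one (by linarith)]; exact hp1
  have h1 := hasSum_pow_div_log_of_abs_lt_one hx1
  have h2 := (hasSum_geometric_of_abs_lt_one hx1).mul_left (log p / log N * (1 / p))
  have h3 := h2.sub h1
  have hpm : (p : ℝ) - 1 ≠ 0 := by linarith
  have hp0 : (p : ℝ) ≠ 0 := by linarith
  have he : log p / log N * (1 / p) * (1 - 1 / (p : ℝ))⁻¹ - -log (1 - 1 / p) =
      log p / ((p : ℝ) - 1) / log N + log (1 - 1 / p) := by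
    have : 1 - 1 / (p : ℝ) = (p - 1) / p := by field_simp
    rw [sub_neg_eq_add]
    congr 1
    rw [this, inv_div]
    field_simp
  rw [he] at h3
  refine h3.congr_fun ?_ |> fun h => h
  intro k
  rw [one_div_pow, one_div_pow, pow_succ]
  field_simp

theorem gain_term_nonneg {N p k : ℕ} (hN : 2 ≤ N) (hp : p.Prime) (hk : Nat.log p N ≤ k) :
    0 ≤ (log p / log N - 1 / ((k : ℝ) + 1)) / (p : ℝ) ^ (k + 1) := by
  refine div_nonneg ?_ (by positivity)
  have h1 : N < p ^ (k + 1) := Nat.lt_pow_of_log_lt hp.one_lt (by lia)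
  have hN1 : (1 : ℝ) < N := by exact_mod_cast hN
  have h2 : log N ≤ ((k : ℝ) + 1) * log p := by
    have := log_le_log (by linarith) (show (N : ℝ) ≤ (p : ℝ) ^ (k + 1) by exact_mod_cast h1.le)
    rw [log_pow] at this
    push_cast at this
    exact this
  rw [sub_nonneg, div_le_div_iff₀ (by positivity) (log_pos hN1)]
  linarith

theorem sum_le_gainAt {N p : ℕ} (hN : 2 ≤ N) (hp : p.Prime) (A : Finset ℕ)
    (hA : ∀ k ∈ A, Nat.log p N ≤ k) :
    ∑ k ∈ A, (log p / log N - 1 / ((k : ℝ) + 1)) / (p : ℝ) ^ (k + 1) ≤ gainAt N p := by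
  have hd : Disjoint (Finset.range (Nat.log p N)) A := by
    rw [Finset.disjoint_left]
    intro k hk hk'
    have := hA k hk'
    rw [Finset.mem_range] at hk
    lia
  have h := sum_le_hasSum (Finset.range (Nat.log p N) ∪ A) (fun k hk => ?_)
      (hasSum_gain (N := N) hp)
  · rw [Finset.sum_union hd] at h
    rw [gainAt]
    linarith
  · refine gain_term_nonneg hN hp ?_
    by_contra hlt
    exact hk (Finset.mem_union_left _ (Finset.mem_range.2 (by lia)))

theorem powTail_eq {N : ℕ} (hN : 1 ≤ N) : powTail N =
    ∑ p ∈ Nat.primesLE N, log p / ((p : ℝ) ^ Nat.log p N * (p - 1)) := by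
  rw [powTail, lamSum_log_eq hN, ← Finset.sum_sub_distrib]
  refine Finset.sum_congr rfl fun p hp => ?_
  have hp1 : (1 : ℝ) < p := by exact_mod_cast (Nat.prime_of_mem_primesLE hp).one_lt
  have hpm : (p : ℝ) - 1 ≠ 0 := by linarith
  have hp0 : (p : ℝ) ≠ 0 := by linarith
  generalize Nat.log p N = K
  induction K with
  | zero => simp
  | succ K ih =>
    rw [Finset.sum_range_succ, ← sub_sub, ih]
    field_simp
    ring

theorem gain_le {N : ℕ} (hN : 2 ≤ N) : gain N ≤ powTail N / log N := by
  have hN1 : (1 : ℝ) < N := by exact_mod_cast hN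
  have hu := log_pos hN1
  rw [gain_eq hN, powTail, sub_div, lamLogSum_log_eq (by lia)]
  have : ∑ p ∈ Nat.primesLE N, log (1 - 1 / (p : ℝ)) + ∑ p ∈ Nat.primesLE N,
      ∑ k ∈ Finset.range (Nat.log p N), 1 / ((k : ℝ) + 1) / (p : ℝ) ^ (k + 1) ≤ 0 := by
    rw [← Finset.sum_add_distrib]
    refine Finset.sum_nonpos fun p hp => ?_
    have hp1 : (1 : ℝ) < p := by exact_mod_cast (Nat.prime_of_mem_primesLE hp).one_lt
    have hx1 : |(1 : ℝ) / p| < 1 := by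
      rw [abs_of_pos (by positivity), div_lt_one (by linarith)]; exact hp1
    have h1 := sum_le_hasSum (Finset.range (Nat.log p N)) (fun k _ => by positivity)
      (hasSum_pow_div_log_of_abs_lt_one hx1)
    have h2 : ∑ k ∈ Finset.range (Nat.log p N), 1 / ((k : ℝ) + 1) / (p : ℝ) ^ (k + 1) =
        ∑ k ∈ Finset.range (Nat.log p N), (1 / (p : ℝ)) ^ (k + 1) / ((k : ℝ) + 1) := by
      refine Finset.sum_congr rfl fun k _ => ?_
      rw [one_div_pow]; field_simp
    rw [h2]
    linarith
  linarith

end PrimeSums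

section PrimeBounds

theorem err_intervalIntegrable (a b : ℝ) : IntervalIntegrable err volume a b := by
  have key : ∀ a b, a ≤ b → IntervalIntegrable err volume a b := fun a b hab => by
    have h := csum_intervalIntegrable (c := fun n => Λ n / n) (g := fun _ => 1) hab (by fun_prop)
    simp only [mul_one] at h
    exact (h.sub (continuous_id.intervalIntegrable a b)).add intervalIntegrable_const
  rcases le_total a b with h | h
  · exact key a b h
  · exact (key b a h).symm

theorem abel_lam {a u : ℝ} (hau : a ≤ u) {g g' : ℝ → ℝ} (hg : ∀ v, HasDerivAt g (g' v) v)
    (hg' : Continuous g') :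
    ∑ n ∈ Finset.Ioc ⌊exp a⌋₊ ⌊exp u⌋₊, Λ n / n * g (log n) =
      (∫ v in a..u, g v) + err u * g u - err a * g a - ∫ v in a..u, err v * g' v := by
  have h := abel_sum (fun n => Λ n / n) hau (fun v _ => hg v) hg'.continuousOn
  rw [h]
  have hgc : Continuous g := continuous_iff_continuousAt.2 fun v => (hg v).continuousAt
  have i1 : IntervalIntegrable (fun v => err v * g' v) volume a u :=
    (err_intervalIntegrable a u).mul_continuousOn hg'.continuousOn
  have i2 : IntervalIntegrable (fun v => (v - γ₀) * g' v) volume a u :=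
    (by fun_prop : Continuous fun v => (v - γ₀) * g' v).intervalIntegrable _ _
  have e1 : ∫ v in a..u, csum (fun n => Λ n / n) v * g' v =
      (∫ v in a..u, err v * g' v) + ∫ v in a..u, (v - γ₀) * g' v := by
    rw [← intervalIntegral.integral_add i1 i2]
    refine integral_congr fun v _ => ?_
    simp only [err, lamSum]; ring
  have e2 : ∫ v in a..u, (v - γ₀) * g' v = (u - γ₀) * g u - (a - γ₀) * g a - ∫ v in a..u, g v := by
    have := integral_mul_deriv_eq_deriv_mul (a := a) (b := u) (u := fun v => v - γ₀) (v := g)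
      (u' := fun _ => 1) (v' := g') (fun v _ => (hasDerivAt_id v).sub_const γ₀) (fun v _ => hg v)
      intervalIntegrable_const (hg'.intervalIntegrable _ _)
    simpa using this
  rw [e1, e2]
  simp only [err, lamSum]
  ring

theorem sum_lam_div_sq_le {a u ε : ℝ} (hau : a ≤ u) (hε : ∀ v, a ≤ v → |err v| ≤ ε) :
    ∑ n ∈ Finset.Ioc ⌊exp a⌋₊ ⌊exp u⌋₊, Λ n / n / n ≤ (1 + 2 * ε) * exp (-a) := by
  have hd : ∀ v : ℝ, HasDerivAt (fun v => exp (-v)) (-exp (-v)) v := fun v => by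
    simpa using (hasDerivAt_neg v).exp
  have h := abel_lam hau hd (by fun_prop)
  have e0 : ∑ n ∈ Finset.Ioc ⌊exp a⌋₊ ⌊exp u⌋₊, Λ n / n / n =
      ∑ n ∈ Finset.Ioc ⌊exp a⌋₊ ⌊exp u⌋₊, Λ n / n * exp (-log n) := by
    refine Finset.sum_congr rfl fun n hn => ?_
    have : (0 : ℝ) < n := by exact_mod_cast (by have := (Finset.mem_Ioc.1 hn).1; lia : 0 < n)
    rw [exp_neg, exp_log this, div_eq_mul_inv (Λ n / n)]
  have e1 : ∫ v in a..u, exp (-v) = exp (-a) - exp (-u) := by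
    rw [integral_eq_sub_of_hasDerivAt (f := fun v => -exp (-v))
      (fun v _ => ((hd v).neg).congr_deriv (by ring))
      ((by fun_prop : Continuous fun v : ℝ => exp (-v)).intervalIntegrable _ _)]
    ring
  have e2 : -∫ v in a..u, err v * -exp (-v) ≤ ε * (exp (-a) - exp (-u)) := by
    rw [← e1, ← intervalIntegral.integral_neg, ← intervalIntegral.integral_const_mul]
    refine integral_mono_on hau ?_ ?_ fun v hv => ?_
    · exact ((err_intervalIntegrable a u).mul_continuousOn (by fun_prop)).neg
    · exact (by fun_prop : Continuous fun v : ℝ => ε * exp (-v)).intervalIntegrable _ _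
    · have := (abs_le.1 (hε v hv.1)).2
      nlinarith [exp_pos (-v)]
  have b1 := (abs_le.1 (hε u hau)).2
  have b2 := (abs_le.1 (hε a le_rfl)).1
  have p1 := exp_pos (-u)
  have p2 := exp_pos (-a)
  rw [e0, h, e1]
  nlinarith

theorem exp_half_log {N : ℕ} (hN : 1 ≤ N) : exp (log N / 2) ^ 2 = N := by
  rw [← exp_nat_mul]
  push_cast
  rw [mul_div_cancel₀ _ two_ne_zero, exp_log (by exact_mod_cast hN)]

theorem powTail_le {N : ℕ} (hN : 4 ≤ N) {ε : ℝ} (hε : ∀ v, log N / 2 ≤ v → |err v| ≤ ε) :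
    powTail N ≤ log 4 / exp (log N / 2) + 2 * lamSum (log N / 2) / exp (log N / 2) ^ 2 +
      (1 + 2 * ε) / (exp (log N / 2) - 1) := by
  set s := log N / 2 with hs
  set y := exp s with hy
  have hN0 : (4 : ℝ) ≤ N := by exact_mod_cast hN
  have hyN : y ^ 2 = N := exp_half_log (by lia)
  have hy2 : 2 ≤ y := by
    have : 0 < y := exp_pos s
    nlinarith
  have hs0 : 0 < s := by rw [hs]; have := log_pos (show (1 : ℝ) < N by linarith); linarith
  set M := ⌊y⌋₊ with hM
  have hMN : M ≤ N := by
    have h1 : (M : ℝ) ≤ y := Nat.floor_le (by linarith)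
    have h2 : (M : ℝ) ≤ N := by nlinarith
    exact_mod_cast h2
  rw [powTail_eq (by lia)]
  have hterm : ∀ p ∈ Nat.primesLE N, log p / ((p : ℝ) ^ Nat.log p N * (p - 1)) ≤
      (if p ≤ M then (log p + 2 * (log p / p)) / N else 0) +
      (if M < p then y / (y - 1) * (log p / p / p) else 0) := by
    intro p hp
    obtain ⟨hpN, hpp⟩ := Nat.mem_primesLE.1 hp
    have hp2 : (2 : ℝ) ≤ p := by exact_mod_cast hpp.two_le
    have hlp : 0 ≤ log p := log_nonneg (by linarith)
    by_cases h : p ≤ M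
    · rw [if_pos h, if_neg (by lia), add_zero]
      have h1 : (N : ℝ) ≤ (p : ℝ) ^ Nat.log p N * p := by
        rw [← pow_succ]
        exact_mod_cast (Nat.lt_pow_of_log_lt hpp.one_lt (Nat.lt_succ_self _)).le
      have h2 : log p + 2 * (log p / p) ≥ log p * (p / (p - 1)) := by
        have : (p : ℝ) / (p - 1) ≤ 1 + 2 / p := by
          rw [div_le_iff₀ (by linarith)]
          have : (1 + 2 / (p : ℝ)) * (p - 1) = p + (1 - 2 / p) := by field_simp; ring
          rw [this]
          have : 2 / (p : ℝ) ≤ 1 := by rw [div_le_one (by linarith)]; exact hp2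
          linarith
        calc log p * (p / (p - 1)) ≤ log p * (1 + 2 / p) := by gcongr
          _ = _ := by ring
      rw [div_le_div_iff₀ (mul_pos (by positivity) (by linarith)) (by linarith)]
      calc log p * N ≤ log p * ((p : ℝ) ^ Nat.log p N * p) := by gcongr
        _ = log p * (p / (p - 1)) * ((p : ℝ) ^ Nat.log p N * (p - 1)) := by
          have : (p : ℝ) - 1 ≠ 0 := by linarith
          field_simp
        _ ≤ _ := by
          refine mul_le_mul_of_nonneg_right h2 (mul_nonneg (by positivity) (by linarith))
    · rw [if_neg h, if_pos (by lia), zero_add]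
      have hpy : y < p := by
        have := Nat.lt_of_floor_lt (show ⌊y⌋₊ < p by lia)
        exact this
      have hK : 1 ≤ Nat.log p N := Nat.log_pos hpp.one_lt hpN
      have h1 : (p : ℝ) ≤ (p : ℝ) ^ Nat.log p N := le_self_pow₀ (by linarith) (by lia)
      have hyy : 0 < y - 1 := by linarith
      have hpm : 0 < (p : ℝ) - 1 := by linarith
      calc log p / ((p : ℝ) ^ Nat.log p N * (p - 1)) ≤ log p / (p * (p - 1)) := by gcongr
        _ = p / (p - 1) * (log p / p / p) := by field_simp
        _ ≤ y / (y - 1) * (log p / p / p) := by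
          refine mul_le_mul_of_nonneg_right ?_ (by positivity)
          rw [div_le_div_iff₀ hpm hyy]
          linarith
  refine (Finset.sum_le_sum hterm).trans ?_
  rw [Finset.sum_add_distrib, ← Finset.sum_filter, ← Finset.sum_filter, ← Finset.sum_div,
    Finset.sum_add_distrib, ← Finset.mul_sum, ← Finset.mul_sum]
  have t1 : ∑ p ∈ (Nat.primesLE N).filter (fun p => p ≤ M), log p ≤ log 4 * y := by
    have := Chebyshev.theta_le_log4_mul_x (x := y) (by linarith)
    refine le_trans (le_of_eq ?_) this
    rw [Chebyshev.theta]
    refine Finset.sum_congr ?_ fun _ _ => rfl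
    ext p
    simp only [Finset.mem_filter, Nat.mem_primesLE, Finset.mem_Ioc]
    constructor
    · rintro ⟨⟨_, h⟩, h'⟩; exact ⟨⟨h.pos, h'⟩, h⟩
    · rintro ⟨⟨_, h⟩, h'⟩; exact ⟨⟨h.trans hMN, h'⟩, h⟩
  have t2 : ∑ p ∈ (Nat.primesLE N).filter (fun p => p ≤ M), log p / p ≤ lamSum s := by
    rw [lamSum, csum]
    calc _ = ∑ p ∈ (Nat.primesLE N).filter (fun p => p ≤ M), Λ p / p := by
          refine Finset.sum_congr rfl fun p hp => ?_
          rw [ArithmeticFunction.vonMangoldt_apply_prime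
            (Nat.mem_primesLE.1 (Finset.mem_filter.1 hp).1).2]
      _ ≤ _ := by
          refine Finset.sum_le_sum_of_subset_of_nonneg ?_ fun n _ _ => lam_div_nonneg n
          intro p hp
          obtain ⟨h1, h2⟩ := Finset.mem_filter.1 hp
          exact Finset.mem_Icc.2 ⟨(Nat.mem_primesLE.1 h1).2.pos, h2⟩
  have t3 : ∑ p ∈ (Nat.primesLE N).filter (fun p => M < p), log p / p / p ≤
      (1 + 2 * ε) * exp (-s) := by
    have hsu : s ≤ log N := by linarith
    refine le_trans ?_ (sum_lam_div_sq_le hsu hε)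
    rw [exp_log (by linarith : (0 : ℝ) < N), Nat.floor_natCast]
    calc _ = ∑ p ∈ (Nat.primesLE N).filter (fun p => M < p), Λ p / p / p := by
          refine Finset.sum_congr rfl fun p hp => ?_
          rw [ArithmeticFunction.vonMangoldt_apply_prime
            (Nat.mem_primesLE.1 (Finset.mem_filter.1 hp).1).2]
      _ ≤ _ := by
          refine Finset.sum_le_sum_of_subset_of_nonneg ?_ fun n _ _ =>
            div_nonneg (lam_div_nonneg n) (by positivity)
          intro p hp
          obtain ⟨h1, h2⟩ := Finset.mem_filter.1 hp
          exact Finset.mem_Ioc.2 ⟨h2, (Nat.mem_primesLE.1 h1).1⟩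
  have hyinv : exp (-s) = 1 / y := by rw [exp_neg, one_div]
  rw [hyinv] at t3
  have hyy : 0 < y - 1 := by linarith
  have a1 : (∑ p ∈ (Nat.primesLE N).filter (fun p => p ≤ M), log p +
      2 * ∑ p ∈ (Nat.primesLE N).filter (fun p => p ≤ M), log p / p) / N ≤
      (log 4 * y + 2 * lamSum s) / N := by gcongr
  have a2 : y / (y - 1) * ∑ p ∈ (Nat.primesLE N).filter (fun p => M < p), log p / p / p ≤
      y / (y - 1) * ((1 + 2 * ε) * (1 / y)) := by gcongr
  have a3 : (log 4 * y + 2 * lamSum s) / N = log 4 / y + 2 * lamSum s / y ^ 2 := by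
    rw [← hyN]; field_simp
  have a4 : y / (y - 1) * ((1 + 2 * ε) * (1 / y)) = (1 + 2 * ε) / (y - 1) := by field_simp
  linarith

theorem sum_lam_weight_ge {s ε : ℝ} (hs : 1 ≤ s) (hε : ∀ v, s ≤ v → |err v| ≤ ε) :
    exp (-s) * (1 - (1 + s) * exp (-s) - 2 * exp (-1) * ε) ≤
      ∑ n ∈ Finset.Ioc ⌊exp s⌋₊ ⌊exp (2 * s)⌋₊, Λ n / n * ((log n - s) / n) := by
  have hsu : s ≤ 2 * s := by linarith
  have hd : ∀ v : ℝ, HasDerivAt (fun v => (v - s) * exp (-v)) ((1 + s - v) * exp (-v)) v :=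
    fun v => by
    have h1 : HasDerivAt (fun v : ℝ => exp (-v)) (-exp (-v)) v := by
      simpa using (hasDerivAt_neg v).exp
    exact (((hasDerivAt_id v).sub_const s).mul h1).congr_deriv (by simp; ring)
  have h := abel_lam hsu hd (by fun_prop)
  have e0 : ∑ n ∈ Finset.Ioc ⌊exp s⌋₊ ⌊exp (2 * s)⌋₊, Λ n / n * ((log n - s) / n) =
      ∑ n ∈ Finset.Ioc ⌊exp s⌋₊ ⌊exp (2 * s)⌋₊, Λ n / n * ((log n - s) * exp (-log n)) := by
    refine Finset.sum_congr rfl fun n hn => ?_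
    have : (0 : ℝ) < n := by exact_mod_cast (by have := (Finset.mem_Ioc.1 hn).1; lia : 0 < n)
    rw [exp_neg, exp_log this, div_eq_mul_inv (log n - s)]
  have e1 : ∫ v in s..2 * s, (v - s) * exp (-v) = exp (-s) - (1 + s) * exp (-(2 * s)) := by
    rw [integral_eq_sub_of_hasDerivAt (f := fun v => -((v - s + 1) * exp (-v))) (fun v _ => ?_)
      ((by fun_prop : Continuous fun v : ℝ => (v - s) * exp (-v)).intervalIntegrable _ _)]
    · ring
    · have h1 : HasDerivAt (fun v : ℝ => exp (-v)) (-exp (-v)) v := by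
        simpa using (hasDerivAt_neg v).exp
      exact ((((hasDerivAt_id v).sub_const s).add_const 1).mul h1).neg.congr_deriv (by simp; ring)
  have hint : ∀ a b, IntervalIntegrable (fun v => err v * ((1 + s - v) * exp (-v))) volume a b :=
    fun a b => (err_intervalIntegrable a b).mul_continuousOn (by fun_prop)
  have hcont : Continuous fun v : ℝ => (1 + s - v) * exp (-v) := by fun_prop
  have e2 : ∫ v in s..(s + 1), err v * ((1 + s - v) * exp (-v)) ≤ ε * exp (-(s + 1)) := by
    have : ε * exp (-(s + 1)) = ∫ v in s..(s + 1), ε * ((1 + s - v) * exp (-v)) := by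
      rw [intervalIntegral.integral_const_mul,
        integral_eq_sub_of_hasDerivAt (fun v _ => hd v) (hcont.intervalIntegrable _ _)]
      ring
    rw [this]
    refine integral_mono_on (by linarith) (hint _ _)
      ((hcont.const_mul ε).intervalIntegrable _ _) fun v hv => ?_
    refine mul_le_mul_of_nonneg_right (abs_le.1 (hε v hv.1)).2
      (mul_nonneg (by linarith [hv.2]) (exp_pos _).le)
  have e3 : ∫ v in (s + 1)..(2 * s), err v * ((1 + s - v) * exp (-v)) ≤
      ε * (exp (-(s + 1)) - s * exp (-(2 * s))) := by
    have : ε * (exp (-(s + 1)) - s * exp (-(2 * s))) =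
        ∫ v in (s + 1)..(2 * s), -ε * ((1 + s - v) * exp (-v)) := by
      rw [intervalIntegral.integral_const_mul,
        integral_eq_sub_of_hasDerivAt (fun v _ => hd v) (hcont.intervalIntegrable _ _)]
      ring
    rw [this]
    refine integral_mono_on (by linarith) (hint _ _)
      ((hcont.const_mul (-ε)).intervalIntegrable _ _) fun v hv => ?_
    refine mul_le_mul_of_nonpos_right (abs_le.1 (hε v (by linarith [hv.1]))).1
      (mul_nonpos_of_nonpos_of_nonneg (by linarith [hv.1]) (exp_pos _).le)
  have e4 := integral_add_adjacent_intervals (hint s (s + 1)) (hint (s + 1) (2 * s))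
  have b1 := (abs_le.1 (hε (2 * s) hsu)).1
  have p1 : exp (-(2 * s)) = exp (-s) * exp (-s) := by rw [← exp_add]; ring_nf
  have p2 : exp (-(s + 1)) = exp (-s) * exp (-1) := by rw [← exp_add]; ring_nf
  have p3 := exp_pos (-s)
  rw [e0, h, e1, ← e4]
  have b3 : -ε * ((2 * s - s) * exp (-(2 * s))) ≤ err (2 * s) * ((2 * s - s) * exp (-(2 * s))) :=
    mul_le_mul_of_nonneg_right b1 (mul_nonneg (by linarith) (exp_pos _).le)
  rw [p2] at e2 e3
  rw [p1] at e3 b3 ⊢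
  nlinarith

theorem gain_ge {N : ℕ} (hN : 8 ≤ N) {ε : ℝ} (hε : ∀ v, log N / 2 ≤ v → |err v| ≤ ε) :
    exp (-(log N / 2)) * (1 - (1 + log N / 2) * exp (-(log N / 2)) - 2 * exp (-1) * ε) ≤
      log N ^ 2 * gain N := by
  have hN0 : (8 : ℝ) ≤ N := by exact_mod_cast hN
  have hs : 1 ≤ log N / 2 := by
    have h1 := log_le_log (by norm_num) hN0
    have h2 : log 8 = 3 * log 2 := by
      rw [show (8 : ℝ) = 2 ^ 3 by norm_num, log_pow]; norm_num
    have := log_two_gt_d9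
    linarith
  have hu : 0 < log N := by linarith
  have h := sum_lam_weight_ge hs hε
  rw [mul_div_cancel₀ _ two_ne_zero, exp_log (by linarith : (0 : ℝ) < N), Nat.floor_natCast] at h
  refine h.trans ?_
  set s := log N / 2 with hsdef
  set M := ⌊exp s⌋₊ with hM
  have h1 : ∑ n ∈ Finset.Ioc M N, Λ n / n * ((log n - s) / n) =
      ∑ n ∈ Finset.Icc 1 N, Λ n * (if M < n then (log n - s) / n / n else 0) := by
    simp only [mul_ite, mul_zero]
    rw [← Finset.sum_filter]
    refine Finset.sum_congr ?_ fun n _ => by ring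
    ext n
    simp only [Finset.mem_Ioc, Finset.mem_filter, Finset.mem_Icc]
    lia
  rw [h1, sum_vonMangoldt_mul, gain, Finset.mul_sum]
  refine Finset.sum_le_sum fun p hp => ?_
  obtain ⟨hpN, hpp⟩ := Nat.mem_primesLE.1 hp
  have hp2 : (2 : ℝ) ≤ p := by exact_mod_cast hpp.two_le
  have hlp : 0 < log p := log_pos (by linarith)
  set B := (Finset.Icc 1 (Nat.log p N)).filter (fun j => M < p ^ j) with hB
  have hBmem : ∀ j ∈ B, 1 ≤ j ∧ p ^ j ≤ N ∧ s < j * log p := by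
    intro j hj
    obtain ⟨hj1, hj2⟩ := Finset.mem_filter.1 hj
    obtain ⟨hj3, hj4⟩ := Finset.mem_Icc.1 hj1
    refine ⟨hj3, Nat.pow_le_of_le_log (by lia) hj4, ?_⟩
    have : exp s < (p ^ j : ℕ) := Nat.lt_of_floor_lt hj2
    have hpj : (0 : ℝ) < (p ^ j : ℕ) := (exp_pos s).trans this
    have := (lt_log_iff_exp_lt hpj).2 this
    push_cast at this
    rwa [log_pow] at this
  have hinj : Set.InjOn (fun j : ℕ => 2 * j - 1) B := by
    intro a ha b hb hab
    have := (hBmem a ha).1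
    have := (hBmem b hb).1
    simp only at hab
    lia
  have hA := sum_le_gainAt (N := N) (by lia) hpp (B.image fun j => 2 * j - 1) (by
    intro k hk
    obtain ⟨j, hj, rfl⟩ := Finset.mem_image.1 hk
    obtain ⟨hj1, hj2, hj3⟩ := hBmem j hj
    have : Nat.log p N < 2 * j := by
      rw [Nat.log_lt_iff_lt_pow hpp.one_lt (by lia)]
      have hlog : log N < log ((p : ℝ) ^ (2 * j)) := by
        rw [log_pow]; push_cast; linarith
      have := (log_lt_log_iff (by linarith) (by positivity)).1 hlog
      exact_mod_cast this
    lia)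
  rw [Finset.sum_image hinj] at hA
  refine le_trans ?_ (mul_le_mul_of_nonneg_left hA (sq_nonneg _))
  rw [Finset.mul_sum]
  simp only [mul_ite, mul_zero]
  rw [← Finset.sum_filter, ← hB]
  refine Finset.sum_le_sum fun j hj => ?_
  obtain ⟨hj1, hj2, hj3⟩ := hBmem j hj
  have hj0 : (0 : ℝ) < j := by exact_mod_cast hj1
  have e1 : 2 * j - 1 + 1 = 2 * j := by lia
  have e2 : ((2 * j - 1 : ℕ) : ℝ) + 1 = 2 * j := by
    rw [← Nat.cast_add_one, e1]; push_cast; ring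
  rw [e1, e2]
  push_cast
  rw [log_pow]
  have hjN : j * log p ≤ log N := by
    have := log_le_log (by positivity) (show ((p : ℝ) ^ j) ≤ N by exact_mod_cast hj2)
    rwa [log_pow] at this
  have key : log p * ((j * log p - s) / (p : ℝ) ^ j / (p : ℝ) ^ j) =
      ((j * log p - s) * log p) / (p : ℝ) ^ (2 * j) := by
    rw [two_mul, pow_add]; field_simp
  have key2 : log N ^ 2 * ((log p / log N - 1 / (2 * j)) / (p : ℝ) ^ (2 * j)) =
      (log N * (j * log p - s) / j) / (p : ℝ) ^ (2 * j) := by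
    rw [hsdef]; field_simp
  rw [key, key2]
  refine div_le_div_of_nonneg_right ?_ (by positivity)
  rw [le_div_iff₀ hj0]
  have : 0 ≤ j * log p - s := by linarith
  nlinarith

end PrimeBounds

section LaplaceAnalytic

theorem mul_exp_le {ε v : ℝ} (hε : 0 < ε) : v ≤ 1 / ε * exp (ε * v) := by
  have h1 := add_one_le_exp (ε * v)
  rw [div_mul_eq_mul_div, one_mul, le_div_iff₀ hε]
  linarith

theorem hasDerivAt_laplace {φ : ℝ → ℝ} (hφ : Measurable φ) {a b : ℝ} (ha : 0 ≤ a)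
    (hint : ∀ x, b < x → IntegrableOn (fun v => φ v * exp (-x * v)) (Ioi a)) {s : ℂ}
    (hs : b < s.re) :
    IntegrableOn (fun v : ℝ => (φ v : ℂ) * (-v * Complex.exp (-s * v))) (Ioi a) ∧
    HasDerivAt (fun z : ℂ => ∫ v in Ioi a, (φ v : ℂ) * Complex.exp (-z * v))
      (∫ v in Ioi a, (φ v : ℂ) * (-v * Complex.exp (-s * v))) s := by
  set ε := (s.re - b) / 3 with hε
  have hε0 : 0 < ε := by rw [hε]; linarith
  have hφc : Measurable fun v => (φ v : ℂ) := Complex.measurable_ofReal.comp hφ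
  have hnorm : ∀ (z : ℂ) (v : ℝ), ‖Complex.exp (-z * v)‖ = exp (-z.re * v) := fun z v => by
    rw [Complex.norm_exp]; congr 1; simp
  have hb1 := ((hint (s.re - 2 * ε) (by rw [hε]; linarith)).norm).const_mul (1 / ε)
  refine hasDerivAt_integral_of_dominated_loc_of_deriv_le (Metric.ball_mem_nhds s hε0) (bound :=
    fun v => 1 / ε * ‖φ v * exp (-(s.re - 2 * ε) * v)‖)
    (F := fun z v => (φ v : ℂ) * Complex.exp (-z * v))
    (F' := fun z v => (φ v : ℂ) * (-v * Complex.exp (-z * v))) ?_ ?_ ?_ ?_ hb1 ?_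
  · exact Eventually.of_forall fun z => (hφc.mul (by fun_prop)).aestronglyMeasurable
  · refine (hint s.re hs).norm.mono' (hφc.mul (by fun_prop)).aestronglyMeasurable ?_
    refine Eventually.of_forall fun v => ?_
    rw [norm_mul, norm_mul, hnorm, Complex.norm_real, norm_of_nonneg (exp_pos _).le]
  · exact (hφc.mul (by fun_prop)).aestronglyMeasurable
  · filter_upwards [ae_restrict_mem measurableSet_Ioi] with v hv z hz
    have hv0 : 0 ≤ v := ha.trans (le_of_lt hv)
    have hz1 : s.re - ε ≤ z.re := by
      have h1 := Complex.abs_re_le_norm (z - s)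
      rw [Metric.mem_ball, dist_eq_norm] at hz
      rw [Complex.sub_re] at h1
      have := (abs_le.1 h1).1
      linarith
    rw [norm_mul, norm_mul, norm_mul, hnorm, Complex.norm_real, norm_neg, Complex.norm_real,
      norm_of_nonneg hv0, norm_of_nonneg (exp_pos (-(s.re - 2 * ε) * v)).le, ← mul_assoc,
      mul_comm (1 / ε), mul_assoc, mul_assoc]
    refine mul_le_mul_of_nonneg_left ?_ (norm_nonneg _)
    calc v * exp (-z.re * v) ≤ (1 / ε * exp (ε * v)) * exp (-(s.re - ε) * v) := by
          refine mul_le_mul (mul_exp_le hε0) (exp_le_exp.2 ?_) (exp_pos _).le (by positivity)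
          nlinarith
      _ = _ := by rw [mul_assoc, ← exp_add, mul_comm]; ring_nf
  · refine Eventually.of_forall fun v z _ => ?_
    have h1 : HasDerivAt (fun z : ℂ => -z * (v : ℂ)) (-1 * v) z := (hasDerivAt_neg z).mul_const _
    exact (h1.cexp.const_mul _).congr_deriv (by ring)

theorem differentiableOn_laplace {φ : ℝ → ℝ} (hφ : Measurable φ) {a b : ℝ} (ha : 0 ≤ a)
    (hint : ∀ x, b < x → IntegrableOn (fun v => φ v * exp (-x * v)) (Ioi a)) :
    DifferentiableOn ℂ (fun z : ℂ => ∫ v in Ioi a, (φ v : ℂ) * Complex.exp (-z * v))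
      {z | b < z.re} := fun _ hz =>
  (hasDerivAt_laplace hφ ha hint hz).2.differentiableAt.differentiableWithinAt

theorem laplace_integrable_real {φ : ℝ → ℝ} (hφ : Measurable φ) {a A b : ℝ}
    (hb : ∀ v, a < v → |φ v| ≤ A * exp (b * v)) {x : ℝ} (hx : b < x) :
    IntegrableOn (fun v : ℝ => φ v * exp (-x * v)) (Ioi a) := by
  have h := (laplace_integrable hφ hb (s := (x : ℂ)) (by simpa using hx)).norm
  refine h.mono' (hφ.mul (by fun_prop)).aestronglyMeasurable (Eventually.of_forall fun v => ?_)
  rw [norm_mul, norm_mul, Complex.norm_exp, Complex.norm_real, norm_of_nonneg (exp_pos _).le]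
  simp

theorem isOpen_re_gt (b : ℝ) : IsOpen {z : ℂ | b < z.re} :=
  isOpen_lt continuous_const Complex.continuous_re

theorem isPreconnected_re_gt (b : ℝ) : IsPreconnected {z : ℂ | b < z.re} :=
  (convex_halfSpace_re_gt b).isPreconnected

theorem eqOn_re_gt {f g : ℂ → ℂ} {b c : ℝ} (hf : DifferentiableOn ℂ f {z | b < z.re})
    (hg : DifferentiableOn ℂ g {z | b < z.re}) (hfg : ∀ z : ℂ, c < z.re → f z = g z) :
    ∀ z : ℂ, b < z.re → f z = g z := by
  intro z hz
  have h0 : ((max b c + 1 : ℝ) : ℂ) ∈ {z : ℂ | b < z.re} := by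
    simp only [mem_ofPred_eq, Complex.ofReal_re]; linarith [le_max_left b c]
  refine (hf.analyticOnNhd (isOpen_re_gt b)).eqOn_of_preconnected_of_eventuallyEq
    (hg.analyticOnNhd (isOpen_re_gt b)) (isPreconnected_re_gt b) h0 ?_ hz
  filter_upwards [(isOpen_re_gt c).mem_nhds (show ((max b c + 1 : ℝ) : ℂ) ∈ {z : ℂ | c < z.re} by
    simp only [mem_ofPred_eq, Complex.ofReal_re]; linarith [le_max_right b c])] with w hw
  exact hfg w hw

/-- The Laplace transform of the fractional part of `exp v`. -/
noncomputable def fractLaplace (s : ℂ) : ℂ :=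
  ∫ v in Ioi (0 : ℝ), ((Int.fract (exp v) : ℝ) : ℂ) * Complex.exp (-s * v)

theorem measurable_fract_exp : Measurable fun v : ℝ => Int.fract (exp v) :=
  measurable_fract.comp measurable_exp

theorem abs_fract_exp_le (v : ℝ) : |Int.fract (exp v)| ≤ 1 * exp (0 * v) := by
  rw [abs_of_nonneg (Int.fract_nonneg _)]
  simpa using (Int.fract_lt_one _).le

theorem differentiableOn_fractLaplace : DifferentiableOn ℂ fractLaplace {z | 0 < z.re} :=
  differentiableOn_laplace measurable_fract_exp le_rfl fun _ hx =>
    laplace_integrable_real measurable_fract_exp (fun v _ => abs_fract_exp_le v) hx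

theorem norm_fractLaplace_le {s : ℂ} (hs : 0 < s.re) : ‖fractLaplace s‖ ≤ 1 / s.re := by
  rw [← integral_exp_neg_mul hs]
  refine norm_integral_le_of_norm_le (integrableOn_exp_mul_Ioi (by linarith) 0)
    (Eventually.of_forall fun v => ?_)
  rw [norm_mul, Complex.norm_real, Complex.norm_exp, Real.norm_eq_abs]
  have h1 : (-s * v).re = -s.re * v := by simp
  have h2 := abs_fract_exp_le v
  rw [zero_mul, exp_zero, mul_one] at h2
  rw [h1]
  nlinarith [exp_pos (-s.re * v)]

theorem zeta_eq_fractLaplace {s : ℂ} (hs : 1 < s.re) :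
    riemannZeta₁ s = s - s * (s - 1) * fractLaplace s := by
  have hs0 : s ≠ 0 := fun h => by simp [h] at hs; linarith
  have hs1 : s - 1 ≠ 0 := fun h => by
    rw [sub_eq_zero] at h; simp [h] at hs
  have hs1' : 0 < (s - 1).re := by simpa using hs
  have hO : (fun n : ℕ ↦ ∑ k ∈ Finset.Icc 1 n, (fun _ : ℕ => (1 : ℝ)) k) =O[atTop]
      fun n : ℕ ↦ (n : ℝ) ^ (1 : ℝ) := by
    simp [Asymptotics.isBigO_refl]
  have h1 := LSeries_eq_mul_integral_of_nonneg (fun _ => (1 : ℝ)) (r := 1) zero_le_one hs hO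
    (fun _ => zero_le_one)
  simp only [Complex.ofReal_one] at h1
  have h2 : LSeries (fun _ => 1) s = riemannZeta s := LSeries_one_eq_riemannZeta hs
  have h3 : ∫ t in Ioi (1 : ℝ), (∑ k ∈ Finset.Icc 1 ⌊t⌋₊, (1 : ℂ)) * (t : ℂ) ^ (-(s + 1)) =
      ∫ v in Ioi (0 : ℝ), (Complex.exp (-(s - 1) * v) -
        ((Int.fract (exp v) : ℝ) : ℂ) * Complex.exp (-s * v)) := by
    rw [← Real.exp_zero, ← integral_comp_exp_Ioi]
    refine setIntegral_congr_fun measurableSet_Ioi fun v _ => ?_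
    have h4 : ((exp v : ℝ) : ℂ) ^ (-(s + 1)) = Complex.exp (v * -(s + 1)) := by
      rw [Complex.cpow_def_of_ne_zero (by exact_mod_cast (exp_pos v).ne'), ← Complex.ofReal_log
        (exp_pos v).le, Real.log_exp]
    have h5 : (Int.fract (exp v) : ℝ) = exp v - (⌊exp v⌋₊ : ℝ) := by
      rw [Int.fract, ← natCast_floor_eq_intCast_floor (exp_pos v).le]
    have h6 : Complex.exp (-(s - 1) * v) = Complex.exp v * Complex.exp (-s * v) := by
      rw [← Complex.exp_add]; ring_nf
    have h7 : Complex.exp (-s * v) = Complex.exp v * Complex.exp (v * -(s + 1)) := by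
      rw [← Complex.exp_add]; ring_nf
    simp only [h4, Complex.real_smul]
    rw [h6, h5, h7, Finset.sum_const, Nat.card_Icc]
    push_cast
    rw [nsmul_eq_mul]
    ring
  have h8 : ∫ v in Ioi (0 : ℝ), Complex.exp (-(s - 1) * v) = 1 / (s - 1) := by
    have := integral_cexp hs1'
    simpa using this
  have i1 : IntegrableOn (fun v : ℝ => Complex.exp (-(s - 1) * v)) (Ioi 0) := integrable_cexp hs1' 0
  have i2 := laplace_integrable measurable_fract_exp (a := 0) (fun v _ => abs_fract_exp_le v)
      (s := s) (by linarith)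
  rw [h2, h3, integral_sub i1 i2, h8] at h1
  have h9 := riemannZeta_eq_inv_sub_mul (sub_ne_zero.1 hs1)
  rw [h1, ← fractLaplace] at h9
  field_simp at h9
  linear_combination -h9

theorem zeta₁_eq {s : ℂ} (hs : 0 < s.re) :
    riemannZeta₁ s = s - s * (s - 1) * fractLaplace s := by
  refine eqOn_re_gt (b := 0) (c := 1) differentiable_riemannZeta₁.differentiableOn ?_
    (fun z hz => zeta_eq_fractLaplace hz) s hs
  exact differentiableOn_id.sub ((differentiableOn_id.mul (differentiableOn_id.sub_const 1)).mul
    differentiableOn_fractLaplace)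

theorem norm_zeta₁_le {s : ℂ} (hs : 0 < s.re) :
    ‖riemannZeta₁ s‖ ≤ ‖s‖ + ‖s‖ * ‖s - 1‖ / s.re := by
  rw [zeta₁_eq hs]
  refine (norm_sub_le _ _).trans ?_
  rw [norm_mul, norm_mul, div_eq_mul_one_div (‖s‖ * ‖s - 1‖)]
  gcongr
  exact norm_fractLaplace_le hs

theorem zeta₁_ne_zero {s : ℂ} (hs : ‖s - 1‖ < s.re) : riemannZeta₁ s ≠ 0 := by
  have hs0 : 0 < s.re := (norm_nonneg _).trans_lt hs
  have hsn : s ≠ 0 := fun h => by simp [h] at hs0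
  rw [zeta₁_eq hs0, show s - s * (s - 1) * fractLaplace s = s *
      (1 - (s - 1) * fractLaplace s) by ring]
  refine mul_ne_zero hsn fun h => ?_
  rw [sub_eq_zero] at h
  have h1 : ‖(s - 1) * fractLaplace s‖ < 1 := by
    rw [norm_mul]
    calc _ ≤ ‖s - 1‖ * (1 / s.re) := by gcongr; exact norm_fractLaplace_le hs0
      _ < 1 := by rw [mul_one_div, div_lt_one hs0]; exact hs
  rw [← h] at h1
  simp at h1

end LaplaceAnalytic

section Parts

theorem integral_primitive_mul {φ : ℝ → ℝ} {g g' : ℝ → ℂ} {a : ℝ} (hφ : Measurable φ)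
    (hg : ∀ v, a < v → HasDerivAt g (g' v) v) (hg'm : Measurable g')
    (hg' : ∀ v, a < v → IntegrableOn g' (Ioi v)) (hlim : Tendsto g atTop (𝓝 0))
    (hb : IntegrableOn (fun v => φ v * ∫ u in Ioi v, ‖g' u‖) (Ioi a)) :
    IntegrableOn (fun u => ((∫ v in a..u, φ v : ℝ) : ℂ) * g' u) (Ioi a) ∧
    ∫ u in Ioi a, ((∫ v in a..u, φ v : ℝ) : ℂ) * g' u = -∫ v in Ioi a, (φ v : ℂ) * g v := by
  set μ := (volume : Measure ℝ).restrict (Ioi a) with hμ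
  set F : ℝ × ℝ → ℂ := {q : ℝ × ℝ | q.1 < q.2}.indicator (fun q => (φ q.1 : ℂ) * g' q.2) with hF
  have hmeas : AEStronglyMeasurable F (μ.prod μ) := by
    refine (Measurable.indicator ?_
        (measurableSet_lt measurable_fst measurable_snd)).aestronglyMeasurable
    exact (Complex.measurable_ofReal.comp (hφ.comp measurable_fst)).mul (hg'm.comp measurable_snd)
  have hsec : ∀ v, (fun u => F (v, u)) = (Ioi v).indicator fun u => (φ v : ℂ) * g' u := by
    intro v; ext u
    simp only [hF, indicator, mem_ofPred_eq, mem_Ioi]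
  have hsub : ∀ v, a < v → ∀ f : ℝ → ℂ, ∫ u, (Ioi v).indicator f u ∂μ = ∫ u in Ioi v, f u := by
    intro v hv f
    rw [MeasureTheory.integral_indicator measurableSet_Ioi, hμ,
        Measure.restrict_restrict measurableSet_Ioi,
      inter_eq_left.2 (Ioi_subset_Ioi hv.le)]
  have hint : Integrable F (μ.prod μ) := by
    rw [integrable_prod_iff hmeas]
    constructor
    · filter_upwards [ae_restrict_mem measurableSet_Ioi] with v hv
      rw [hsec, integrable_indicator_iff measurableSet_Ioi, IntegrableOn, hμ,
        Measure.restrict_restrict measurableSet_Ioi, inter_eq_left.2 (Ioi_subset_Ioi (le_of_lt hv))]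
      exact (hg' v hv).const_mul _
    · refine (hb.norm).congr ?_
      filter_upwards [ae_restrict_mem measurableSet_Ioi] with v hv
      have h1 : (fun u => ‖F (v, u)‖) = (Ioi v).indicator fun u => |φ v| * ‖g' u‖ := by
        ext u
        rw [show F (v, u) = (fun u => F (v, u)) u from rfl, hsec, norm_indicator_eq_indicator_norm]
        simp
      rw [h1, MeasureTheory.integral_indicator measurableSet_Ioi, hμ,
          Measure.restrict_restrict measurableSet_Ioi,
        inter_eq_left.2 (Ioi_subset_Ioi (le_of_lt hv)), MeasureTheory.integral_const_mul, norm_mul,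
        norm_of_nonneg (integral_nonneg fun u => norm_nonneg _), Real.norm_eq_abs]
  have hcol : ∀ u, a < u → ∫ v, F (v, u) ∂μ = ((∫ v in a..u, φ v : ℝ) : ℂ) * g' u := by
    intro u hu
    have h1 : (fun v => F (v, u)) = (Iio u).indicator fun v => (φ v : ℂ) * g' u := by
      ext v; simp only [hF, indicator, mem_ofPred_eq, mem_Iio]
    rw [h1, MeasureTheory.integral_indicator measurableSet_Iio, hμ,
        Measure.restrict_restrict measurableSet_Iio,
      Iio_inter_Ioi, MeasureTheory.integral_mul_const, integral_of_le hu.le,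
      integral_Ioc_eq_integral_Ioo, integral_complex_ofReal]
  have hrow : ∀ v, a < v → ∫ u, F (v, u) ∂μ = -((φ v : ℂ) * g v) := by
    intro v hv
    rw [hsec, hsub v hv, MeasureTheory.integral_const_mul,
      integral_Ioi_of_hasDerivAt_of_tendsto' (fun x hx => hg x (lt_of_lt_of_le hv hx))
          (hg' v hv) hlim]
    ring
  constructor
  · refine hint.integral_prod_right.congr ?_
    filter_upwards [ae_restrict_mem measurableSet_Ioi] with u hu using hcol u hu
  · have h1 := integral_integral_swap (f := fun v u => F (v, u)) hint
    rw [← MeasureTheory.integral_neg]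
    calc _ = ∫ u, ∫ v, F (v, u) ∂μ ∂μ := by
          refine (setIntegral_congr_fun measurableSet_Ioi fun u hu => ?_).symm
          exact hcol u hu
      _ = _ := by
          rw [← h1]
          exact setIntegral_congr_fun measurableSet_Ioi fun v hv => hrow v hv

theorem integral_norm_cexp {s : ℂ} (hs : 0 < s.re) (v : ℝ) :
    ∫ u in Ioi v, ‖-s * Complex.exp (-s * u)‖ = ‖s‖ / s.re * exp (-s.re * v) := by
  have h1 : ∀ u : ℝ, ‖-s * Complex.exp (-s * u)‖ = ‖s‖ * exp (-s.re * u) := fun u => by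
    rw [norm_mul, norm_neg, Complex.norm_exp]; simp
  simp_rw [h1]
  rw [MeasureTheory.integral_const_mul, integral_exp_mul_Ioi (by linarith)]
  field_simp

theorem laplace_primitive {φ : ℝ → ℝ} (hφ : Measurable φ) {a : ℝ} {s : ℂ} (hs : 0 < s.re)
    (hint : IntegrableOn (fun v => φ v * exp (-s.re * v)) (Ioi a)) :
    IntegrableOn (fun u : ℝ => ((∫ v in a..u, φ v : ℝ) : ℂ) * Complex.exp (-s * u)) (Ioi a) ∧
    s * ∫ u in Ioi a, ((∫ v in a..u, φ v : ℝ) : ℂ) * Complex.exp (-s * u) =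
      ∫ v in Ioi a, (φ v : ℂ) * Complex.exp (-s * v) := by
  have hs0 : s ≠ 0 := fun h => by simp [h] at hs
  have h := integral_primitive_mul (a := a) (g := fun v : ℝ => Complex.exp (-s * v))
    (g' := fun v : ℝ => -s * Complex.exp (-s * v)) hφ ?_ (by fun_prop) ?_ (tendsto_cexp hs) ?_
  · obtain ⟨h1, h2⟩ := h
    have e1 : ∀ u : ℝ, ((∫ v in a..u, φ v : ℝ) : ℂ) * (-s * Complex.exp (-s * u)) =
        -s * (((∫ v in a..u, φ v : ℝ) : ℂ) * Complex.exp (-s * u)) := fun u => by ring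
    simp_rw [e1] at h1 h2
    rw [MeasureTheory.integral_const_mul] at h2
    constructor
    · have := h1.const_mul (-s)⁻¹
      refine this.congr (Eventually.of_forall fun u => ?_)
      simp only
      rw [← mul_assoc, inv_mul_cancel₀ (neg_ne_zero.2 hs0), one_mul]
    · linear_combination -h2
  · intro v _
    have h1 : HasDerivAt (fun v : ℝ => -s * (v : ℂ)) (-s * 1) v :=
      (Complex.ofRealCLM.hasDerivAt (x := v)).const_mul _
    exact h1.cexp.congr_deriv (by ring)
  · intro v _
    exact (integrable_cexp hs v).const_mul _
  · simp_rw [integral_norm_cexp hs]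
    have := hint.const_mul (‖s‖ / s.re)
    refine this.congr (Eventually.of_forall fun u => ?_)
    simp only; ring

end Parts

section Landau

theorem iteratedDeriv_laplace {φ : ℝ → ℝ} (hφ : Measurable φ) {a b : ℝ} (ha : 0 ≤ a)
    (hint : ∀ x, b < x → IntegrableOn (fun v => φ v * exp (-x * v)) (Ioi a)) (n : ℕ) :
    (∀ x, b < x → IntegrableOn (fun v => φ v * (-v) ^ n * exp (-x * v)) (Ioi a)) ∧
    ∀ s : ℂ, b < s.re →
      iteratedDeriv n (fun z : ℂ => ∫ v in Ioi a, (φ v : ℂ) * Complex.exp (-z * v)) s =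
      ∫ v in Ioi a, ((φ v * (-v) ^ n : ℝ) : ℂ) * Complex.exp (-s * v) := by
  induction n with
  | zero => simpa using hint
  | succ n ih =>
    obtain ⟨ih1, ih2⟩ := ih
    have hm : Measurable fun v => φ v * (-v) ^ n := by fun_prop
    constructor
    · intro x hx
      have h1 := (hasDerivAt_laplace hm ha ih1 (s := (x : ℂ)) (by simpa using hx)).1.re
      refine h1.congr (Eventually.of_forall fun v => ?_)
      simp only [RCLike.re_to_complex]
      have : (((φ v * (-v) ^ n : ℝ) : ℂ) * (-v * Complex.exp (-(x : ℂ) * v))) =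
        ((φ v * (-v) ^ n * (-v * exp (-x * v)) : ℝ) : ℂ) := by push_cast; ring
      rw [this, Complex.ofReal_re]
      ring
    · intro s hs
      rw [iteratedDeriv_succ]
      have h1 := (hasDerivAt_laplace hm ha ih1 hs).2
      have h2 : iteratedDeriv n (fun z : ℂ =>
          ∫ v in Ioi a, (φ v : ℂ) * Complex.exp (-z * v)) =ᶠ[𝓝 s]
          fun z => ∫ v in Ioi a, ((φ v * (-v) ^ n : ℝ) : ℂ) * Complex.exp (-z * v) := by
        filter_upwards [(isOpen_re_gt b).mem_nhds hs] with z hz using ih2 z hz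
      rw [h2.deriv_eq, h1.deriv]
      refine setIntegral_congr_fun measurableSet_Ioi fun v _ => ?_
      push_cast
      ring

theorem landau {G : ℝ → ℝ} (hG : Measurable G) {a : ℝ} (ha : 0 ≤ a) (hG0 : ∀ v, a < v → 0 ≤ G v)
    (hint : ∀ x, 0 < x → IntegrableOn (fun v => G v * exp (-x * v)) (Ioi a)) {δ r : ℝ} (hδ : 0 < δ)
    {H : ℂ → ℂ} (hH : DifferentiableOn ℂ H (Metric.ball (δ : ℂ) r))
    (hHG : H =ᶠ[𝓝 (δ : ℂ)] fun z => ∫ v in Ioi a, (G v : ℂ) * Complex.exp (-z * v))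
    {x : ℝ} (hx : δ - r < x) (hxδ : x ≤ δ) :
        IntegrableOn (fun v => G v * exp (-x * v)) (Ioi a) := by
  have hd := fun n => (iteratedDeriv_laplace hG ha hint n).1 δ hδ
  have hpt : ∀ n v, a < v → 0 ≤ G v * exp (-δ * v) * (((δ - x) * v) ^ n / n.factorial) :=
    fun n v hv => by
    have := hG0 v hv
    have hv0 : 0 ≤ v := ha.trans hv.le
    have : 0 ≤ δ - x := by linarith
    positivity
  have hterm : ∀ n, IntegrableOn (fun v => G v * exp (-δ * v) * (((δ - x) * v) ^ n / n.factorial))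
      (Ioi a) := by
    intro n
    refine ((hd n).const_mul ((x - δ) ^ n / n.factorial)).congr (Eventually.of_forall fun v => ?_)
    have : ((δ - x) * v) ^ n = (x - δ) ^ n * (-v) ^ n := by rw [← mul_pow]; ring_nf
    beta_reduce
    rw [this]; ring
  have hsum : Summable fun n : ℕ =>
      ∫ v in Ioi a, G v * exp (-δ * v) * (((δ - x) * v) ^ n / n.factorial) := by
    have hxb : (x : ℂ) ∈ Metric.ball (δ : ℂ) r := by
      rw [Metric.mem_ball, dist_eq_norm, ← Complex.ofReal_sub, Complex.norm_real, Real.norm_eq_abs,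
        abs_sub_lt_iff]
      constructor <;> linarith
    have hs := (Complex.hasSum_taylorSeries_on_ball hH hxb).summable
    have hs2 := Complex.reCLM.summable hs
    refine hs2.congr fun n => ?_
    have h1 : iteratedDeriv n H δ = ((∫ v in Ioi a, G v * (-v) ^ n * exp (-δ * v) : ℝ) : ℂ) := by
      rw [(hHG.iteratedDeriv_eq n).trans
          ((iteratedDeriv_laplace hG ha hint n).2 δ (by simpa using hδ)),
        ← integral_complex_ofReal]
      refine setIntegral_congr_fun measurableSet_Ioi fun v _ => ?_
      push_cast
      ring
    rw [h1, ← Complex.ofReal_sub, smul_eq_mul, smul_eq_mul]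
    have h2 : ((n.factorial : ℂ))⁻¹ * (((x - δ : ℝ) : ℂ) ^ n *
        ((∫ v in Ioi a, G v * (-v) ^ n * exp (-δ * v) : ℝ) : ℂ)) =
        (((n.factorial : ℝ)⁻¹ * ((x - δ) ^ n * ∫ v in Ioi a, G v * (-v) ^ n * exp (-δ * v)) : ℝ) :
            ℂ) := by
      push_cast; ring
    rw [h2, Complex.reCLM_apply, Complex.ofReal_re, ← MeasureTheory.integral_const_mul,
      ← MeasureTheory.integral_const_mul]
    refine setIntegral_congr_fun measurableSet_Ioi fun v _ => ?_
    have : ((δ - x) * v) ^ n = (x - δ) ^ n * (-v) ^ n := by rw [← mul_pow]; ring_nf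
    rw [this]; ring
  refine ⟨(hG.mul (by fun_prop)).aestronglyMeasurable, ?_⟩
  rw [hasFiniteIntegral_iff_ofReal (by
    filter_upwards [ae_restrict_mem measurableSet_Ioi] with v hv
    exact mul_nonneg (hG0 v hv) (exp_pos _).le)]
  have h3 : ∀ v, a < v → ENNReal.ofReal (G v * exp (-x * v)) =
      ∑' n : ℕ, ENNReal.ofReal (G v * exp (-δ * v) * (((δ - x) * v) ^ n / n.factorial)) := by
    intro v hv
    have h4 : HasSum (fun n : ℕ => G v * exp (-δ * v) * (((δ - x) * v) ^ n / n.factorial))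
        (G v * exp (-x * v)) := by
      have := (NormedSpace.expSeries_div_hasSum_exp ((δ - x) * v)).mul_left (G v * exp (-δ * v))
      rw [← Real.exp_eq_exp_ℝ, mul_assoc, ← exp_add] at this
      have e : -x * v = -δ * v + (δ - x) * v := by ring
      rw [e]; exact this
    rw [← h4.tsum_eq, ENNReal.ofReal_tsum_of_nonneg (fun n => hpt n v hv) h4.summable]
  rw [setLIntegral_congr_fun measurableSet_Ioi h3, lintegral_tsum fun n => by
    refine (Measurable.ennreal_ofReal ?_).aemeasurable
    fun_prop]
  have h5 : ∀ n : ℕ, ∫⁻ v in Ioi a,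
      ENNReal.ofReal (G v * exp (-δ * v) * (((δ - x) * v) ^ n / n.factorial)) =
      ENNReal.ofReal (∫ v in Ioi a, G v * exp (-δ * v) * (((δ - x) * v) ^ n / n.factorial)) := by
    intro n
    rw [ofReal_integral_eq_lintegral_ofReal (hterm n)]
    filter_upwards [ae_restrict_mem measurableSet_Ioi] with v hv using hpt n v hv
  simp_rw [h5]
  rw [← ENNReal.ofReal_tsum_of_nonneg (fun n => setIntegral_nonneg measurableSet_Ioi fun v hv =>
      hpt n v hv) hsum]
  exact ENNReal.ofReal_lt_top

end Landau

section Connection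

theorem image_nth_prime (N : ℕ) :
    (Finset.range (Nat.primeCounting N)).image (Nat.nth Nat.Prime) = Nat.primesLE N := by
  ext p
  simp only [Finset.mem_image, Finset.mem_range, Nat.mem_primesLE]
  constructor
  · rintro ⟨k, hk, rfl⟩
    exact ⟨Nat.lt_succ_iff.1 (Nat.nth_lt_of_lt_count hk), Nat.prime_nth_prime k⟩
  · rintro ⟨hp, hpp⟩
    exact ⟨Nat.count Nat.Prime p, Nat.count_strict_mono hpp (Nat.lt_succ_iff.2 hp),
        Nat.nth_count hpp⟩

theorem gammaR_primeCounting (N : ℕ) : gammaR (Nat.primeCounting N) = gammaP (Nat.primesLE N) := by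
  rw [gammaR, image_nth_prime]

theorem gammaR_succ (r : ℕ) : gammaR (r + 1) = gammaP (Nat.primesLE (Nat.nth Nat.Prime r)) := by
  rw [← gammaR_primeCounting]
  congr 1
  rw [Nat.primeCounting, Nat.primeCounting', Nat.count_succ, if_pos (Nat.prime_nth_prime r)]
  exact congrArg (· + 1) (Nat.primeCounting'_nth_eq r).symm

theorem powTail_nonneg {N : ℕ} (hN : 1 ≤ N) : 0 ≤ powTail N := by
  rw [powTail_eq hN]
  refine Finset.sum_nonneg fun p hp => ?_
  have := (Nat.prime_of_mem_primesLE hp).one_lt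
  have h1 : (1 : ℝ) < p := by exact_mod_cast this
  have := log_pos h1
  have : 0 < (p : ℝ) - 1 := by linarith
  positivity

theorem one_add_q_pos {N : ℕ} (hN : 2 ≤ N) : 0 < 1 + (err (log N) + powTail N) / log N := by
  have hl : 0 < log N := log_pos (by exact_mod_cast hN)
  have h1 := powTail_nonneg (N := N) (by omega)
  have h2 := lamSum_nonneg (log N)
  have h3 := one_half_lt_eulerMascheroniConstant
  rw [← div_self hl.ne', ← add_div]
  refine div_pos ?_ hl
  rw [err]; linarith

theorem lamSum_le {C : ℝ} (hC : ∀ v, 0 ≤ v → |err v| ≤ C) {v : ℝ} (hv : 0 ≤ v) :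
    lamSum v ≤ C + v := by
  have h3 := one_half_lt_eulerMascheroniConstant
  have := (abs_le.1 (hC v hv)).2
  rw [err] at this; linarith

theorem powTail_le_div {C : ℝ} (hC1 : 1 ≤ C) (hC : ∀ v, 0 ≤ v → |err v| ≤ C) {N : ℕ} (hN : 4 ≤ N) :
    powTail N ≤ (log 4 + 2 * (1 + C) + 2 * (1 + 2 * C)) / exp (log N / 2) := by
  have hN0 : (4 : ℝ) ≤ N := by exact_mod_cast hN
  have hl : 0 ≤ log N := log_nonneg (by linarith)
  refine (powTail_le hN (ε := C) fun v hv => hC v (by linarith)).trans ?_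
  have h1 := exp_half_log (N := N) (by omega)
  have h2 := lamSum_le hC (v := log N / 2) (by linarith)
  have h3 := add_one_le_exp (log N / 2)
  set y := exp (log N / 2)
  have hy0 : 0 < y := exp_pos _
  have hy : 2 ≤ y := by nlinarith
  rw [add_div _ (2 * (1 + 2 * C)) y, add_div _ (2 * (1 + C)) y]
  refine add_le_add (add_le_add le_rfl ?_) ?_
  · rw [div_le_div_iff₀ (by positivity) hy0]
    have : lamSum (log N / 2) ≤ (1 + C) * y := by nlinarith
    nlinarith [mul_le_mul_of_nonneg_right this hy0.le]
  · rw [div_le_div_iff₀ (by linarith) hy0]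
    nlinarith

theorem errTail_lower_nat (h : ∀ r : ℕ, exp (-γ₀) < gammaR r) {N : ℕ} (hN : 2 ≤ N) :
    -(powTail N / log N) ≤ errTail (log N) := by
  have h1 := h (Nat.primeCounting N)
  rw [gammaR_primeCounting] at h1
  have h2 := (lt_log_iff_exp_lt ((exp_pos _).trans h1)).2 h1
  have h3 := log_gammaP hN
  have h4 := log_le_sub_one_of_pos (one_add_q_pos hN)
  have h5 := gain_le hN
  linarith

theorem floor_exp_ge_half {u : ℝ} (hu : 0 ≤ u) : exp u / 2 ≤ ⌊exp u⌋₊ := by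
  have h1 : 1 ≤ ⌊exp u⌋₊ := Nat.one_le_floor_iff _ |>.2 (one_le_exp hu)
  have h2 : (1 : ℝ) ≤ ⌊exp u⌋₊ := by exact_mod_cast h1
  linarith [Nat.lt_floor_add_one (exp u)]

theorem errTail_lower (h : ∀ r : ℕ, exp (-γ₀) < gammaR r) :
    ∃ C, ∀ u, 1 ≤ u → 0 ≤ errTail u + C * exp (-u / 2) := by
  obtain ⟨C, hC1, hC⟩ := exists_err_bound
  have hlog4 : 0 < log 4 := log_pos (by norm_num)
  set D := log 4 + 2 * (1 + C) + 2 * (1 + 2 * C) with hD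
  have hD0 : 0 ≤ D := by positivity
  refine ⟨2 * D + 2 * C, fun u hu => ?_⟩
  rcases le_or_gt u (log 4) with hu4 | hu4
  · have h1 := (abs_le.1 (abs_errTail_le hC (by linarith : 0 < u))).1
    have h2 : C / u ≤ C := div_le_self (by linarith) hu
    have h3 : 1 / 2 ≤ exp (-u / 2) := by
      have : exp (log 4 / 2) ^ 2 = 4 := by
        rw [← exp_nat_mul]; push_cast; rw [mul_div_cancel₀ _ two_ne_zero, exp_log]; norm_num
      have h4 : exp (log 4 / 2) ≤ 2 := by nlinarith [exp_pos (log 4 / 2)]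
      calc (1 / 2 : ℝ) ≤ (exp (log 4 / 2))⁻¹ := by
            rw [one_div]; exact inv_anti₀ (exp_pos _) h4
        _ ≤ _ := by rw [← exp_neg]; exact exp_le_exp.2 (by linarith)
    nlinarith
  · have hN4 : 4 ≤ ⌊exp u⌋₊ := by
      rw [le_floor_exp_iff (by norm_num)]; exact_mod_cast hu4.le
    have hhalf := floor_exp_ge_half (by linarith : 0 ≤ u)
    have hNle : (⌊exp u⌋₊ : ℝ) ≤ exp u := Nat.floor_le (exp_pos _).le
    have hNlt := Nat.lt_floor_add_one (exp u)
    set N := ⌊exp u⌋₊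
    have hN0 : (4 : ℝ) ≤ N := by exact_mod_cast hN4
    have hlN : log N ≤ u := by rw [log_le_iff_le_exp (by linarith)]; exact hNle
    have hlN1 : 1 ≤ log N := by
      have : exp 1 ≤ N := by linarith [exp_one_lt_d9]
      rwa [← le_log_iff_exp_le (by linarith)] at this
    have h1 := errTail_lower_nat h (N := N) (by omega)
    have h2 := powTail_le_div hC1 hC hN4
    have hp0 := powTail_nonneg (N := N) (by omega)
    have h3 : powTail N / log N ≤ powTail N := div_le_self hp0 hlN1
    have h4 := exp_half_log (N := N) (by omega)
    have h5 : exp (u / 2) ^ 2 = exp u := by rw [← exp_nat_mul]; congr 1; push_cast; ring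
    have h6 : exp (u / 2) / 2 ≤ exp (log N / 2) := by
      refine (sq_le_sq₀ (by positivity) (exp_pos _).le).1 ?_
      rw [div_pow, h4, h5]; linarith
    have h7 : D / exp (log N / 2) ≤ 2 * D * exp (-u / 2) := by
      rw [neg_div, exp_neg, ← div_eq_mul_inv, div_le_div_iff₀ (exp_pos _) (exp_pos _)]
      nlinarith
    have h8 := errTail_sub (by linarith : 0 < log N) hlN
    have h9 : ∫ v in log N..u, err v / v ^ 2 ≤ C * (u - log N) := by
      have := norm_integral_le_of_norm_le_const (f := fun v => err v / v ^ 2) (a := log N) (b := u)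
          (C := C) (fun v hv => by
        rw [uIoc_of_le hlN] at hv
        have hv1 : 1 ≤ v := by linarith [hv.1]
        rw [norm_div, Real.norm_eq_abs, Real.norm_eq_abs, abs_of_nonneg (sq_nonneg v)]
        exact (div_le_self (abs_nonneg _) (by nlinarith)).trans (hC v (by linarith)))
      rw [abs_of_nonneg (by linarith : 0 ≤ u - log N)] at this
      exact (le_abs_self _).trans this
    have h10 : u - log N ≤ 2 * exp (-u / 2) := by
      have h11 := log_le_sub_one_of_pos (div_pos (exp_pos u) (by linarith : (0 : ℝ) < N))
      rw [log_div (exp_pos u).ne' (by linarith), log_exp] at h11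
      have h12 : exp u / N - 1 ≤ 1 / N := by
        rw [div_sub_one (by linarith)]; gcongr; linarith
      have h13 : (1 : ℝ) / N ≤ 2 * exp (-u) := by
        rw [exp_neg, ← div_eq_mul_inv, div_le_div_iff₀ (by linarith) (exp_pos _)]
        linarith
      have h14 : exp (-u) ≤ exp (-u / 2) := exp_le_exp.2 (by linarith)
      linarith
    nlinarith

end Connection

section Continuation

noncomputable def errSq (v : ℝ) : ℝ := (Ioi 1).indicator (fun v => err v / v ^ 2) v

theorem measurable_errSq : Measurable errSq :=
  (measurable_err.div (by fun_prop)).indicator measurableSet_Ioi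

theorem errSq_of_lt {v : ℝ} (hv : 1 < v) : errSq v = err v / v ^ 2 := indicator_of_mem hv _

theorem integrable_errSq : Integrable errSq :=
  (integrable_indicator_iff measurableSet_Ioi).2 (integrable_err_div_sq one_pos)

theorem exists_errSq_bound : ∃ C, ∀ v, |errSq v| ≤ C * exp (0 * v) := by
  obtain ⟨C, hC1, hC⟩ := exists_err_bound
  refine ⟨C, fun v => ?_⟩
  rw [zero_mul, exp_zero, mul_one]
  rcases le_or_gt v 1 with hv | hv
  · rw [errSq, indicator_of_notMem (by simpa using hv)]; simp; linarith
  · rw [errSq_of_lt hv, abs_div, abs_of_nonneg (sq_nonneg v)]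
    exact (div_le_self (abs_nonneg _) (by nlinarith)).trans (hC v (by linarith))

theorem integrable_errSq_mul_exp {x : ℝ} (hx : 0 < x) (a : ℝ) :
    IntegrableOn (fun v => errSq v * exp (-x * v)) (Ioi a) := by
  obtain ⟨C, hC⟩ := exists_errSq_bound
  exact laplace_integrable_real measurable_errSq (fun v _ => hC v) hx

noncomputable def tailFun (u : ℝ) : ℝ := errTail 1 - ∫ v in (1 : ℝ)..u, errSq v

theorem continuous_tailFun : Continuous tailFun :=
  continuous_const.sub (continuous_primitive (fun _ _ => integrable_errSq.intervalIntegrable) 1)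

theorem tailFun_eq {u : ℝ} (hu : 1 ≤ u) : tailFun u = errTail u := by
  rw [tailFun, intervalIntegral.integral_congr_ae (g := fun v => err v / v ^ 2),
      errTail_sub one_pos hu]
  · ring
  · refine Eventually.of_forall fun v hv => ?_
    rw [uIoc_of_le hu] at hv
    exact errSq_of_lt hv.1

theorem integrable_tailFun_mul_exp {x : ℝ} (hx : 0 < x) :
    IntegrableOn (fun v => tailFun v * exp (-x * v)) (Ioi 1) := by
  obtain ⟨C, hC1, hC⟩ := exists_err_bound
  refine laplace_integrable_real (A := C) (b := 0) continuous_tailFun.measurable (fun v hv => ?_) hx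
  rw [tailFun_eq hv.le, zero_mul, exp_zero, mul_one]
  exact (abs_errTail_le hC (by linarith)).trans (div_le_self (by linarith) hv.le)

noncomputable def errSqLaplace (w : ℂ) : ℂ :=
  ∫ v in Ioi (1 : ℝ), (errSq v : ℂ) * Complex.exp (-w * v)

noncomputable def errLaplace (w : ℂ) : ℂ := ∫ v in Ioi (0 : ℝ), (err v : ℂ) * Complex.exp (-w * v)

noncomputable def errHeadLaplace (w : ℂ) : ℂ :=
  ∫ v in Ioi (0 : ℝ), (((Iic 1).indicator err v : ℝ) : ℂ) * Complex.exp (-w * v)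

theorem integral_cexp_Ioi_one {w : ℂ} (hw : 0 < w.re) :
    ∫ u in Ioi (1 : ℝ), Complex.exp (-w * u) = Complex.exp (-w) / w := by
  have := integral_exp_mul_complex_Ioi (a := -w) (by simpa using hw) 1
  rw [this]; simp

theorem laplace_tailFun {w : ℂ} (hw : 0 < w.re) :
    w * ∫ u in Ioi (1 : ℝ), (tailFun u : ℂ) * Complex.exp (-w * u) =
      errTail 1 * Complex.exp (-w) - errSqLaplace w := by
  obtain ⟨h1, h2⟩ := laplace_primitive measurable_errSq hw (integrable_errSq_mul_exp hw 1)
  have hw0 : w ≠ 0 := fun h => by simp [h] at hw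
  have h3 : ∀ u : ℝ, (tailFun u : ℂ) * Complex.exp (-w * u) = errTail 1 * Complex.exp (-w * u) -
      ((∫ v in (1 : ℝ)..u, errSq v : ℝ) : ℂ) * Complex.exp (-w * u) := fun u => by
    rw [tailFun]; push_cast; ring
  simp_rw [h3]
  rw [MeasureTheory.integral_sub ((integrable_cexp hw 1).const_mul _) h1, mul_sub, h2,
    MeasureTheory.integral_const_mul, integral_cexp_Ioi_one hw, errSqLaplace]
  field_simp

theorem differentiableOn_errSqLaplace : DifferentiableOn ℂ errSqLaplace {w | 0 < w.re} :=
  differentiableOn_laplace measurable_errSq zero_le_one fun _ hx => integrable_errSq_mul_exp hx 1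

theorem integrable_errHead {b x : ℝ} (hx : b < x) :
    IntegrableOn (fun v => (Iic 1).indicator err v * exp (-x * v)) (Ioi 0) := by
  obtain ⟨C, hC1, hC⟩ := exists_err_bound
  refine laplace_integrable_real (A := C * exp |b|) (b := b)
      (measurable_err.indicator measurableSet_Iic)
    (fun v hv => ?_) hx
  by_cases h : v ∈ Iic 1
  · rw [indicator_of_mem h, mul_assoc, ← exp_add]
    refine (hC v hv.le).trans (le_mul_of_one_le_right (by linarith) (one_le_exp ?_))
    have h1 : |b * v| ≤ |b| := by
      rw [abs_mul, abs_of_pos hv]; exact mul_le_of_le_one_right (abs_nonneg _) h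
    linarith [neg_abs_le (b * v)]
  · rw [indicator_of_notMem h, abs_zero]; positivity

theorem differentiable_errHeadLaplace : Differentiable ℂ errHeadLaplace := fun w =>
  (hasDerivAt_laplace (b := w.re - 1) (measurable_err.indicator measurableSet_Iic) le_rfl
    (fun _ hx => integrable_errHead hx) (by linarith)).2.differentiableAt

theorem integrable_err_mul_cexp {w : ℂ} (hw : 0 < w.re) :
    IntegrableOn (fun v : ℝ => (err v : ℂ) * Complex.exp (-w * v)) (Ioi 0) := by
  obtain ⟨C, hC1, hC⟩ := exists_err_bound
  refine laplace_integrable (A := C) (b := 0) measurable_err (fun v hv => ?_) hw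
  simpa using hC v hv.le

theorem errLaplace_split {w : ℂ} (hw : 0 < w.re) : errLaplace w =
    errHeadLaplace w + ∫ v in Ioi (1 : ℝ), (err v : ℂ) * Complex.exp (-w * v) := by
  have h1 := integrable_err_mul_cexp hw
  have hs : Ioi (0 : ℝ) = Ioc 0 1 ∪ Ioi 1 := (Ioc_union_Ioi_eq_Ioi zero_le_one).symm
  have hd : Disjoint (Ioc (0 : ℝ) 1) (Ioi 1) := Ioc_disjoint_Ioi_same
  rw [errLaplace]
  conv_lhs => rw [hs]
  rw [setIntegral_union hd measurableSet_Ioi (h1.mono_set Ioc_subset_Ioi_self)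
    (h1.mono_set (Ioi_subset_Ioi zero_le_one))]
  congr 1
  rw [errHeadLaplace]
  have h2 : ∀ v : ℝ, (((Iic 1).indicator err v : ℝ) : ℂ) * Complex.exp (-w * v) =
      (Iic (1 : ℝ)).indicator (fun v : ℝ => (err v : ℂ) * Complex.exp (-w * v)) v := fun v => by
    by_cases h : v ∈ Iic (1 : ℝ)
    · simp only [indicator_of_mem h]
    · simp only [indicator_of_notMem h]; simp
  simp_rw [h2]
  rw [setIntegral_indicator measurableSet_Iic, Ioi_inter_Iic]

theorem deriv_deriv_errSqLaplace {w : ℂ} (hw : 0 < w.re) :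
    deriv (deriv errSqLaplace) w = errLaplace w - errHeadLaplace w := by
  have h := (iteratedDeriv_laplace measurable_errSq zero_le_one
    (fun x hx => integrable_errSq_mul_exp (x := x) hx 1) 2).2 w hw
  rw [errLaplace_split hw, add_sub_cancel_left]
  have h2 : deriv (deriv errSqLaplace) = iteratedDeriv 2 errSqLaplace := by
    rw [iteratedDeriv_succ, iteratedDeriv_one]
  rw [h2]
  refine h.trans (setIntegral_congr_fun measurableSet_Ioi fun v hv => ?_)
  have hv0 : v ≠ 0 := by have : (1 : ℝ) < v := hv; linarith
  rw [errSq_of_lt hv, neg_sq, div_mul_cancel₀ _ (pow_ne_zero 2 hv0)]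

theorem zeta₁_ne_zero_of_re_pos {w : ℂ} (hw : 0 < w.re) : riemannZeta₁ (1 + w) ≠ 0 := by
  intro h
  have h1 : (1 + w : ℂ) ≠ 1 := fun h => by simp at h; simp [h] at hw
  have := riemannZeta_ne_zero_of_one_le_re (s := 1 + w) (by simp; linarith)
  rw [riemannZeta_eq_inv_sub_mul h1, h, mul_zero] at this
  exact this rfl

theorem errLaplace_eq {w : ℂ} (hw : 0 < w.re) :
    errLaplace w = (γ₀ - deriv riemannZeta₁ (1 + w) / riemannZeta₁ (1 + w)) / w := by
  have hw0 : w ≠ 0 := fun h => by simp [h] at hw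
  have h1 : (1 + w : ℂ) ≠ 1 := fun h => hw0 (by simpa using h)
  have hZ := zeta₁_ne_zero_of_re_pos hw
  rw [errLaplace, laplace_err hw]
  have hz := riemannZeta_eq_inv_sub_mul h1
  have hd : deriv riemannZeta (1 + w) = -1 / w ^ 2 * riemannZeta₁ (1 + w) + w⁻¹ *
      deriv riemannZeta₁ (1 + w) := by
    have h2 : riemannZeta =ᶠ[𝓝 (1 + w)] fun s => (s - 1)⁻¹ * riemannZeta₁ s := by
      filter_upwards [isOpen_ne.mem_nhds h1] with s hs using riemannZeta_eq_inv_sub_mul hs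
    rw [h2.deriv_eq]
    have h3 : HasDerivAt (fun s : ℂ => (s - 1)⁻¹) (-1 / w ^ 2) (1 + w) := by
      have := ((hasDerivAt_id (1 + w)).sub_const 1).inv (by simpa using hw0)
      refine this.congr_deriv ?_
      simp
    have h4 := h3.mul (differentiable_riemannZeta₁ (1 + w)).hasDerivAt
    refine h4.deriv.trans ?_
    simp
  rw [hd, hz]
  simp only [add_sub_cancel_left]
  field_simp
  ring

theorem tendsto_errSqLaplace : Tendsto (fun x : ℝ => errSqLaplace x) (𝓝[>] 0) (𝓝 (errTail 1)) := by
  have h1 : (errTail 1 : ℂ) = ∫ v in Ioi (1 : ℝ), (errSq v : ℂ) := by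
    rw [errTail, ← integral_complex_ofReal]
    exact setIntegral_congr_fun measurableSet_Ioi fun v hv => by rw [errSq_of_lt hv]
  rw [h1]
  refine tendsto_integral_filter_of_dominated_convergence (fun v => |errSq v|) ?_ ?_
    integrable_errSq.abs.integrableOn ?_
  · refine Eventually.of_forall fun x => ?_
    exact (Measurable.mul (Complex.measurable_ofReal.comp measurable_errSq)
        (by fun_prop)).aestronglyMeasurable
  · filter_upwards [self_mem_nhdsWithin] with x hx
    filter_upwards [ae_restrict_mem measurableSet_Ioi] with v hv
    rw [norm_mul, Complex.norm_real, Complex.norm_exp, Real.norm_eq_abs]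
    refine mul_le_of_le_one_right (abs_nonneg _) (exp_le_one_iff.2 ?_)
    have hx : (0 : ℝ) < x := hx
    have hv : (1 : ℝ) < v := hv
    simp; nlinarith
  · refine Eventually.of_forall fun v => ?_
    have : Continuous fun x : ℝ => (errSq v : ℂ) * Complex.exp (-(x : ℂ) * v) := by fun_prop
    have := this.tendsto 0
    simp only [Complex.ofReal_zero, neg_zero, zero_mul, Complex.exp_zero, mul_one] at this
    exact this.mono_left nhdsWithin_le_nhds

end Continuation

section ZeroFree

theorem integrable_tailFun_add {C x : ℝ} (hx : -(1 / 2) < x) :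
    IntegrableOn (fun v => C * exp (-v / 2) * exp (-x * v)) (Ioi 1) := by
  have := (integrableOn_exp_mul_Ioi (a := -(x + 1 / 2)) (by linarith) 1).const_mul C
  refine this.congr (Eventually.of_forall fun v => ?_)
  beta_reduce
  rw [mul_assoc, ← exp_add]; congr 2; ring

theorem errLaplace_extends {δ : ℝ} (hδ : 0 < δ) (hδ' : δ < 1 / 2) :
    ∃ f, DifferentiableOn ℂ f (Metric.ball (δ : ℂ) (1 / 2)) ∧
      ∀ w ∈ Metric.ball (δ : ℂ) (1 / 2), 0 < w.re → f w = errLaplace w := by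
  set N : ℂ → ℂ := fun w => γ₀ - deriv riemannZeta₁ (1 + w) / riemannZeta₁ (1 + w) with hN
  have hZ : ∀ w ∈ Metric.ball (δ : ℂ) (1 / 2), riemannZeta₁ (1 + w) ≠ 0 := fun w hw => by
    refine zeta₁_ne_zero ?_
    rw [mem_ball_iff_norm] at hw
    have h1 := (abs_le.1 (Complex.abs_re_le_norm (w - δ))).1
    have h2 := norm_add_le (w - δ) (δ : ℂ)
    rw [sub_add_cancel, Complex.norm_real, Real.norm_of_nonneg hδ.le] at h2
    simp only [Complex.sub_re, Complex.ofReal_re] at h1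
    simp only [add_sub_cancel_left, Complex.add_re, Complex.one_re]
    linarith
  have hdz : Differentiable ℂ fun w : ℂ => riemannZeta₁ (1 + w) :=
    differentiable_riemannZeta₁.comp (differentiable_id.const_add 1)
  have hdz' : Differentiable ℂ fun w : ℂ => deriv riemannZeta₁ (1 + w) := by
    have : Differentiable ℂ (deriv riemannZeta₁) := fun z =>
      ((differentiable_riemannZeta₁.analyticAt z).deriv).differentiableAt
    exact this.comp (differentiable_id.const_add 1)
  have hNd : DifferentiableOn ℂ N (Metric.ball (δ : ℂ) (1 / 2)) :=
    (differentiableOn_const _).sub (hdz'.differentiableOn.div hdz.differentiableOn hZ)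
  have h0 : Metric.ball (δ : ℂ) (1 / 2) ∈ 𝓝 (0 : ℂ) := by
    refine Metric.isOpen_ball.mem_nhds ?_
    rw [mem_ball_iff_norm', sub_zero, Complex.norm_real, Real.norm_of_nonneg hδ.le]; exact hδ'
  have hN0 : N 0 = 0 := by
    simp [hN, deriv_riemannZeta₁_one, riemannZeta₁_one]
  refine ⟨dslope N 0, (Complex.differentiableOn_dslope h0).2 hNd, fun w _ hw => ?_⟩
  have hw0 : w ≠ 0 := fun h => by simp [h] at hw
  rw [dslope_of_ne _ hw0, slope_def_field, hN0, errLaplace_eq hw, sub_zero, sub_zero]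

theorem exists_errSqLaplace_ext {δ : ℝ} (hδ : 0 < δ) (hδ' : δ < 1 / 2) :
    ∃ f, DifferentiableOn ℂ f (Metric.ball (δ : ℂ) (1 / 2)) ∧
      ∀ w ∈ Metric.ball (δ : ℂ) (1 / 2), 0 < w.re → f w = errSqLaplace w := by
  obtain ⟨e, he, he'⟩ := errLaplace_extends hδ hδ'
  set B := Metric.ball (δ : ℂ) (1 / 2) with hB
  set U := B ∩ {w : ℂ | 0 < w.re} with hU
  have hUo : IsOpen U := Metric.isOpen_ball.inter (isOpen_re_gt 0)
  have hUc : IsPreconnected U :=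
    ((convex_ball _ _).inter (convex_halfSpace_re_gt 0)).isPreconnected
  have hδU : (δ : ℂ) ∈ U := ⟨Metric.mem_ball_self (by norm_num), by simpa using hδ⟩
  have hK := differentiableOn_errSqLaplace
  have hK1 := hK.deriv (isOpen_re_gt 0)
  obtain ⟨f1, hf1, hf1'⟩ :=
    (he.sub differentiable_errHeadLaplace.differentiableOn).isExactOn_ball.with_val_at
    δ (deriv errSqLaplace δ)
  have h1 : U.EqOn f1 (deriv errSqLaplace) := by
    refine hUo.eqOn_of_deriv_eq hUc (fun w hw =>
        (hf1' w hw.1).differentiableAt.differentiableWithinAt)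
      (hK1.mono inter_subset_right) (fun w hw => ?_) hδU hf1
    rw [(hf1' w hw.1).deriv, deriv_deriv_errSqLaplace hw.2]
    simp [he' w hw.1 hw.2]
  have hf1d : DifferentiableOn ℂ f1 B := fun w hw =>
      (hf1' w hw).differentiableAt.differentiableWithinAt
  obtain ⟨f2, hf2, hf2'⟩ := hf1d.isExactOn_ball.with_val_at δ (errSqLaplace δ)
  refine ⟨f2, fun w hw => (hf2' w hw).differentiableAt.differentiableWithinAt, fun w hw hw' => ?_⟩
  refine hUo.eqOn_of_deriv_eq hUc (fun w hw =>
      (hf2' w hw.1).differentiableAt.differentiableWithinAt)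
    (hK.mono inter_subset_right) (fun w hw => ?_) hδU hf2 ⟨hw, hw'⟩
  rw [(hf2' w hw.1).deriv, h1 hw]

theorem integrable_tailFun_of_lower {C : ℝ}
    (hC : ∀ u, 1 ≤ u → 0 ≤ errTail u + C * exp (-u / 2)) {x : ℝ} (hx : -(1 / 2) < x) :
    IntegrableOn (fun v => tailFun v * exp (-x * v)) (Ioi 1) := by
  rcases lt_or_ge 0 x with hx0 | hx0
  · exact integrable_tailFun_mul_exp hx0
  set δ := (x + 1 / 2) / 2 with hδdef
  have hδ : 0 < δ := by linarith
  have hδ' : δ < 1 / 2 := by linarith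
  obtain ⟨f, hf, hf'⟩ := exists_errSqLaplace_ext hδ hδ'
  set B := Metric.ball (δ : ℂ) (1 / 2) with hB
  have h0 : B ∈ 𝓝 (0 : ℂ) := by
    refine Metric.isOpen_ball.mem_nhds ?_
    rw [mem_ball_iff_norm', sub_zero, Complex.norm_real, Real.norm_of_nonneg hδ.le]; exact hδ'
  have hf0 : f 0 = errTail 1 := by
    have hc : Tendsto f (𝓝 0) (𝓝 (f 0)) := ((hf.differentiableAt h0).continuousAt).tendsto
    have hr : Tendsto (fun x : ℝ => (x : ℂ)) (𝓝[>] 0) (𝓝 0) := by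
      have : Continuous fun x : ℝ => (x : ℂ) := Complex.continuous_ofReal
      exact (this.tendsto' 0 0 (by simp)).mono_left nhdsWithin_le_nhds
    refine tendsto_nhds_unique (hc.comp hr) (tendsto_errSqLaplace.congr' ?_)
    filter_upwards [hr.eventually h0, self_mem_nhdsWithin] with y hy hy'
    exact (hf' y hy (by simpa using hy')).symm
  set Nn : ℂ → ℂ := fun w => errTail 1 * Complex.exp (-w) - f w with hNn
  have hNnd : DifferentiableOn ℂ Nn B := DifferentiableOn.sub (by fun_prop) hf
  have hNn0 : Nn 0 = 0 := by simp [hNn, hf0]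
  set H : ℂ → ℂ := fun w => dslope Nn 0 w + C * Complex.exp (-(w + 1 / 2)) / (w + 1 / 2) with hH
  have hne : ∀ w ∈ B, w + 1 / 2 ≠ 0 := fun w hw h => by
    rw [hB, mem_ball_iff_norm] at hw
    have h1 := (abs_le.1 (Complex.abs_re_le_norm (w - δ))).1
    have h2 := congrArg Complex.re h
    simp at h2
    simp only [Complex.sub_re, Complex.ofReal_re] at h1
    linarith
  have hHd : DifferentiableOn ℂ H B := by
    refine ((Complex.differentiableOn_dslope h0).2 hNnd).add (DifferentiableOn.div ?_ ?_ hne) <;>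
        fun_prop
  have hG : Measurable fun u => tailFun u + C * exp (-u / 2) :=
    continuous_tailFun.measurable.add (by fun_prop)
  have hGint : ∀ x, -(1 / 2) < x → IntegrableOn (fun v => tailFun v * exp (-x * v)) (Ioi 1) →
      IntegrableOn (fun v => (tailFun v + C * exp (-v / 2)) * exp (-x * v)) (Ioi 1) :=
        fun x hx h => by
    simp_rw [add_mul]
    exact h.add (integrable_tailFun_add hx)
  have hland := landau hG zero_le_one (fun v hv => by rw [tailFun_eq hv.le]; exact hC v hv.le)
    (fun x hx => hGint x (by linarith) (integrable_tailFun_mul_exp hx)) hδ hHd (x := x) ?_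
        (by linarith) (by linarith)
  · have := hland.sub (integrable_tailFun_add (C := C) hx)
    refine this.congr (Eventually.of_forall fun v => ?_)
    simp only [Pi.sub_apply]; ring
  · have hδB : (δ : ℂ) ∈ B := Metric.mem_ball_self (by norm_num)
    filter_upwards [Metric.isOpen_ball.mem_nhds hδB,
        (isOpen_re_gt 0).mem_nhds (by simpa using hδ : (0:ℝ) < (δ : ℂ).re)]
      with w hwB hw
    have hw : 0 < w.re := hw
    have hw0 : w ≠ 0 := fun h => by simp [h] at hw
    have hw' : 0 < (w + 1 / 2).re := by simp; linarith
    have h1 := laplace_tailFun hw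
    have h2 : ∀ v : ℝ, ((tailFun v + C * exp (-v / 2) : ℝ) : ℂ) * Complex.exp (-w * v) =
        (tailFun v : ℂ) * Complex.exp (-w * v) + C * Complex.exp (-(w + 1 / 2) * v) := fun v => by
      push_cast
      rw [add_mul, mul_assoc (C : ℂ), ← Complex.exp_add]
      congr 3; ring
    simp_rw [h2]
    obtain ⟨C', hC1', hC'⟩ := exists_err_bound
    have hi : IntegrableOn (fun v : ℝ => (tailFun v : ℂ) * Complex.exp (-w * v)) (Ioi 1) := by
      refine laplace_integrable (A := C') (b := 0) continuous_tailFun.measurable (fun v hv => ?_) hw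
      rw [tailFun_eq hv.le, zero_mul, exp_zero, mul_one]
      exact (abs_errTail_le hC' (by linarith)).trans (div_le_self (by linarith) hv.le)
    rw [MeasureTheory.integral_add hi ((integrable_cexp hw' 1).const_mul _),
        MeasureTheory.integral_const_mul,
      integral_cexp_Ioi_one hw', hH]
    beta_reduce
    rw [dslope_of_ne _ hw0, slope_def_field, hNn0, sub_zero, sub_zero, hNn]
    beta_reduce
    rw [hf' w hwB hw, ← h1]
    field_simp

theorem zeta₁_ne_zero_of_lower {C : ℝ}
    (hC : ∀ u, 1 ≤ u → 0 ≤ errTail u + C * exp (-u / 2)) {w : ℂ} (hw : -(1 / 2) < w.re) :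
    riemannZeta₁ (1 + w) ≠ 0 := by
  have hint := fun x (hx : -(1 / 2) < x) => integrable_tailFun_of_lower hC hx
  set S := {z : ℂ | -(1 / 2) < z.re} with hS
  have hSo : IsOpen S := isOpen_re_gt _
  have hJ := differentiableOn_laplace continuous_tailFun.measurable zero_le_one hint
  set K : ℂ → ℂ := fun w => errTail 1 * Complex.exp (-w) -
    w * ∫ u in Ioi (1 : ℝ), (tailFun u : ℂ) * Complex.exp (-w * u) with hK
  have hKd : DifferentiableOn ℂ K S :=
    DifferentiableOn.sub (by fun_prop) (differentiableOn_id.mul hJ)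
  set E : ℂ → ℂ := fun w => deriv (deriv K) w + errHeadLaplace w with hE
  have hEd : DifferentiableOn ℂ E S :=
    ((hKd.deriv hSo).deriv hSo).add differentiable_errHeadLaplace.differentiableOn
  have hKe : ∀ z : ℂ, 0 < z.re → K z = errSqLaplace z := fun z hz => by
    rw [hK]; beta_reduce; rw [laplace_tailFun hz]; ring
  have hEe : ∀ z : ℂ, 0 < z.re → E z = errLaplace z := fun z hz => by
    have h1 : K =ᶠ[𝓝 z] errSqLaplace := by
      filter_upwards [(isOpen_re_gt 0).mem_nhds hz] with y hy using hKe y hy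
    rw [hE]; beta_reduce; rw [h1.deriv.deriv_eq, deriv_deriv_errSqLaplace hz]; ring
  have hdz : Differentiable ℂ fun w : ℂ => riemannZeta₁ (1 + w) :=
    differentiable_riemannZeta₁.comp (differentiable_id.const_add 1)
  have hdz' : Differentiable ℂ fun w : ℂ => deriv riemannZeta₁ (1 + w) := by
    have : Differentiable ℂ (deriv riemannZeta₁) := fun z =>
      ((differentiable_riemannZeta₁.analyticAt z).deriv).differentiableAt
    exact this.comp (differentiable_id.const_add 1)
  have hode : ∀ z : ℂ, -(1 / 2) < z.re → deriv riemannZeta₁ (1 + z) =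
      (γ₀ - z * E z) * riemannZeta₁ (1 + z) := by
    refine eqOn_re_gt (c := 0) hdz'.differentiableOn ?_ fun z hz => ?_
    · exact ((differentiableOn_const _).sub (differentiableOn_id.mul hEd)).mul hdz.differentiableOn
    · have hz0 : z ≠ 0 := fun h => by simp [h] at hz
      have := zeta₁_ne_zero_of_re_pos hz
      rw [hEe z hz, errLaplace_eq hz]
      field_simp
      ring
  set c : ℝ := ‖w‖ ^ 2 / (1 + 2 * w.re) + 1 with hc
  have hpos : 0 < 1 + 2 * w.re := by linarith
  have hc0 : 0 < c := by positivity
  have hball : Metric.ball (c : ℂ) (c + 1 / 2) ⊆ S := fun z hz => by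
    rw [mem_ball_iff_norm] at hz
    have h1 := (abs_le.1 (Complex.abs_re_le_norm (z - c))).1
    simp only [Complex.sub_re, Complex.ofReal_re] at h1
    simp only [hS, mem_ofPred_eq]; linarith
  have hwb : w ∈ Metric.ball (c : ℂ) (c + 1 / 2) := by
    rw [mem_ball_iff_norm]
    refine lt_of_pow_lt_pow_left₀ 2 (by positivity) ?_
    have h1 : ‖w - c‖ ^ 2 = ‖w‖ ^ 2 - 2 * c * w.re + c ^ 2 := by
      rw [Complex.sq_norm, Complex.sq_norm, Complex.normSq_apply, Complex.normSq_apply]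
      simp; ring
    have h2 : ‖w‖ ^ 2 = (c - 1) * (1 + 2 * w.re) := by rw [hc]; field_simp; ring
    rw [h1]; nlinarith
  have hcb : (c : ℂ) ∈ Metric.ball (c : ℂ) (c + 1 / 2) := Metric.mem_ball_self (by positivity)
  have hL : DifferentiableOn ℂ (fun z => (γ₀ : ℂ) - z * E z) (Metric.ball (c : ℂ) (c + 1 / 2)) :=
    ((differentiableOn_const _).sub (differentiableOn_id.mul hEd)).mono hball
  obtain ⟨Φ, -, hΦ⟩ := hL.isExactOn_ball.with_val_at c 0
  have hd : ∀ z ∈ Metric.ball (c : ℂ) (c + 1 / 2),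
      HasDerivAt (fun z => riemannZeta₁ (1 + z) * Complex.exp (-Φ z)) 0 z := fun z hz => by
    have h1 : HasDerivAt (fun w : ℂ => riemannZeta₁ (1 + w)) (deriv riemannZeta₁ (1 + z)) z := by
      have := (differentiable_riemannZeta₁ (1 + z)).hasDerivAt.comp z
          ((hasDerivAt_id z).const_add 1)
      rw [mul_one] at this
      exact this
    refine (h1.mul (hΦ z hz).neg.cexp).congr_deriv ?_
    rw [hode z (hball hz)]; simp only [Pi.neg_apply]; ring
  have := Metric.isOpen_ball.is_const_of_deriv_eq_zero (convex_ball _ _).isPreconnected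
    (fun z hz => (hd z hz).differentiableAt.differentiableWithinAt)
    (fun z hz => (hd z hz).deriv) hwb hcb
  intro h
  rw [h, zero_mul] at this
  exact mul_ne_zero (zeta₁_ne_zero_of_re_pos (by simpa using hc0)) (Complex.exp_ne_zero _) this.symm

theorem riemannHypothesis_of_ne_zero (h : ∀ s : ℂ, 1 / 2 < s.re → s ≠ 1 → riemannZeta s ≠ 0) :
    RiemannHypothesis := by
  intro s hs htriv hs1
  rcases lt_trichotomy s.re (1 / 2) with hlt | heq | hgt
  · exfalso
    have hs0 : s ≠ 0 := fun h0 => by rw [h0, riemannZeta_zero] at hs; norm_num at hs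
    have h1s : (1 - s) ≠ 0 := sub_ne_zero.2 hs1.symm
    rw [riemannZeta_def_of_ne_zero hs0, div_eq_zero_iff] at hs
    rcases hs with hs | hs
    · refine h (1 - s) (by simp; linarith) (by simpa using hs0) ?_
      rw [riemannZeta_def_of_ne_zero h1s, completedRiemannZeta_one_sub, hs, zero_div]
    · rw [Complex.Gammaℝ_eq_zero_iff] at hs
      obtain ⟨n, hn⟩ := hs
      rcases n with _ | n
      · simp at hn; exact hs0 hn
      · exact htriv ⟨n, by rw [hn]; push_cast; ring⟩
  · exact heq
  · exact (h s hgt hs1 hs).elim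

theorem riemannHypothesis_of_gammaR (h : ∀ r : ℕ, exp (-γ₀) < gammaR r) : RiemannHypothesis := by
  obtain ⟨C, hC⟩ := errTail_lower h
  refine riemannHypothesis_of_ne_zero fun s hs hs1 => ?_
  rw [riemannZeta_eq_inv_sub_mul hs1]
  refine mul_ne_zero (inv_ne_zero (sub_ne_zero.2 hs1)) ?_
  have := zeta₁_ne_zero_of_lower hC (w := s - 1) (by simp; linarith)
  simpa using this

end ZeroFree

section Factor

theorem differentiable_dslope {f : ℂ → ℂ} (hf : Differentiable ℂ f) (a : ℂ) :
    Differentiable ℂ (dslope f a) := by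
  rw [← differentiableOn_univ] at hf ⊢
  exact (Complex.differentiableOn_dslope univ_mem).2 hf

theorem differentiable_iterate_dslope {f : ℂ → ℂ} (hf : Differentiable ℂ f) (a : ℂ) (n : ℕ) :
    Differentiable ℂ ((Function.swap dslope a)^[n] f) := by
  induction n generalizing f with
  | zero => exact hf
  | succ n ih => exact ih (differentiable_dslope hf a)

theorem exists_factor_at {f : ℂ → ℂ} (hf : Differentiable ℂ f) {a : ℂ}
    (ha : analyticOrderAt f a ≠ ⊤) : ∃ k : ℂ → ℂ, Differentiable ℂ k ∧ k a ≠ 0 ∧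
      ∀ z, f z = (z - a) ^ analyticOrderNatAt f a * k z := by
  have hfa : AnalyticAt ℂ f a := hf.analyticAt a
  obtain ⟨p, hp⟩ := id hfa
  have hp0 : p ≠ 0 := by
    intro h0
    exact ha (analyticOrderAt_eq_top.2 ((hp.locally_zero_iff).2 h0))
  have hk := differentiable_iterate_dslope hf a p.order
  have heq : p.order = analyticOrderNatAt f a := by
    refine ((hfa.analyticOrderNatAt_eq_iff ha).2 ⟨_, hk.analyticAt a,
      hp.iterate_dslope_fslope_ne_zero hp0, .of_forall hp.eq_pow_order_mul_iterate_dslope⟩).symm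
  refine ⟨_, hk, hp.iterate_dslope_fslope_ne_zero hp0, fun z => ?_⟩
  rw [← heq]
  simpa using hp.eq_pow_order_mul_iterate_dslope z

theorem analyticOrderAt_ne_top_of_entire {f : ℂ → ℂ} (hf : Differentiable ℂ f) {c : ℂ}
    (hc : f c ≠ 0) (a : ℂ) : analyticOrderAt f a ≠ ⊤ := by
  have h1 : AnalyticOnNhd ℂ f univ := fun z _ => hf.analyticAt z
  refine h1.analyticOrderAt_ne_top_of_isPreconnected isPreconnected_univ (mem_univ c)
    (mem_univ a) ?_
  rw [(hf.analyticAt c).analyticOrderAt_eq_zero.2 hc]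
  simp

theorem exists_factor_finset {f : ℂ → ℂ} (hf : Differentiable ℂ f) {c : ℂ} (hc : f c ≠ 0)
    (S : Finset ℂ) : ∃ k : ℂ → ℂ, Differentiable ℂ k ∧ (∀ a ∈ S, k a ≠ 0) ∧
      ∀ z, f z = (∏ a ∈ S, (z - a) ^ analyticOrderNatAt f a) * k z := by
  classical
  induction S using Finset.induction_on with
  | empty => exact ⟨f, hf, by simp, by simp⟩
  | insert b S hb ih =>
    obtain ⟨k, hk, hkS, hfk⟩ := ih
    have hkc : k c ≠ 0 := fun h => hc (by rw [hfk, h, mul_zero])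
    obtain ⟨k', hk', hk'b, hkk'⟩ := exists_factor_at hk (analyticOrderAt_ne_top_of_entire hk hkc b)
    have hord : analyticOrderNatAt f b = analyticOrderNatAt k b := by
      refine ((hf.analyticAt b).analyticOrderNatAt_eq_iff
        (analyticOrderAt_ne_top_of_entire hf hc b)).2
        ⟨fun z => (∏ a ∈ S, (z - a) ^ analyticOrderNatAt f a) * k' z, ?_, ?_,
          .of_forall fun z => ?_⟩
      · exact Differentiable.analyticAt (by fun_prop) b
      · refine mul_ne_zero (Finset.prod_ne_zero_iff.2 fun a ha => pow_ne_zero _ ?_) hk'b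
        exact sub_ne_zero.2 fun h => hb (h ▸ ha)
      · rw [hfk, hkk', smul_eq_mul]; ring
    refine ⟨k', hk', fun a ha => ?_, fun z => ?_⟩
    · rcases Finset.mem_insert.1 ha with rfl | ha
      · exact hk'b
      · exact fun h => hkS a ha (by rw [hkk', h, mul_zero])
    · rw [hfk, hkk', Finset.prod_insert hb, hord]; ring

theorem finite_zeros {f : ℂ → ℂ} (hf : Differentiable ℂ f) {c : ℂ} (hc : f c ≠ 0) (R : ℝ) :
    {z | f z = 0 ∧ ‖z‖ ≤ R}.Finite := by
  have h1 : AnalyticOnNhd ℂ f univ := fun z _ => hf.analyticAt z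
  have h2 := h1.preimage_zero_mem_codiscrete (x := c) hc
  rw [mem_codiscrete'] at h2
  have hcl : IsClosed (f ⁻¹' {0}) := by simpa using h2.1
  have hd : IsDiscrete (f ⁻¹' {0}) := by simpa using h2.2
  have := ((isCompact_closedBall (0 : ℂ) R).inter_right hcl).finite (hd.mono inter_subset_right)
  refine this.subset fun z hz => ⟨by simpa using hz.2, hz.1⟩

theorem logDeriv_factor {f k : ℂ → ℂ} {S : Finset ℂ} {m : ℂ → ℕ} (hk : Differentiable ℂ k)
    (hfk : ∀ z, f z = (∏ a ∈ S, (z - a) ^ m a) * k z) {z : ℂ} (hz : f z ≠ 0) :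
    logDeriv f z = ∑ a ∈ S, m a / (z - a) + logDeriv k z := by
  have hz' := hz
  rw [hfk] at hz'
  have hf : f = fun z => (∏ a ∈ S, (z - a) ^ m a) * k z := funext hfk
  have hne := Finset.prod_ne_zero_iff.1 (left_ne_zero_of_mul hz')
  rw [hf, logDeriv_mul z (left_ne_zero_of_mul hz') (right_ne_zero_of_mul hz') (by fun_prop)
    (hk z)]
  congr 1
  have := logDeriv_prod (s := S) (f := fun a z => (z - a) ^ m a) (x := z) hne
    (fun a _ => by fun_prop)
  rw [this]
  refine Finset.sum_congr rfl fun a _ => ?_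
  rw [logDeriv_fun_pow (by fun_prop)]
  simp [logDeriv_apply, div_eq_mul_inv]

end Factor

section LogDerivBound

theorem norm_logDeriv_sub_le {k : ℂ → ℂ} (hk : Differentiable ℂ k) {c : ℂ} {ρ M : ℝ}
    (hρ : 0 < ρ) (hM : 0 < M) (hne : ∀ z ∈ Metric.ball c ρ, k z ≠ 0)
    (hkM : ∀ z ∈ Metric.ball c ρ, ‖k z‖ ≤ exp M * ‖k c‖) {x y : ℂ}
    (hx : x ∈ Metric.ball c (ρ / 8)) (hy : y ∈ Metric.ball c (ρ / 8)) :
    ‖logDeriv k x - logDeriv k y‖ ≤ 64 * M / ρ ^ 2 * ‖x - y‖ := by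
  have hd : DifferentiableOn ℂ (logDeriv k) (Metric.ball c ρ) := by
    have h1 : DifferentiableOn ℂ (deriv k) (Metric.ball c ρ) := hk.deriv.differentiableOn
    exact h1.div hk.differentiableOn hne
  have hc : c ∈ Metric.ball c ρ := Metric.mem_ball_self hρ
  obtain ⟨L, hLc, hL⟩ := hd.isExactOn_ball.with_val_at c 0
  have hexp : ∀ z ∈ Metric.ball c ρ, k z * Complex.exp (-L z) = k c := by
    intro z hz
    have hG : ∀ z ∈ Metric.ball c ρ, HasDerivAt (fun z => k z * Complex.exp (-L z)) 0 z := by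
      intro z hz
      refine ((hk z).hasDerivAt.mul (hL z hz).neg.cexp).congr_deriv ?_
      rw [logDeriv_apply]; field_simp [hne z hz]; ring
    have := Metric.isOpen_ball.is_const_of_deriv_eq_zero (convex_ball c ρ).isPreconnected
      (fun z hz => (hG z hz).differentiableAt.differentiableWithinAt)
      (fun z hz => (hG z hz).deriv) hz hc
    simpa [hLc] using this
  have hre : ∀ z ∈ Metric.ball c ρ, (L z).re ≤ M := by
    intro z hz
    have h1 : ‖k z‖ = ‖k c‖ * exp ((L z).re) := by
      rw [← hexp z hz, norm_mul, Complex.norm_exp, Complex.neg_re, mul_assoc, ← Real.exp_add]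
      simp
    have h2 := hkM z hz
    rw [h1, mul_comm (exp M)] at h2
    exact exp_le_exp.1 (le_of_mul_le_mul_left h2 (norm_pos_iff.2 (hne c hc)))
  have hLd : DifferentiableOn ℂ L (Metric.ball c ρ) :=
    fun z hz => (hL z hz).differentiableAt.differentiableWithinAt
  have hLb : ∀ z ∈ Metric.closedBall c (ρ / 2), ‖L z‖ ≤ 2 * M := by
    intro z hz
    rw [Metric.mem_closedBall, dist_eq_norm] at hz
    have hmap : MapsTo (fun w => c + w) (Metric.ball 0 ρ) (Metric.ball c ρ) := by
      intro w hw; simpa [dist_eq_norm] using hw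
    have := Complex.borelCaratheodory_zero (f := fun w => L (c + w)) (z := z - c) (R := ρ) hM
      (hLd.comp (by fun_prop) hmap) (fun w hw => hre _ (hmap hw)) hρ (by
        rw [mem_ball_zero_iff]; linarith) (by simpa using hLc)
    simp only [add_sub_cancel] at this
    refine this.trans ?_
    rw [div_le_iff₀ (by linarith)]
    nlinarith
  have hL1 : ∀ z ∈ Metric.closedBall c (ρ / 4), ‖logDeriv k z‖ ≤ 8 * M / ρ := by
    intro z hz
    rw [Metric.mem_closedBall] at hz
    have hsub : Metric.closedBall z (ρ / 4) ⊆ Metric.closedBall c (ρ / 2) :=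
      Metric.closedBall_subset_closedBall' (by linarith)
    have hsub' : Metric.closedBall z (ρ / 4) ⊆ Metric.ball c ρ :=
      hsub.trans (Metric.closedBall_subset_ball (by linarith))
    have := Complex.norm_deriv_le_of_forall_mem_sphere_norm_le (c := z) (R := ρ / 4) (f := L)
      (by linarith) ((hLd.mono hsub').diffContOnCl_ball Subset.rfl)
      (fun w hw => hLb w (hsub (Metric.sphere_subset_closedBall hw)))
    rw [(hL z (Metric.ball_subset_ball (by linarith : ρ/2 ≤ ρ) (by
      rw [Metric.mem_ball]; linarith))).deriv] at this
    refine this.trans (le_of_eq ?_)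
    field_simp; norm_num
  have hL2 : ∀ z ∈ Metric.ball c (ρ / 8), ‖deriv (logDeriv k) z‖ ≤ 64 * M / ρ ^ 2 := by
    intro z hz
    rw [Metric.mem_ball] at hz
    have hsub : Metric.closedBall z (ρ / 8) ⊆ Metric.closedBall c (ρ / 4) :=
      Metric.closedBall_subset_closedBall' (by linarith)
    have hsub' : Metric.closedBall z (ρ / 8) ⊆ Metric.ball c ρ :=
      hsub.trans (Metric.closedBall_subset_ball (by linarith))
    have := Complex.norm_deriv_le_of_forall_mem_sphere_norm_le (c := z) (R := ρ / 8)
      (f := logDeriv k)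
      (by linarith) ((hd.mono hsub').diffContOnCl_ball Subset.rfl)
      (fun w hw => hL1 w (hsub (Metric.sphere_subset_closedBall hw)))
    refine this.trans (le_of_eq ?_)
    field_simp; norm_num
  have := (convex_ball c (ρ / 8)).norm_image_sub_le_of_norm_deriv_le (f := logDeriv k)
    (fun z hz => hd.differentiableAt (Metric.isOpen_ball.mem_nhds
      (Metric.ball_subset_ball (by linarith) hz))) hL2 hy hx
  exact this

end LogDerivBound

section MittagLeffler

theorem norm_factor_le {h k : ℂ → ℂ} {S : Finset ℂ} {m : ℂ → ℕ} (hk : Differentiable ℂ k)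
    (hfk : ∀ z, h z = (∏ a ∈ S, (z - a) ^ m a) * k z) {c : ℂ} (hc : h c = 1) {R M : ℝ}
    (hR : 1 ≤ R) (hcR : ‖c‖ ≤ R) (hS : ∀ a ∈ S, ‖a‖ ≤ R)
    (hM : ∀ z, ‖z‖ ≤ 3 * R → ‖h z‖ ≤ exp M) {z : ℂ} (hz : ‖z‖ ≤ R) :
    ‖k z‖ ≤ exp M * ‖k c‖ := by
  refine Complex.norm_le_of_forall_mem_frontier_norm_le (U := Metric.ball 0 (3 * R))
    Metric.isBounded_ball (hk.diffContOnCl) (fun w hw => ?_) (subset_closure (by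
      rw [mem_ball_zero_iff]; linarith))
  rw [frontier_ball _ (by linarith), mem_sphere_zero_iff_norm] at hw
  have hmono : ∏ a ∈ S, ‖(c - a) ^ m a‖ ≤ ∏ a ∈ S, ‖(w - a) ^ m a‖ := by
    refine Finset.prod_le_prod (fun _ _ => norm_nonneg _) fun a ha => ?_
    rw [norm_pow, norm_pow]
    refine pow_le_pow_left₀ (norm_nonneg _) ?_ _
    have h1 := norm_sub_le c a
    have h2 := norm_sub_norm_le w a
    have h3 := hS a ha
    linarith
  have hcp : (∏ a ∈ S, ‖(c - a) ^ m a‖) * ‖k c‖ = 1 := by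
    rw [← norm_prod, ← norm_mul, ← hfk, hc, norm_one]
  have hwp : (∏ a ∈ S, ‖(w - a) ^ m a‖) * ‖k w‖ ≤ exp M := by
    rw [← norm_prod, ← norm_mul, ← hfk]; exact hM w hw.le
  have hP0 : 0 ≤ ∏ a ∈ S, ‖(c - a) ^ m a‖ := Finset.prod_nonneg fun _ _ => norm_nonneg _
  calc ‖k w‖ = ((∏ a ∈ S, ‖(c - a) ^ m a‖) * ‖k c‖) * ‖k w‖ := by rw [hcp, one_mul]
    _ = ((∏ a ∈ S, ‖(c - a) ^ m a‖) * ‖k w‖) * ‖k c‖ := by ring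
    _ ≤ ((∏ a ∈ S, ‖(w - a) ^ m a‖) * ‖k w‖) * ‖k c‖ := by gcongr
    _ ≤ exp M * ‖k c‖ := by gcongr

theorem logDeriv_neg_of_even {h : ℂ → ℂ} (heven : ∀ z, h (-z) = h z) (z : ℂ) :
    logDeriv h (-z) = - logDeriv h z := by
  have h1 : deriv h (-z) = - deriv h z := by
    have := deriv_comp_neg h z
    rw [funext heven] at this
    rw [this, neg_neg]
  rw [logDeriv_apply, logDeriv_apply, heven, h1, neg_div]

theorem re_div_sub {a : ℂ} (ha : a.re = 0) (n : ℕ) (z : ℝ) :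
    ((n : ℂ) / ((z : ℂ) - a)).re = n * (z / (z ^ 2 + a.im ^ 2)) := by
  rw [Complex.div_re]
  simp [Complex.normSq_apply, ha]
  ring

theorem abs_re_logDeriv_sub_le {h : ℂ → ℂ} (hd : Differentiable ℂ h)
    (heven : ∀ z, h (-z) = h z) (hone : h (1 / 2) = 1) (hzero : ∀ a, h a = 0 → a.re = 0)
    {R M : ℝ} (hR : 1 ≤ R) (hM0 : 0 < M) (hM : ∀ z, ‖z‖ ≤ 3 * R → ‖h z‖ ≤ exp M)
    {S : Finset ℂ} (hS : ∀ a, a ∈ S ↔ h a = 0 ∧ ‖a‖ ≤ R) {z : ℝ} (hz : 0 < z)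
    (hzR : 8 * z + 5 < R) :
    |(logDeriv h z).re - ∑ a ∈ S, analyticOrderNatAt h a * (z / (z ^ 2 + a.im ^ 2))| ≤
      64 * M / (R - 1 / 2) ^ 2 * z := by
  have hc : h (1 / 2) ≠ 0 := by rw [hone]; exact one_ne_zero
  obtain ⟨k, hk, hkS, hfk⟩ := exists_factor_finset hd hc S
  have hcn : ‖(1 / 2 : ℂ)‖ = 1 / 2 := by norm_num
  have hball : ∀ w ∈ Metric.ball (1 / 2 : ℂ) (R - 1 / 2), ‖w‖ ≤ R := by
    intro w hw
    rw [Metric.mem_ball, dist_eq_norm] at hw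
    have := norm_sub_norm_le w (1 / 2)
    linarith
  have hne : ∀ w ∈ Metric.ball (1 / 2 : ℂ) (R - 1 / 2), k w ≠ 0 := by
    intro w hw h0
    have hw0 : h w = 0 := by rw [hfk, h0, mul_zero]
    exact hkS w ((hS w).2 ⟨hw0, hball w hw⟩) h0
  have hmem : ∀ x : ℝ, |x| ≤ z → (x : ℂ) ∈ Metric.ball (1 / 2 : ℂ) ((R - 1 / 2) / 8) := by
    intro x hx
    rw [Metric.mem_ball, dist_eq_norm]
    have h1 := norm_sub_le (x : ℂ) (1 / 2)
    rw [hcn, Complex.norm_real, norm_eq_abs] at h1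
    linarith
  have key := norm_logDeriv_sub_le hk (by linarith) hM0 hne
    (fun w hw => norm_factor_le hk hfk hone hR (by rw [hcn]; linarith)
      (fun a ha => ((hS a).1 ha).2) hM (hball w hw))
    (hmem z (abs_of_pos hz).le) (hmem (-z) (by rw [abs_neg, abs_of_pos hz]))
  have hnz : ∀ x : ℝ, x ≠ 0 → h x ≠ 0 := fun x hx h0 => hx (by simpa using hzero _ h0)
  have e1 := logDeriv_factor hk hfk (hnz z hz.ne')
  have e2 := logDeriv_factor hk hfk (hnz (-z) (by linarith))
  have e3 : logDeriv h ((-z : ℝ) : ℂ) = -logDeriv h z := by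
    rw [Complex.ofReal_neg, logDeriv_neg_of_even heven]
  rw [e3] at e2
  have r1 := congrArg Complex.re e1
  have r2 := congrArg Complex.re e2
  rw [Complex.add_re, Complex.re_sum, Finset.sum_congr rfl fun a ha =>
    re_div_sub (hzero a ((hS a).1 ha).1) _ _] at r1 r2
  have hneg : ∑ a ∈ S, (analyticOrderNatAt h a : ℝ) * (-z / ((-z) ^ 2 + a.im ^ 2)) =
      - ∑ a ∈ S, (analyticOrderNatAt h a : ℝ) * (z / (z ^ 2 + a.im ^ 2)) := by
    rw [← Finset.sum_neg_distrib]
    refine Finset.sum_congr rfl fun a _ => ?_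
    rw [neg_sq]; ring
  rw [hneg, Complex.neg_re] at r2
  have h2 : ‖(z : ℂ) - ((-z : ℝ) : ℂ)‖ = 2 * z := by
    rw [← Complex.ofReal_sub, Complex.norm_real, norm_eq_abs, abs_of_pos (by linarith)]; ring
  rw [h2] at key
  have h3 := (Complex.abs_re_le_norm _).trans key
  rw [Complex.sub_re] at h3
  have h4 : 2 * ((logDeriv h z).re - ∑ a ∈ S, analyticOrderNatAt h a * (z / (z ^ 2 + a.im ^ 2)))
      = (logDeriv k z).re - (logDeriv k ((-z : ℝ) : ℂ)).re := by linarith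
  rw [← h4, abs_mul, abs_two] at h3
  linarith

theorem hasSum_logDeriv_of_even {h : ℂ → ℂ} (hd : Differentiable ℂ h)
    (heven : ∀ z, h (-z) = h z) (hone : h (1 / 2) = 1) (hzero : ∀ a, h a = 0 → a.re = 0)
    {A : ℝ} (hA : 0 < A)
    (hgrow : ∀ R : ℝ, 1 ≤ R → ∀ z, ‖z‖ ≤ R → ‖h z‖ ≤ exp (A * R ^ (3 / 2 : ℝ)))
    {z : ℝ} (hz : 0 < z) :
    HasSum (fun a : ℂ => (analyticOrderNatAt h a : ℝ) * (z / (z ^ 2 + a.im ^ 2)))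
      (logDeriv h z).re := by
  have hc : h (1 / 2) ≠ 0 := by rw [hone]; exact one_ne_zero
  set F : ℂ → ℝ := fun a => (analyticOrderNatAt h a : ℝ) * (z / (z ^ 2 + a.im ^ 2)) with hF
  have hF0 : ∀ a, 0 ≤ F a := fun a => by positivity
  have hF1 : ∀ a, h a ≠ 0 → F a = 0 := by
    intro a ha
    have : analyticOrderNatAt h a = 0 := by
      rw [analyticOrderNatAt, (hd.analyticAt a).analyticOrderAt_eq_zero.2 ha]; rfl
    simp [hF, this]
  set S : ℕ → Finset ℂ := fun n => (finite_zeros hd hc n).toFinset with hSdef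
  have hS : ∀ n a, a ∈ S n ↔ h a = 0 ∧ ‖a‖ ≤ n := fun n a => by simp [hSdef]
  have hlim : Tendsto (fun n : ℕ => ∑ a ∈ S n, F a) atTop (𝓝 (logDeriv h z).re) := by
    have hb : ∀ᶠ n : ℕ in atTop, ‖(∑ a ∈ S n, F a) - (logDeriv h z).re‖ ≤
        (64 * A * 3 ^ (3 / 2 : ℝ) * 4 * z) * (n : ℝ) ^ (-(1 / 2) : ℝ) := by
      filter_upwards [eventually_gt_atTop ⌈8 * z + 5⌉₊] with n hn
      have hn' : 8 * z + 5 < n := lt_of_le_of_lt (Nat.le_ceil _) (by exact_mod_cast hn)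
      have hn1 : (1 : ℝ) ≤ n := by linarith
      have hn0 : (0 : ℝ) < n := by linarith
      have := abs_re_logDeriv_sub_le hd heven hone hzero hn1
        (M := A * (3 * n) ^ (3 / 2 : ℝ)) (by positivity) (hgrow (3 * n) (by linarith)) (hS n) hz hn'
      rw [norm_eq_abs, abs_sub_comm]
      refine this.trans ?_
      rw [mul_rpow (by norm_num) hn0.le]
      have e1 : (n : ℝ) ^ (3 / 2 : ℝ) = (n : ℝ) ^ 2 * (n : ℝ) ^ (-(1 / 2) : ℝ) := by
        rw [← rpow_natCast, ← rpow_add hn0]; norm_num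
      rw [e1]
      have e2 : (n : ℝ) ^ 2 / (n - 1 / 2) ^ 2 ≤ 4 := by
        rw [div_le_iff₀ (by nlinarith)]; nlinarith
      calc _ = (64 * A * 3 ^ (3 / 2 : ℝ) * z * (n : ℝ) ^ (-(1 / 2) : ℝ)) *
            ((n : ℝ) ^ 2 / (n - 1 / 2) ^ 2) := by ring
        _ ≤ (64 * A * 3 ^ (3 / 2 : ℝ) * z * (n : ℝ) ^ (-(1 / 2) : ℝ)) * 4 := by gcongr
        _ = _ := by ring
    rw [tendsto_iff_norm_sub_tendsto_zero]
    refine squeeze_zero' (.of_forall fun _ => norm_nonneg _) hb ?_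
    have := ((tendsto_rpow_neg_atTop (y := 1 / 2) (by norm_num)).comp
      (tendsto_natCast_atTop_atTop (R := ℝ))).const_mul (64 * A * 3 ^ (3 / 2 : ℝ) * 4 * z)
    simpa using this
  have hmono : Monotone fun n : ℕ => ∑ a ∈ S n, F a := by
    intro n m hnm
    refine Finset.sum_le_sum_of_subset_of_nonneg (fun a ha => ?_) fun a _ _ => hF0 a
    rw [hS] at ha ⊢
    exact ⟨ha.1, ha.2.trans (by exact_mod_cast hnm)⟩
  refine hasSum_of_isLUB_of_nonneg _ hF0 ⟨?_, fun b hb => ?_⟩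
  · rintro _ ⟨T, rfl⟩
    obtain ⟨n, hn⟩ : ∃ n : ℕ, ∀ a ∈ T, ‖a‖ ≤ n := by
      obtain ⟨C, hC⟩ := T.finite_toSet.isBounded.exists_norm_le
      obtain ⟨n, hn⟩ := exists_nat_ge C
      exact ⟨n, fun a ha => (hC a ha).trans hn⟩
    refine le_trans ?_ (hmono.ge_of_tendsto hlim n)
    classical
    have : ∑ a ∈ T, F a = ∑ a ∈ T with h a = 0, F a := by
      rw [Finset.sum_filter_of_ne]
      intro a _ ha
      by_contra h0
      exact ha (hF1 a h0)
    beta_reduce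
    rw [this]
    refine Finset.sum_le_sum_of_subset_of_nonneg (fun a ha => ?_) fun a _ _ => hF0 a
    rw [Finset.mem_filter] at ha
    exact (hS n a).2 ⟨ha.2, hn a ha.1⟩
  · exact le_of_tendsto' hlim fun n => hb ⟨S n, rfl⟩

end MittagLeffler

section Xi

noncomputable def xiFun (z : ℂ) : ℂ := (z ^ 2 - 1 / 4) * completedRiemannZeta₀ (1 / 2 + z) + 1

theorem differentiable_xiFun : Differentiable ℂ xiFun := by
  have h := differentiable_completedZeta₀
  unfold xiFun
  exact ((by fun_prop : Differentiable ℂ fun z : ℂ => z ^ 2 - 1 / 4).mul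
    (h.comp (by fun_prop : Differentiable ℂ fun z : ℂ => 1 / 2 + z))).add_const 1

theorem xiFun_neg (z : ℂ) : xiFun (-z) = xiFun z := by
  unfold xiFun
  rw [← completedRiemannZeta₀_one_sub (1 / 2 + z), neg_sq]
  ring_nf

theorem xiFun_half : xiFun (1 / 2) = 1 := by
  unfold xiFun; norm_num

theorem Gamma_three_half : Complex.Gamma (1 / 2 + 1) = 1 / 2 * (π : ℂ) ^ (1 / 2 : ℂ) := by
  rw [Complex.Gamma_add_one _ (by norm_num), Complex.Gamma_one_half_eq]

theorem xiFun_eq {s : ℂ} (hs : 0 < s.re) :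
    xiFun (s - 1 / 2) = 2 * riemannZeta₁ s * (π : ℂ) ^ (-s / 2) * Complex.Gamma (s / 2 + 1) := by
  have hs0 : s ≠ 0 := fun h => by simp [h] at hs
  by_cases h1 : s = 1
  · rw [h1, riemannZeta₁_one, Gamma_three_half, show (1 : ℂ) - 1 / 2 = 1 / 2 by norm_num,
        xiFun_half,
      show (-1 : ℂ) / 2 = -(1 / 2) by norm_num, Complex.cpow_neg]
    have : (π : ℂ) ^ (1 / 2 : ℂ) ≠ 0 := by simp [Complex.cpow_eq_zero_iff, pi_ne_zero]
    field_simp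
  · have hs1 : s - 1 ≠ 0 := sub_ne_zero.2 h1
    have hs1' : 1 - s ≠ 0 := sub_ne_zero.2 (Ne.symm h1)
    have e1 := riemannZeta_eq_inv_sub_mul h1
    have e2 := riemannZeta_def_of_ne_zero hs0
    have hG : Complex.Gammaℝ s ≠ 0 := Complex.Gammaℝ_ne_zero_of_re_pos hs
    have e3 := completedRiemannZeta_eq s
    have e4 : riemannZeta₁ s = (s - 1) * (completedRiemannZeta s / Complex.Gammaℝ s) := by
      rw [← e2, e1, mul_inv_cancel_left₀ hs1]
    have e5 : completedRiemannZeta₀ s = completedRiemannZeta s + 1 / s + 1 / (1 - s) := by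
      rw [e3]; ring
    have e6 : (π : ℂ) ^ (-s / 2) * Complex.Gamma (s / 2) = Complex.Gammaℝ s := rfl
    rw [Complex.Gamma_add_one _ (by simpa using hs0), e4]
    calc xiFun (s - 1 / 2) = s * (s - 1) * completedRiemannZeta₀ s + 1 := by
          unfold xiFun; ring_nf
      _ = s * (s - 1) * completedRiemannZeta s := by
          rw [e5]; field_simp; ring
      _ = (s - 1) * (completedRiemannZeta s / Complex.Gammaℝ s) * s *
          ((π : ℂ) ^ (-s / 2) * Complex.Gamma (s / 2)) := by
          rw [e6]; field_simp
      _ = _ := by ring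

theorem re_eq_zero_of_xiFun (hRH : RiemannHypothesis) {a : ℂ} (ha : xiFun a = 0) : a.re = 0 := by
  have key : ∀ a : ℂ, 0 ≤ a.re → xiFun a = 0 → a.re = 0 := by
    intro a h0 ha
    have hs : 0 < (1 / 2 + a).re := by simp; linarith
    have h := xiFun_eq hs
    rw [show 1 / 2 + a - 1 / 2 = a by ring, ha] at h
    have hG : Complex.Gamma ((1 / 2 + a) / 2 + 1) ≠ 0 :=
      Complex.Gamma_ne_zero_of_re_pos (by simp; linarith)
    have hp : (π : ℂ) ^ (-(1 / 2 + a) / 2) ≠ 0 := by simp [Complex.cpow_eq_zero_iff, pi_ne_zero]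
    have hz : riemannZeta₁ (1 / 2 + a) = 0 := by
      by_contra hne
      exact mul_ne_zero (mul_ne_zero (mul_ne_zero two_ne_zero hne) hp) hG h.symm
    have h1 : (1 / 2 + a) ≠ 1 := fun h => by rw [h, riemannZeta₁_one] at hz; exact one_ne_zero hz
    have := hRH (1 / 2 + a) (by rw [riemannZeta_eq_inv_sub_mul h1, hz, mul_zero]) (by
      rintro ⟨n, hn⟩
      rw [hn] at hs
      simp at hs
      have : (0 : ℝ) ≤ n := n.cast_nonneg
      linarith) h1
    simp at this; linarith
  rcases le_total 0 a.re with h | h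
  · exact key a h ha
  · have := key (-a) (by simpa using h) (by rw [xiFun_neg, ha])
    simpa using this

theorem logDeriv_xiFun {s : ℂ} (hs : 0 < s.re) (h1 : riemannZeta₁ s ≠ 0) :
    logDeriv xiFun (s - 1 / 2) = logDeriv riemannZeta₁ s - Real.log π / 2
      + Complex.digamma (s / 2 + 1) / 2 := by
  have hp : ∀ s : ℂ, (π : ℂ) ^ (-s / 2) ≠ 0 := by simp [Complex.cpow_eq_zero_iff, pi_ne_zero]
  have hre : 0 < (s / 2 + 1).re := by simp; linarith
  have hG : Complex.Gamma (s / 2 + 1) ≠ 0 := Complex.Gamma_ne_zero_of_re_pos hre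
  have hev : (fun s => xiFun (s - 1 / 2)) =ᶠ[𝓝 s]
      fun s => 2 * riemannZeta₁ s * (π : ℂ) ^ (-s / 2) * Complex.Gamma (s / 2 + 1) := by
    filter_upwards [(isOpen_re_gt 0).mem_nhds hs] with w hw using xiFun_eq hw
  have hd1 : DifferentiableAt ℂ riemannZeta₁ s := differentiable_riemannZeta₁ s
  have hπ : (π : ℂ) ≠ 0 := by simp [pi_ne_zero]
  have hd2 : HasDerivAt (fun s : ℂ => (π : ℂ) ^ (-s / 2))
      ((π : ℂ) ^ (-s / 2) * Complex.log π * (-1 / 2)) s :=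
    HasDerivAt.const_cpow (((hasDerivAt_id s).neg).div_const 2) (Or.inl hπ)
  have hd3 : HasDerivAt (fun s : ℂ => Complex.Gamma (s / 2 + 1))
      (deriv Complex.Gamma (s / 2 + 1) * (1 / 2)) s := by
    refine HasDerivAt.comp s (Complex.differentiableAt_Gamma _ fun m hm => ?_).hasDerivAt
      (((hasDerivAt_id s).div_const 2).add_const 1)
    rw [hm] at hre
    have : (0 : ℝ) ≤ m := m.cast_nonneg
    simp at hre; linarith
  have e := (logDeriv_congr_nhds hev).eq_of_nhds
  have e1 : logDeriv (fun s => xiFun (s - 1 / 2)) s = logDeriv xiFun (s - 1 / 2) := by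
    rw [logDeriv_apply, logDeriv_apply, deriv_comp_sub_const]
  rw [← e1, e, logDeriv_mul s (f := fun s => 2 * riemannZeta₁ s * (π : ℂ) ^ (-s / 2))
      (mul_ne_zero (mul_ne_zero two_ne_zero h1) (hp s)) hG
          ((hd1.const_mul 2).mul hd2.differentiableAt) hd3.differentiableAt,
    logDeriv_mul s (f := fun s => 2 * riemannZeta₁ s) (mul_ne_zero two_ne_zero h1) (hp s)
        (hd1.const_mul 2) hd2.differentiableAt,
    logDeriv_const_mul _ _ two_ne_zero, logDeriv_apply (fun s : ℂ => (π : ℂ) ^ (-s / 2)), hd2.deriv,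
    logDeriv_apply (fun s : ℂ => Complex.Gamma (s / 2 + 1)), hd3.deriv, Complex.digamma_def,
    logDeriv_apply Complex.Gamma, Complex.ofReal_log pi_pos.le]
  have := hp s
  field_simp
  ring

theorem digamma_add_nat (m : ℕ) : Complex.digamma (3 / 2 + m) =
    Complex.digamma (3 / 2) + ∑ n ∈ Finset.range m, 2 / (2 * (n : ℂ) + 3) := by
  induction m with
  | zero => simp
  | succ m ih =>
    have hne : ∀ k : ℕ, (3 / 2 + (m : ℂ)) ≠ -k := by
      intro k h
      have := congrArg Complex.re h
      simp at this
      have h1 : (0 : ℝ) ≤ k := k.cast_nonneg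
      have h2 : (0 : ℝ) ≤ m := m.cast_nonneg
      norm_num at this; linarith
    rw [Finset.sum_range_succ, ← add_assoc, ← ih, Nat.cast_succ, ← add_assoc,
      Complex.digamma_apply_add_one _ hne]
    congr 1
    have h0 : (3 / 2 + (m : ℂ)) ≠ 0 := by simpa using hne 0
    have h3 : (2 * (m : ℂ) + 3) ≠ 0 := by
      intro h; apply h0; linear_combination h / 2
    have h3' : (3 + (m : ℂ) * 2) ≠ 0 := by rwa [mul_comm, add_comm]
    have h0' : (3 + 2 * (m : ℂ)) ≠ 0 := by rwa [add_comm]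
    field_simp
    ring

theorem digamma_three_half : Complex.digamma (3 / 2) = 2 - 2 * Real.log 2 - γ₀ := by
  have h := Complex.digamma_apply_add_one (1 / 2) (by
    intro k h
    have := congrArg Complex.re h
    have h1 : (0 : ℝ) ≤ k := k.cast_nonneg
    simp at this; norm_num at this; linarith)
  rw [Complex.digamma_one_half] at h
  norm_num at h
  have e : ((Real.log 2 : ℝ) : ℂ) = Complex.log 2 := by
    rw [Complex.ofReal_log (by norm_num)]; norm_num
  rw [h, e]
  ring

noncomputable def xiLog (z : ℝ) : ℝ := (logDeriv xiFun z).re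

theorem logDeriv_xiFun_half : logDeriv xiFun ((1 / 2 : ℝ) : ℂ) =
    γ₀ - Real.log π / 2 + Complex.digamma (3 / 2) / 2 := by
  have := logDeriv_xiFun (s := 1) (by simp) (by simp)
  rw [show (1 : ℂ) - 1 / 2 = ((1 / 2 : ℝ) : ℂ) by push_cast; ring] at this
  rw [this, logDeriv_apply, deriv_riemannZeta₁_one, riemannZeta₁_one]
  norm_num

theorem xiLog_half : xiLog (1 / 2) = γ₀ / 2 + 1 - Real.log (4 * π) / 2 := by
  rw [xiLog, logDeriv_xiFun_half, digamma_three_half, log_mul (by norm_num) pi_ne_zero,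
    show (4 : ℝ) = 2 ^ 2 by norm_num, Real.log_pow]
  have : (((γ₀ : ℝ) : ℂ) - (Real.log π : ℝ) / 2 + (2 - 2 * (Real.log 2 : ℝ) - (γ₀ : ℝ)) / 2) =
      ((γ₀ - Real.log π / 2 + (2 - 2 * Real.log 2 - γ₀) / 2 : ℝ) : ℂ) := by push_cast; ring
  rw [this, Complex.ofReal_re]
  push_cast; ring

theorem errLaplace_two_mul {m : ℕ} (hm : 1 ≤ m) : (errLaplace (2 * m)).re * (2 * m) =
    xiLog (1 / 2) - xiLog (1 / 2 + 2 * m) + ∑ n ∈ Finset.range m, 1 / (2 * (n : ℝ) + 3) := by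
  have hm' : (1 : ℝ) ≤ m := by exact_mod_cast hm
  have hre : 0 < (2 * (m : ℂ)).re := by simp; omega
  have hre1 : 0 < (1 + 2 * (m : ℂ)).re := by simp at hre ⊢; linarith
  have h1 := errLaplace_eq hre
  have h2 := logDeriv_xiFun hre1 (zeta₁_ne_zero_of_re_pos hre)
  rw [show (1 + 2 * (m : ℂ)) / 2 + 1 = 3 / 2 + m by ring, digamma_add_nat,
    show 1 + 2 * (m : ℂ) - 1 / 2 = ((1 / 2 + 2 * m : ℝ) : ℂ) by push_cast; ring] at h2
  have h3 : errLaplace (2 * m) * (2 * m : ℝ) = logDeriv xiFun ((1 / 2 : ℝ) : ℂ) -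
      logDeriv xiFun ((1 / 2 + 2 * m : ℝ) : ℂ) +
      ((∑ n ∈ Finset.range m, 1 / (2 * (n : ℝ) + 3) : ℝ) : ℂ) := by
    have hm0 : (m : ℂ) ≠ 0 := by simp; omega
    rw [h1, h2, logDeriv_xiFun_half, logDeriv_apply]
    push_cast
    rw [div_mul_cancel₀ _ (by simpa using hm0)]
    have : ∑ n ∈ Finset.range m, 2 / (2 * (n : ℂ) + 3) =
        2 * ∑ n ∈ Finset.range m, 1 / (2 * (n : ℂ) + 3) := by
      rw [Finset.mul_sum]; exact Finset.sum_congr rfl fun _ _ => by ring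
    rw [this]; ring
  have h4 := congrArg Complex.re h3
  rw [Complex.re_mul_ofReal, Complex.add_re, Complex.sub_re, Complex.ofReal_re] at h4
  exact h4

end Xi

section Growth

theorem norm_Gamma_le {s : ℂ} (hs : 0 < s.re) : ‖Complex.Gamma s‖ ≤ Real.Gamma s.re := by
  rw [Complex.Gamma_eq_integral hs, Complex.GammaIntegral, Real.Gamma_eq_integral hs]
  refine (MeasureTheory.norm_integral_le_integral_norm _).trans (le_of_eq ?_)
  refine setIntegral_congr_fun measurableSet_Ioi fun x hx => ?_
  rw [norm_mul, Complex.norm_cpow_eq_rpow_re_of_pos hx, Complex.norm_real, norm_eq_abs,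
    abs_of_pos (exp_pos _)]
  simp

theorem Gamma_le_exp {x R : ℝ} (hR : 1 ≤ R) (hx : 1 ≤ x) (hxR : x ≤ 3 * R) :
    Real.Gamma x ≤ exp (16 * R ^ (3 / 2 : ℝ)) := by
  set N := ⌈x⌉₊ with hN
  have hNx : x ≤ N := Nat.le_ceil x
  have hN1 : (N : ℝ) < x + 1 := Nat.ceil_lt_add_one (by linarith)
  have hN0 : (1 : ℝ) ≤ N := hx.trans hNx
  have hΓ : 0 < Real.Gamma x := Gamma_pos_of_pos (by linarith)
  have h1 : Real.Gamma x ≤ Real.Gamma (x + 1) := by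
    rw [Real.Gamma_add_one (by linarith)]; nlinarith
  have h2 : Real.Gamma (x + 1) ≤ Real.Gamma (N + 1) :=
    Gamma_strictMonoOn_Ici.monotoneOn (by simp; linarith) (by simp only [mem_Ici]; linarith)
        (by linarith)
  rw [Real.Gamma_nat_eq_factorial] at h2
  have h3 : (N.factorial : ℝ) ≤ (N : ℝ) ^ N := by exact_mod_cast Nat.factorial_le_pow N
  have h4 : (N : ℝ) ^ N = exp (N * Real.log N) := by
    rw [mul_comm, exp_mul, exp_log (by linarith), rpow_natCast]
  have h5 : Real.log N ≤ (N : ℝ) ^ (1 / 2 : ℝ) / (1 / 2) :=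
    log_le_rpow_div (by linarith) (by norm_num)
  refine (h1.trans h2).trans (h3.trans ?_)
  rw [h4]
  refine exp_le_exp.2 ?_
  have h6 : (N : ℝ) * Real.log N ≤ 2 * (N : ℝ) ^ (3 / 2 : ℝ) := by
    have : (N : ℝ) ^ (3 / 2 : ℝ) = N * (N : ℝ) ^ (1 / 2 : ℝ) := by
      rw [show (3 / 2 : ℝ) = 1 + 1 / 2 by norm_num, rpow_add (by linarith), rpow_one]
    rw [this]
    nlinarith
  have h7 : (N : ℝ) ^ (3 / 2 : ℝ) ≤ (4 * R) ^ (3 / 2 : ℝ) :=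
    rpow_le_rpow (by linarith) (by linarith) (by norm_num)
  have h8 : (4 * R) ^ (3 / 2 : ℝ) = 8 * R ^ (3 / 2 : ℝ) := by
    rw [mul_rpow (by norm_num) (by linarith), show (4 : ℝ) = 2 ^ (2 : ℝ) by norm_num,
      ← rpow_mul (by norm_num)]
    norm_num
  linarith

theorem norm_xiFun_le {R : ℝ} (hR : 1 ≤ R) {z : ℂ} (hz : ‖z‖ ≤ R) :
    ‖xiFun z‖ ≤ exp (22 * R ^ (3 / 2 : ℝ)) := by
  wlog h0 : 0 ≤ z.re generalizing z
  · rw [← xiFun_neg]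
    exact this (by rwa [norm_neg]) (by simp; linarith)
  set s := 1 / 2 + z with hsdef
  have hzs : z = s - 1 / 2 := by rw [hsdef]; ring
  have hre : s.re = 1 / 2 + z.re := by simp [hsdef]
  have hs : 1 / 2 ≤ s.re := by linarith
  have hs1 : ‖s‖ ≤ 3 / 2 * R := by
    refine (norm_add_le _ _).trans ?_
    norm_num; linarith
  have hs2 : ‖s - 1‖ ≤ 3 / 2 * R := by
    rw [hsdef, show 1 / 2 + z - 1 = z - 1 / 2 by ring]
    refine (norm_sub_le _ _).trans ?_
    norm_num; linarith
  rw [hzs, xiFun_eq (by linarith), norm_mul, norm_mul, norm_mul]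
  have hζ : ‖riemannZeta₁ s‖ ≤ 6 * R ^ 2 := by
    refine (norm_zeta₁_le (by linarith)).trans ?_
    have : ‖s‖ * ‖s - 1‖ / s.re ≤ (3 / 2 * R) * (3 / 2 * R) / (1 / 2) := by gcongr
    nlinarith
  have hp : ‖(π : ℂ) ^ (-s / 2)‖ ≤ 1 := by
    rw [Complex.norm_cpow_eq_rpow_re_of_pos pi_pos]
    refine rpow_le_one_of_one_le_of_nonpos (by linarith [pi_gt_three]) ?_
    simp; linarith
  have hsre : s.re ≤ 3 / 2 * R := (Complex.re_le_norm s).trans hs1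
  have hΓ : ‖Complex.Gamma (s / 2 + 1)‖ ≤ exp (16 * R ^ (3 / 2 : ℝ)) := by
    have e : (s / 2 + 1).re = s.re / 2 + 1 := by simp
    refine (norm_Gamma_le (by rw [e]; linarith)).trans ?_
    rw [e]
    exact Gamma_le_exp hR (by linarith) (by linarith)
  have hRR : R ≤ R ^ (3 / 2 : ℝ) := by
    calc R = R ^ (1 : ℝ) := (rpow_one R).symm
      _ ≤ _ := rpow_le_rpow_of_exponent_le hR (by norm_num)
  have hq : 12 * R ^ 2 ≤ exp (6 * R ^ (3 / 2 : ℝ)) := by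
    have h1 := quadratic_le_exp_of_nonneg (x := 6 * R) (by linarith)
    have h2 : exp (6 * R) ≤ exp (6 * R ^ (3 / 2 : ℝ)) := exp_le_exp.2 (by linarith)
    nlinarith
  calc ‖(2 : ℂ)‖ * ‖riemannZeta₁ s‖ * ‖(π : ℂ) ^ (-s / 2)‖ * ‖Complex.Gamma (s / 2 + 1)‖
      ≤ 2 * (6 * R ^ 2) * 1 * exp (16 * R ^ (3 / 2 : ℝ)) := by
        rw [Complex.norm_ofNat]; gcongr
    _ = (12 * R ^ 2) * exp (16 * R ^ (3 / 2 : ℝ)) := by ring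
    _ ≤ exp (6 * R ^ (3 / 2 : ℝ)) * exp (16 * R ^ (3 / 2 : ℝ)) := by gcongr
    _ = _ := by rw [← Real.exp_add]; ring_nf

theorem hasSum_xiLog (hRH : RiemannHypothesis) {z : ℝ} (hz : 0 < z) :
    HasSum (fun a : ℂ => (analyticOrderNatAt xiFun a : ℝ) * (z / (z ^ 2 + a.im ^ 2))) (xiLog z) :=
  hasSum_logDeriv_of_even differentiable_xiFun xiFun_neg xiFun_half
    (fun _ => re_eq_zero_of_xiFun hRH) (by norm_num : (0 : ℝ) < 22)
    (fun _ hR _ hz => norm_xiFun_le hR hz) hz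

end Growth

section LaplaceUniqueness

theorem eq_zero_of_laplace_even {d : ℝ → ℝ} (hd : Continuous d) {K : ℝ}
    (hK : ∀ u, 0 ≤ u → |d u| ≤ K * exp u)
    (h0 : ∀ m : ℕ, 2 ≤ m → ∫ u in Ioi (0 : ℝ), d u * exp (-(2 * m) * u) = 0) {u : ℝ} (hu : 0 ≤ u) :
    d u = 0 := by
  have hint : ∀ c : ℝ, 1 < c → IntegrableOn (fun u => d u * exp (-c * u)) (Ioi 0) := by
    intro c hc
    refine Integrable.mono' ((integrableOn_exp_mul_Ioi (a := 1 - c) (by linarith) 0).const_mul K)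
      (by fun_prop) ((ae_restrict_iff' measurableSet_Ioi).2 (.of_forall fun u hu => ?_))
    rw [norm_mul, norm_eq_abs, norm_eq_abs, abs_of_pos (exp_pos _)]
    calc |d u| * exp (-c * u) ≤ K * exp u * exp (-c * u) := by
          gcongr; exact hK u (le_of_lt hu)
      _ = _ := by rw [mul_assoc, ← Real.exp_add]; ring_nf
  set g : ℝ → ℝ := fun t => t * d (-(Real.log t) / 2) with hg
  have hg0 : ContinuousOn g (Icc 0 1) := by
    intro t ht
    rcases eq_or_lt_of_le ht.1 with rfl | ht0
    · have hgz : g 0 = 0 := by simp [hg]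
      rw [ContinuousWithinAt, hgz]
      have hlim : Tendsto (fun t : ℝ => K * √t) (𝓝[Icc 0 1] 0) (𝓝 0) := by
        have : ContinuousAt (fun t : ℝ => K * √t) 0 := by fun_prop
        have h := this.tendsto.mono_left (nhdsWithin_le_nhds (s := Icc 0 1))
        simpa using h
      refine squeeze_zero_norm' ?_ hlim
      filter_upwards [self_mem_nhdsWithin] with t ht
      rcases eq_or_lt_of_le ht.1 with rfl | ht0
      · simp [hg]
      · have h1 := hK (-(Real.log t) / 2) (by linarith [log_nonpos ht.1 ht.2])
        have h2 : exp (-(Real.log t) / 2) = (√t)⁻¹ := by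
          rw [sqrt_eq_rpow, rpow_def_of_pos ht0, ← exp_neg]; ring_nf
        rw [norm_eq_abs, abs_mul, abs_of_pos ht0]
        rw [h2] at h1
        calc t * |d (-(Real.log t) / 2)| ≤ t * (K * (√t)⁻¹) := by gcongr
          _ = K * √t := by rw [mul_left_comm, ← div_eq_mul_inv, div_sqrt]
    · refine ContinuousAt.continuousWithinAt ?_
      exact continuousAt_id.mul (hd.continuousAt.comp (by
        have := continuousAt_log ht0.ne'
        fun_prop))
  have hgexp : ∀ u, g (exp (-2 * u)) = d u * exp (-2 * u) := by
    intro u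
    simp only [hg, Real.log_exp]; rw [mul_comm]; ring_nf
  have hexpmem : ∀ u ∈ Ioi (0 : ℝ), exp (-2 * u) ∈ Icc (0 : ℝ) 1 := fun u hu =>
    ⟨(exp_pos _).le, exp_le_one_iff.2 (by have : (0 : ℝ) < u := hu; linarith)⟩
  have hterm : ∀ (p : Polynomial ℝ) (u : ℝ), d u * exp (-4 * u) * p.eval (exp (-2 * u)) =
      ∑ i ∈ Finset.range (p.natDegree + 1), p.coeff i * (d u * exp (-(2 * (i + 2 : ℕ)) * u)) := by
    intro p u
    rw [Polynomial.eval_eq_sum_range, Finset.mul_sum]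
    refine Finset.sum_congr rfl fun i _ => ?_
    rw [← Real.exp_nat_mul]
    have : exp (-(2 * (i + 2 : ℕ)) * u) = exp (-4 * u) * exp (i * (-2 * u)) := by
      rw [← Real.exp_add]; push_cast; ring_nf
    rw [this]; ring
  have hintm : ∀ i : ℕ, IntegrableOn (fun u => d u * exp (-(2 * (i + 2 : ℕ)) * u)) (Ioi 0) := by
    intro i
    refine hint _ ?_
    push_cast
    have : (0 : ℝ) ≤ i := i.cast_nonneg
    linarith
  have hpoly : ∀ p : Polynomial ℝ,
      IntegrableOn (fun u => d u * exp (-4 * u) * p.eval (exp (-2 * u))) (Ioi 0) ∧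
      ∫ u in Ioi (0 : ℝ), d u * exp (-4 * u) * p.eval (exp (-2 * u)) = 0 := by
    intro p
    simp_rw [hterm p]
    refine ⟨integrable_finsetSum _ fun i _ => (hintm i).const_mul _, ?_⟩
    rw [integral_finsetSum _ fun i _ => (hintm i).const_mul _]
    refine Finset.sum_eq_zero fun i _ => ?_
    rw [MeasureTheory.integral_const_mul, h0 _ (by omega), mul_zero]
  have h4 := hint 4 (by norm_num)
  set D := ∫ u in Ioi (0 : ℝ), |d u * exp (-4 * u)| with hD
  have hD0 : 0 ≤ D := integral_nonneg fun _ => abs_nonneg _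
  have hsqe : ∀ u, d u * exp (-4 * u) * g (exp (-2 * u)) = (d u * exp (-3 * u)) ^ 2 := by
    intro u
    rw [hgexp, mul_pow, ← Real.exp_nat_mul]
    have : exp ((2 : ℕ) * (-3 * u)) = exp (-4 * u) * exp (-2 * u) := by
      rw [← Real.exp_add]; push_cast; ring_nf
    rw [this]; ring
  have hsqi : IntegrableOn (fun u => (d u * exp (-3 * u)) ^ 2) (Ioi 0) := by
    refine Integrable.mono' ((h4.norm).const_mul |K|) (by fun_prop)
      ((ae_restrict_iff' measurableSet_Ioi).2 (.of_forall fun u hu => ?_))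
    rw [norm_eq_abs, abs_of_nonneg (sq_nonneg _), ← hsqe, hgexp]
    have hu' : (0 : ℝ) < u := hu
    refine (le_abs_self _).trans ?_
    rw [abs_mul, mul_comm, norm_eq_abs]
    refine mul_le_mul_of_nonneg_right ?_ (abs_nonneg _)
    rw [abs_mul, abs_of_pos (exp_pos (-2 * u))]
    calc |d u| * exp (-2 * u) ≤ K * exp u * exp (-2 * u) := by gcongr; exact hK u hu'.le
      _ = K * exp (-u) := by rw [mul_assoc, ← Real.exp_add]; ring_nf
      _ ≤ |K| * 1 := by
        gcongr
        · exact le_abs_self K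
        · exact exp_le_one_iff.2 (by linarith)
      _ = |K| := mul_one _
  have hzero : ∫ u in Ioi (0 : ℝ), (d u * exp (-3 * u)) ^ 2 = 0 := by
    refine le_antisymm (le_of_forall_pos_le_add fun ε hε => ?_)
      (integral_nonneg fun _ => sq_nonneg _)
    obtain ⟨p, hp⟩ := exists_polynomial_near_of_continuousOn 0 1 g hg0 (ε / (D + 1)) (by positivity)
    obtain ⟨hpi, hp0⟩ := hpoly p
    have hsub := MeasureTheory.integral_sub hsqi hpi
    rw [hp0, sub_zero] at hsub
    rw [zero_add, ← hsub]
    calc _ ≤ ∫ u in Ioi (0 : ℝ), |d u * exp (-4 * u)| * (ε / (D + 1)) := by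
          refine setIntegral_mono_on (hsqi.sub hpi) (h4.abs.mul_const _) measurableSet_Ioi
            fun u hu => ?_
          rw [← hsqe, ← mul_sub]
          refine (le_abs_self _).trans ?_
          rw [abs_mul, abs_sub_comm (g _)]
          exact mul_le_mul_of_nonneg_left (hp _ (hexpmem u hu)).le (abs_nonneg _)
      _ = D * (ε / (D + 1)) := by rw [MeasureTheory.integral_mul_const]
      _ ≤ ε := by
        rw [mul_div_assoc', div_le_iff₀ (by linarith)]; nlinarith
  have hae := (setIntegral_eq_zero_iff_of_nonneg_ae (.of_forall fun _ => sq_nonneg _) hsqi).1 hzero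
  have hon : EqOn (fun u => (d u * exp (-3 * u)) ^ 2) 0 (Ioi 0) :=
    Measure.eqOn_open_of_ae_eq hae isOpen_Ioi (by fun_prop) continuousOn_const
  have hcl : EqOn (fun u => (d u * exp (-3 * u)) ^ 2) 0 (closure (Ioi 0)) :=
    hon.closure (by fun_prop) continuous_const
  rw [closure_Ioi] at hcl
  have := hcl hu
  simpa [exp_ne_zero] using this

end LaplaceUniqueness

section Modes

noncomputable def modeTerm (b : ℂ) (u : ℝ) : ℝ := ((1 - Complex.exp (-b * u)) / b ^ 2).re

theorem continuous_modeTerm (b : ℂ) : Continuous (modeTerm b) := by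
  unfold modeTerm
  exact Complex.continuous_re.comp (by fun_prop)

theorem norm_cexp_neg_mul (b : ℂ) (u : ℝ) : ‖Complex.exp (-b * u)‖ = exp (-(b.re * u)) := by
  rw [Complex.norm_exp]; simp

theorem abs_modeTerm_le {b : ℂ} (hb : 0 < b.re) {u : ℝ} (hu : 0 ≤ u) :
    |modeTerm b u| ≤ 2 / ‖b‖ ^ 2 := by
  refine (Complex.abs_re_le_norm _).trans ?_
  rw [norm_div, norm_pow]
  gcongr
  refine (norm_sub_le _ _).trans ?_
  rw [norm_one, norm_cexp_neg_mul]
  have : exp (-(b.re * u)) ≤ 1 := exp_le_one_iff.2 (by nlinarith)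
  linarith

theorem abs_modeTerm_sub_le {b : ℂ} {δ : ℝ} (hb : δ ≤ b.re) {u : ℝ} (hu : 0 ≤ u) :
    |modeTerm b u - (1 / b ^ 2).re| ≤ exp (-(δ * u)) * (1 / ‖b‖ ^ 2) := by
  have : modeTerm b u - (1 / b ^ 2).re = (-Complex.exp (-b * u) / b ^ 2).re := by
    rw [modeTerm, ← Complex.sub_re]; ring_nf
  rw [this]
  refine (Complex.abs_re_le_norm _).trans ?_
  rw [norm_div, norm_pow, norm_neg, norm_cexp_neg_mul, div_eq_mul_one_div]
  gcongr

theorem laplace_modeTerm {b : ℂ} (hb : 0 < b.re) {x : ℝ} (hx : 0 < x) :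
    IntegrableOn (fun u => modeTerm b u * exp (-x * u)) (Ioi 0) ∧
    ∫ u in Ioi (0 : ℝ), modeTerm b u * exp (-x * u) = (1 / (b * x * (x + b))).re := by
  have hb0 : b ≠ 0 := fun h => by simp [h] at hb
  have hxr : 0 < (x : ℂ).re := by simpa using hx
  have hxb : 0 < ((x : ℂ) + b).re := by simp; linarith
  have hxb0 : (x : ℂ) + b ≠ 0 := fun h => by rw [h] at hxb; simp at hxb
  have hx0 : (x : ℂ) ≠ 0 := by simpa using hx.ne'
  have e : ∀ u : ℝ, (1 - Complex.exp (-b * u)) / b ^ 2 * Complex.exp (-(x : ℂ) * u) =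
      1 / b ^ 2 * Complex.exp (-(x : ℂ) * u) - 1 / b ^ 2 * Complex.exp (-((x : ℂ) + b) * u) := by
    intro u
    have : Complex.exp (-((x : ℂ) + b) * u) =
        Complex.exp (-b * u) * Complex.exp (-(x : ℂ) * u) := by
      rw [← Complex.exp_add]; ring_nf
    rw [this]; ring
  have hr : ∀ u : ℝ, modeTerm b u * exp (-x * u) =
      ((1 - Complex.exp (-b * u)) / b ^ 2 * Complex.exp (-(x : ℂ) * u)).re := by
    intro u
    have : Complex.exp (-(x : ℂ) * u) = ((exp (-x * u) : ℝ) : ℂ) := by push_cast; ring_nf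
    rw [this, Complex.re_mul_ofReal, modeTerm]
  have i1 := (integrable_cexp hxr 0).const_mul (1 / b ^ 2)
  have i2 := (integrable_cexp hxb 0).const_mul (1 / b ^ 2)
  have i3 : IntegrableOn (fun u : ℝ => (1 - Complex.exp (-b * u)) / b ^ 2 *
      Complex.exp (-(x : ℂ) * u)) (Ioi 0) := by
    simp_rw [e]; exact i1.sub i2
  refine ⟨by simp_rw [hr]; exact i3.re, ?_⟩
  simp_rw [hr]
  have h1 := integral_re (𝕜 := ℂ) i3
  have h2 : ∫ u in Ioi (0 : ℝ), (1 - Complex.exp (-b * u)) / b ^ 2 * Complex.exp (-(x : ℂ) * u) =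
      1 / (b * x * (x + b)) := by
    simp_rw [e]
    rw [MeasureTheory.integral_sub i1 i2, MeasureTheory.integral_const_mul,
      MeasureTheory.integral_const_mul, integral_cexp hxr, integral_cexp hxb]
    field_simp
    ring
  rw [h2] at h1
  exact h1

theorem sq_mul_laplace_modeTerm {b : ℂ} (hb : 0 < b.re) {x : ℝ} (hx : 0 < x) :
    x ^ 2 * (1 / (b * x * (x + b))).re = (1 / b).re - (1 / (x + b)).re := by
  have hb0 : b ≠ 0 := fun h => by simp [h] at hb
  have hxb : 0 < ((x : ℂ) + b).re := by simp; linarith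
  have hxb0 : (x : ℂ) + b ≠ 0 := fun h => by rw [h] at hxb; simp at hxb
  have hx0 : (x : ℂ) ≠ 0 := by simpa using hx.ne'
  rw [← Complex.sub_re, ← Complex.re_ofReal_mul]
  congr 1
  push_cast
  field_simp
  ring

variable {ι : Type*} {c : ι → ℝ} {b : ι → ℂ}

noncomputable def modeSum (c : ι → ℝ) (b : ι → ℂ) (u : ℝ) : ℝ :=
  ∑' i, c i * modeTerm (b i) (max u 0)

noncomputable def modeLim (c : ι → ℝ) (b : ι → ℂ) : ℝ := ∑' i, c i * (1 / b i ^ 2).re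

theorem abs_mul_modeTerm_le (hc : ∀ i, 0 ≤ c i) (hb : ∀ i, 0 < (b i).re) (i : ι) (u : ℝ) :
    ‖c i * modeTerm (b i) (max u 0)‖ ≤ 2 * (c i / ‖b i‖ ^ 2) := by
  rw [norm_mul, norm_eq_abs, norm_eq_abs, abs_of_nonneg (hc i)]
  calc _ ≤ c i * (2 / ‖b i‖ ^ 2) :=
        mul_le_mul_of_nonneg_left (abs_modeTerm_le (hb i) (le_max_right _ _)) (hc i)
    _ = _ := by ring

theorem continuous_modeSum (hc : ∀ i, 0 ≤ c i) (hb : ∀ i, 0 < (b i).re)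
    (hs : Summable fun i => c i / ‖b i‖ ^ 2) : Continuous (modeSum c b) := by
  refine continuous_tsum (fun i => ?_) (hs.mul_left 2) (abs_mul_modeTerm_le hc hb)
  have := continuous_modeTerm (b i)
  fun_prop

theorem abs_modeSum_le (hc : ∀ i, 0 ≤ c i) (hb : ∀ i, 0 < (b i).re)
    (hs : Summable fun i => c i / ‖b i‖ ^ 2) (u : ℝ) :
    |modeSum c b u| ≤ 2 * ∑' i, c i / ‖b i‖ ^ 2 := by
  rw [← tsum_mul_left, ← norm_eq_abs]
  exact tsum_of_norm_bounded (hs.mul_left 2).hasSum (abs_mul_modeTerm_le hc hb · u)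

theorem abs_modeSum_sub_le {δ : ℝ} (hδ : 0 < δ) (hc : ∀ i, 0 ≤ c i) (hb : ∀ i, δ ≤ (b i).re)
    (hs : Summable fun i => c i / ‖b i‖ ^ 2) {u : ℝ} (hu : 0 ≤ u) :
    |modeSum c b u - modeLim c b| ≤ exp (-(δ * u)) * ∑' i, c i / ‖b i‖ ^ 2 := by
  have hb' : ∀ i, 0 < (b i).re := fun i => hδ.trans_le (hb i)
  have s1 : Summable fun i => c i * modeTerm (b i) (max u 0) :=
    Summable.of_norm_bounded (hs.mul_left 2) (abs_mul_modeTerm_le hc hb' · u)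
  have s2 : Summable fun i => c i * (1 / b i ^ 2).re := by
    refine Summable.of_norm_bounded hs fun i => ?_
    rw [norm_mul, norm_eq_abs, abs_of_nonneg (hc i), div_eq_mul_one_div (c i)]
    refine mul_le_mul_of_nonneg_left ((Complex.abs_re_le_norm _).trans ?_) (hc i)
    rw [norm_div, norm_one, norm_pow]
  rw [modeSum, modeLim, ← s1.tsum_sub s2, ← tsum_mul_left, ← norm_eq_abs]
  refine tsum_of_norm_bounded (hs.mul_left _).hasSum fun i => ?_
  rw [← mul_sub, norm_mul, norm_eq_abs, norm_eq_abs, abs_of_nonneg (hc i), max_eq_left hu]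
  calc _ ≤ c i * (exp (-(δ * u)) * (1 / ‖b i‖ ^ 2)) :=
        mul_le_mul_of_nonneg_left (abs_modeTerm_sub_le (hb i) hu) (hc i)
    _ = _ := by ring

theorem laplace_modeSum [Countable ι] (hc : ∀ i, 0 ≤ c i) (hb : ∀ i, 0 < (b i).re)
    (hs : Summable fun i => c i / ‖b i‖ ^ 2) {x : ℝ} (hx : 0 < x) :
    IntegrableOn (fun u => modeSum c b u * exp (-x * u)) (Ioi 0) ∧
    HasSum (fun i => c i * ((1 / b i).re - (1 / (x + b i)).re))
      (x ^ 2 * ∫ u in Ioi (0 : ℝ), modeSum c b u * exp (-x * u)) := by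
  have hexp : IntegrableOn (fun u => exp (-x * u)) (Ioi 0) :=
    integrableOn_exp_mul_Ioi (by linarith) 0
  have hint : ∀ i, IntegrableOn (fun u => c i * modeTerm (b i) (max u 0) * exp (-x * u))
      (Ioi 0) := by
    intro i
    have : IntegrableOn (fun u => c i * (modeTerm (b i) u * exp (-x * u))) (Ioi 0) :=
      ((laplace_modeTerm (hb i) hx).1).const_mul (c i)
    refine this.congr_fun (fun u hu => ?_) measurableSet_Ioi
    beta_reduce
    rw [max_eq_left (le_of_lt hu), mul_assoc]
  refine ⟨?_, ?_⟩
  · refine Integrable.mono' (hexp.const_mul (2 * ∑' i, c i / ‖b i‖ ^ 2))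
      (((continuous_modeSum hc hb hs).mul (by fun_prop)).aestronglyMeasurable)
          (.of_forall fun u => ?_)
    rw [norm_mul, norm_eq_abs, norm_eq_abs, abs_of_pos (exp_pos _)]
    exact mul_le_mul_of_nonneg_right (abs_modeSum_le hc hb hs u) (exp_pos _).le
  · have hsum : Summable fun i =>
        ∫ u in Ioi (0 : ℝ), ‖c i * modeTerm (b i) (max u 0) * exp (-x * u)‖ := by
      refine Summable.of_nonneg_of_le (fun i => integral_nonneg fun _ => norm_nonneg _)
        (fun i => ?_) (hs.mul_left (2 * ∫ u in Ioi (0 : ℝ), exp (-x * u)))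
      calc _ ≤ ∫ u in Ioi (0 : ℝ), 2 * (c i / ‖b i‖ ^ 2) * exp (-x * u) := by
            refine setIntegral_mono_on (hint i).norm (hexp.const_mul _) measurableSet_Ioi
              fun u _ => ?_
            rw [norm_mul, norm_eq_abs (exp _), abs_of_pos (exp_pos _)]
            exact mul_le_mul_of_nonneg_right (abs_mul_modeTerm_le hc hb i u) (exp_pos _).le
        _ = _ := by rw [MeasureTheory.integral_const_mul]; ring
    have h := (hasSum_integral_of_summable_integral_norm hint hsum).mul_left (x ^ 2)
    have e1 : ∀ u, ∑' i, c i * modeTerm (b i) (max u 0) * exp (-x * u) =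
        modeSum c b u * exp (-x * u) := fun u => by rw [tsum_mul_right]; rfl
    simp_rw [e1] at h
    refine (congrArg (fun f => HasSum f _) (funext fun i => ?_)).mpr h
    rw [← sq_mul_laplace_modeTerm (hb i) hx, ← (laplace_modeTerm (hb i) hx).2, mul_left_comm,
      ← MeasureTheory.integral_const_mul (c i)]
    congr 1
    refine setIntegral_congr_fun measurableSet_Ioi fun u hu => ?_
    rw [max_eq_left (le_of_lt hu), mul_assoc]

end Modes

section ExplicitFormula

noncomputable def errInt (u : ℝ) : ℝ := ∫ v in (0 : ℝ)..u, err v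

theorem continuous_errInt : Continuous errInt :=
  continuous_primitive err_intervalIntegrable 0

theorem abs_errInt_le {C : ℝ} (hC : ∀ v, 0 ≤ v → |err v| ≤ C) {u : ℝ} (hu : 0 ≤ u) :
    |errInt u| ≤ C * u := by
  have := intervalIntegral.norm_integral_le_of_norm_le_const (a := 0) (b := u) (f := err) (C := C)
    fun v hv => by
      rw [uIoc_of_le hu] at hv
      simpa using hC v hv.1.le
  simpa [errInt, abs_of_nonneg hu] using this

theorem laplace_errInt {x : ℝ} (hx : 0 < x) :
    IntegrableOn (fun u => errInt u * exp (-x * u)) (Ioi 0) ∧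
    x ^ 2 * ∫ u in Ioi (0 : ℝ), errInt u * exp (-x * u) = x * (errLaplace x).re := by
  obtain ⟨C, hC1, hC⟩ := exists_err_bound
  have hint : IntegrableOn (fun v => err v * exp (-(x : ℂ).re * v)) (Ioi 0) :=
    laplace_integrable_real (A := C) (b := 0) measurable_err
      (fun v hv => by simpa using hC v hv.le) (by simpa using hx)
  obtain ⟨h1, h2⟩ := laplace_primitive measurable_err (s := (x : ℂ)) (by simpa using hx) hint
  have hf : (fun u : ℝ => ((∫ v in (0 : ℝ)..u, err v : ℝ) : ℂ) * Complex.exp (-(x : ℂ) * u)) =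
      fun u : ℝ => ((errInt u * exp (-x * u) : ℝ) : ℂ) := by
    funext u; push_cast; rfl
  rw [hf] at h1 h2
  have h3 := h1.re
  simp only [RCLike.re_eq_complex_re, Complex.ofReal_re] at h3
  refine ⟨h3, ?_⟩
  rw [integral_complex_ofReal] at h2
  rw [errLaplace, ← h2, ← Complex.ofReal_mul, Complex.ofReal_re]
  ring

theorem hasSum_quarter_telescope :
    HasSum (fun n : ℕ => (1 / (n + 1) - 1 / (n + 2) : ℝ) / 4) (1 / 4) := by
  rw [hasSum_iff_tendsto_nat_of_nonneg]
  · have h : ∀ n : ℕ, ∑ i ∈ Finset.range n, (1 / (i + 1) - 1 / (i + 2) : ℝ) / 4 =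
        1 / 4 - 1 / (n + 1) / 4 := by
      intro n
      induction n with
      | zero => simp
      | succ k ih => rw [Finset.sum_range_succ, ih]; push_cast; ring
    simp_rw [h]
    have := (tendsto_one_div_add_atTop_nhds_zero_nat (𝕜 := ℝ)).div_const 4
    simpa only [zero_div, sub_zero] using this.const_sub (1 / 4)
  · intro i
    have : (0 : ℝ) ≤ 1 / (i + 1) - 1 / (i + 2) := by
      rw [sub_nonneg]; gcongr; norm_num
    positivity

theorem inv_sq_odd_le (n : ℕ) :
    1 / ‖(2 * n + 3 : ℂ)‖ ^ 2 ≤ (1 / (n + 1) - 1 / (n + 2) : ℝ) / 4 := by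
  have : ‖(2 * n + 3 : ℂ)‖ = 2 * n + 3 := by
    rw [show (2 * n + 3 : ℂ) = ((2 * n + 3 : ℝ) : ℂ) by push_cast; ring, Complex.norm_real,
      norm_of_nonneg (by positivity)]
  rw [this, div_sub_div _ _ (by positivity) (by positivity), div_div,
    div_le_div_iff₀ (by positivity) (by positivity)]
  nlinarith

theorem summable_inv_sq_odd : Summable fun n : ℕ => 1 / ‖(2 * n + 3 : ℂ)‖ ^ 2 :=
  hasSum_quarter_telescope.summable.of_nonneg_of_le (fun _ => by positivity) inv_sq_odd_le

theorem tsum_inv_sq_odd_le : ∑' n : ℕ, 1 / ‖(2 * n + 3 : ℂ)‖ ^ 2 ≤ 1 / 4 := by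
  rw [← hasSum_quarter_telescope.tsum_eq]
  exact summable_inv_sq_odd.tsum_le_tsum inv_sq_odd_le hasSum_quarter_telescope.summable

theorem tendsto_sum_odd_sub (m : ℕ) : Tendsto (fun N : ℕ => ∑ n ∈ Finset.range N,
    (1 / (2 * (n : ℝ) + 3) - 1 / (2 * ((m + n : ℕ) : ℝ) + 3))) atTop
    (𝓝 (∑ n ∈ Finset.range m, 1 / (2 * (n : ℝ) + 3))) := by
  have h : ∀ N : ℕ, ∑ n ∈ Finset.range N,
      (1 / (2 * (n : ℝ) + 3) - 1 / (2 * ((m + n : ℕ) : ℝ) + 3)) =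
      ∑ n ∈ Finset.range m, 1 / (2 * (n : ℝ) + 3) -
        ∑ n ∈ Finset.range m, 1 / (2 * ((N + n : ℕ) : ℝ) + 3) := by
    intro N
    have h1 := Finset.sum_range_add (fun n : ℕ => 1 / (2 * (n : ℝ) + 3)) N m
    have h2 := Finset.sum_range_add (fun n : ℕ => 1 / (2 * (n : ℝ) + 3)) m N
    rw [add_comm N m] at h1
    rw [Finset.sum_sub_distrib]
    linarith
  simp_rw [h]
  have h0 : Tendsto (fun N : ℕ => ∑ n ∈ Finset.range m, 1 / (2 * ((N + n : ℕ) : ℝ) + 3)) atTop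
      (𝓝 (∑ n ∈ Finset.range m, 0)) := by
    refine tendsto_finsetSum _ fun n _ => ?_
    refine tendsto_const_nhds.div_atTop (tendsto_atTop_add_const_right _ _ ?_)
    exact (tendsto_natCast_atTop_atTop.comp (tendsto_add_atTop_nat n)).const_mul_atTop two_pos
  simpa using h0.const_sub (∑ n ∈ Finset.range m, 1 / (2 * (n : ℝ) + 3))

theorem exists_abs_sub_errInt_le (hRH : RiemannHypothesis) : ∃ W : ℝ, ∀ u, 0 ≤ u →
    |W - errInt u| ≤ exp (-(u / 2)) * (2 * xiLog (1 / 2)) + exp (-(3 * u)) / 4 := by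
  set ord : ℂ → ℝ := fun a => analyticOrderNatAt xiFun a with hord
  set S : Set ℂ := {a | analyticOrderNatAt xiFun a ≠ 0} with hS
  have hsum : ∀ {z : ℝ}, 0 < z →
      HasSum (fun a : S => ord a * (z / (z ^ 2 + (a : ℂ).im ^ 2))) (xiLog z) := by
    intro z hz
    refine (hasSum_subtype_iff_of_support_subset (f := fun a : ℂ =>
        ord a * (z / (z ^ 2 + a.im ^ 2)))
      (s := S) ?_).2 (hasSum_xiLog hRH hz)
    intro a ha h0
    apply ha
    have : analyticOrderNatAt xiFun a = 0 := h0
    simp [hord, this]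
  have hre : ∀ a : S, (a : ℂ).re = 0 := fun a =>
    re_eq_zero_of_xiFun hRH (apply_eq_zero_of_analyticOrderNatAt_ne_zero a.2)
  have hcount : Countable S := by
    have h := (hasSum_xiLog hRH (z := 1 / 2) (by norm_num)).summable.countable_support
    refine (h.mono fun a ha => ?_).to_subtype
    have h1 : (0 : ℝ) < (1 / 2) / ((1 / 2) ^ 2 + a.im ^ 2) := by positivity
    have h2 : (analyticOrderNatAt xiFun a : ℝ) ≠ 0 := by exact_mod_cast ha
    exact mul_ne_zero h2 h1.ne'
  have hinv : ∀ (x : ℝ) (a : S), (1 / ((x : ℂ) + (1 / 2 - (a : ℂ)))).re =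
      (1 / 2 + x) / ((1 / 2 + x) ^ 2 + (a : ℂ).im ^ 2) := by
    intro x a
    rw [one_div, Complex.inv_re, Complex.normSq_apply]
    simp [hre a]
    ring
  set c₁ : S → ℝ := fun a => ord a with hc₁
  set b₁ : S → ℂ := fun a => 1 / 2 - (a : ℂ) with hb₁
  have c1 : ∀ i, 0 ≤ c₁ i := fun i => Nat.cast_nonneg _
  have b1 : ∀ i, 1 / 2 ≤ (b₁ i).re := fun i => by simp [hb₁, hre i]
  have b1' : ∀ i, 0 < (b₁ i).re := fun i => lt_of_lt_of_le (by norm_num) (b1 i)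
  have hs1 : HasSum (fun i => c₁ i / ‖b₁ i‖ ^ 2) (2 * xiLog (1 / 2)) := by
    have h := (hsum (z := 1 / 2) (by norm_num)).mul_left 2
    refine h.congr_fun fun i => ?_
    rw [Complex.sq_norm, Complex.normSq_apply]
    simp only [hb₁, hc₁, Complex.sub_re, Complex.sub_im, hre i]
    norm_num
    ring
  set c₂ : ℕ → ℝ := fun _ => 1 with hc₂
  set b₂ : ℕ → ℂ := fun n => 2 * n + 3 with hb₂
  have c2 : ∀ i, 0 ≤ c₂ i := fun i => zero_le_one
  have hb2re : ∀ n, (b₂ n).re = 2 * n + 3 := fun n => by simp [hb₂]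
  have b2 : ∀ i, 3 ≤ (b₂ i).re := fun i => by
    rw [hb2re]; linarith [Nat.cast_nonneg (α := ℝ) i]
  have b2' : ∀ i, 0 < (b₂ i).re := fun i => lt_of_lt_of_le (by norm_num) (b2 i)
  have hs2 : Summable (fun i => c₂ i / ‖b₂ i‖ ^ 2) := summable_inv_sq_odd
  set d : ℝ → ℝ := fun u => errInt (max u 0) - modeSum c₁ b₁ u - modeSum c₂ b₂ u with hd
  have hdc : Continuous d :=
    ((continuous_errInt.comp (by fun_prop)).sub (continuous_modeSum c1 b1' hs1.summable)).sub
      (continuous_modeSum c2 b2' hs2)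
  have hlap : ∀ m : ℕ, 2 ≤ m → ∫ u in Ioi (0 : ℝ), d u * exp (-(2 * m) * u) = 0 := by
    intro m hm
    have hx : (0 : ℝ) < 2 * m := by positivity
    obtain ⟨i1, e1⟩ := laplace_errInt hx
    obtain ⟨i2, e2⟩ := laplace_modeSum c1 b1' hs1.summable hx
    obtain ⟨i3, e3⟩ := laplace_modeSum c2 b2' hs2 hx
    have e2' : HasSum (fun i => c₁ i * ((1 / b₁ i).re - (1 / (((2 * m : ℝ) : ℂ) + b₁ i)).re))
        (xiLog (1 / 2) - xiLog (1 / 2 + 2 * m)) := by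
      refine ((hsum (z := 1 / 2) (by norm_num)).sub
          (hsum (z := 1 / 2 + 2 * m) (by positivity))).congr_fun fun i => ?_
      have h0 := hinv 0 i
      have h1 := hinv (2 * m) i
      rw [Complex.ofReal_zero, zero_add, add_zero] at h0
      rw [h0, h1]
      ring
    have e3' := e3.tendsto_sum_nat
    have e3'' := tendsto_sum_odd_sub m
    have hfun : (fun N : ℕ => ∑ n ∈ Finset.range N,
        c₂ n * ((1 / b₂ n).re - (1 / (((2 * m : ℝ) : ℂ) + b₂ n)).re)) = fun N : ℕ =>
        ∑ n ∈ Finset.range N, (1 / (2 * (n : ℝ) + 3) - 1 / (2 * ((m + n : ℕ) : ℝ) + 3)) := by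
      funext N
      refine Finset.sum_congr rfl fun n _ => ?_
      have q1 : b₂ n = ((2 * n + 3 : ℝ) : ℂ) := by simp [hb₂]
      rw [q1, ← Complex.ofReal_add, ← Complex.ofReal_one, ← Complex.ofReal_div,
        ← Complex.ofReal_div, Complex.ofReal_re, Complex.ofReal_re]
      simp only [hc₂, one_mul]
      push_cast
      ring_nf
    rw [hfun] at e3'
    have E2 := e2.unique e2'
    have E3 := tendsto_nhds_unique e3' e3''
    have E1 := errLaplace_two_mul (m := m) (by omega)
    have hsplit : ∫ u in Ioi (0 : ℝ), d u * exp (-(2 * m) * u) =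
        (∫ u in Ioi (0 : ℝ), errInt u * exp (-(2 * m) * u)) -
        (∫ u in Ioi (0 : ℝ), modeSum c₁ b₁ u * exp (-(2 * m) * u)) -
        ∫ u in Ioi (0 : ℝ), modeSum c₂ b₂ u * exp (-(2 * m) * u) := by
      rw [← MeasureTheory.integral_sub i1 i2,
          ← MeasureTheory.integral_sub (f := fun u =>
          errInt u * exp (-(2 * m) * u) - modeSum c₁ b₁ u * exp (-(2 * m) * u))
        (i1.sub i2) i3]
      refine setIntegral_congr_fun measurableSet_Ioi fun u hu => ?_
      simp only [hd, max_eq_left (le_of_lt (mem_Ioi.1 hu))]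
      ring
    have hx2 : ((2 * m : ℝ)) ^ 2 ≠ 0 := by positivity
    refine (mul_eq_zero.1 ?_).resolve_left hx2
    rw [hsplit, mul_sub, mul_sub, e1, E2, E3]
    push_cast
    linarith
  have hbd : ∃ K, ∀ u, 0 ≤ u → |d u| ≤ K * exp u := by
    obtain ⟨C, hC1, hC⟩ := exists_err_bound
    set A := 2 * ∑' i, c₁ i / ‖b₁ i‖ ^ 2
    set B := 2 * ∑' i, c₂ i / ‖b₂ i‖ ^ 2
    have hA : 0 ≤ A := by have := c1; positivity
    have hB : 0 ≤ B := by have := c2; positivity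
    refine ⟨C + A + B, fun u hu => ?_⟩
    have h1 := abs_errInt_le hC hu
    have h2 := abs_modeSum_le c1 b1' hs1.summable u
    have h3 := abs_modeSum_le c2 b2' hs2 u
    have h4 : |d u| ≤ |errInt u| + |modeSum c₁ b₁ u| + |modeSum c₂ b₂ u| := by
      simp only [hd, max_eq_left hu]
      exact (abs_sub _ _).trans (add_le_add_left (abs_sub _ _) _)
    have h5 := Real.add_one_le_exp u
    nlinarith
  obtain ⟨K, hK⟩ := hbd
  refine ⟨modeLim c₁ b₁ + modeLim c₂ b₂, fun u hu => ?_⟩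
  have h0 := eq_zero_of_laplace_even hdc hK hlap hu
  simp only [hd, max_eq_left hu] at h0
  have h1 := abs_modeSum_sub_le (by norm_num) c1 b1 hs1.summable hu
  have h2 := abs_modeSum_sub_le (by norm_num) c2 b2 hs2 hu
  rw [hs1.tsum_eq] at h1
  have h3 : ∑' i, c₂ i / ‖b₂ i‖ ^ 2 ≤ 1 / 4 := tsum_inv_sq_odd_le
  have h4 := mul_le_mul_of_nonneg_left h3 (exp_pos (-(3 * u))).le
  rw [show -(1 / 2 * u) = -(u / 2) by ring] at h1
  rw [show modeLim c₁ b₁ + modeLim c₂ b₂ - errInt u =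
    -((modeSum c₁ b₁ u - modeLim c₁ b₁) + (modeSum c₂ b₂ u - modeLim c₂ b₂)) by linarith, abs_neg]
  refine (abs_add_le _ _).trans ?_
  linarith

end ExplicitFormula

section Large

theorem errInt_sub (a b : ℝ) : ∫ v in a..b, err v = errInt b - errInt a := by
  rw [errInt, errInt, integral_interval_sub_left (err_intervalIntegrable _ _)
    (err_intervalIntegrable _ _)]

theorem abs_errTail_le_of_errInt {W c u₁ : ℝ} (hu₁ : 0 < u₁)
    (hV : ∀ u, u₁ ≤ u → |W - errInt u| ≤ c * exp (-(u / 2))) {u : ℝ} (hu : u₁ ≤ u) :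
    |errTail u| ≤ 2 * c * exp (-(u / 2)) / u ^ 2 := by
  have hu0 : 0 < u := hu₁.trans_le hu
  obtain ⟨C, hC1, hC⟩ := exists_err_bound
  have hder : ∀ v : ℝ, u < v → HasDerivAt (fun v : ℝ => (((v ^ 2)⁻¹ : ℝ) : ℂ))
      ((-2 * v ^ (-3 : ℝ) : ℝ) : ℂ) v := by
    intro v hv
    have hv0 : 0 < v := hu0.trans hv
    refine (HasDerivAt.ofReal_comp ?_)
    refine ((hasDerivAt_pow 2 v).inv (by positivity)).congr_deriv ?_
    rw [rpow_neg hv0.le, show (3 : ℝ) = (3 : ℕ) by norm_num, rpow_natCast]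
    field_simp
    push_cast
    ring
  have hi3 : ∀ v : ℝ, 0 < v → IntegrableOn (fun x : ℝ => x ^ (-3 : ℝ)) (Ioi v) := fun v hv =>
    integrableOn_Ioi_rpow_of_lt (by norm_num) hv
  have hI3 : ∀ v : ℝ, 0 < v → ∫ x in Ioi v, 2 * x ^ (-3 : ℝ) = 1 / v ^ 2 := by
    intro v hv
    rw [MeasureTheory.integral_const_mul, integral_Ioi_rpow_of_lt (by norm_num) hv,
      show (-3 + 1 : ℝ) = -(2 : ℕ) by norm_num, rpow_neg hv.le, rpow_natCast]
    field_simp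
    norm_num
  have h := (integral_primitive_mul (a := u) measurable_err hder ?_ ?_ ?_ ?_).2
  · have e1 : ∫ v in Ioi u, (err v : ℂ) * (((v ^ 2)⁻¹ : ℝ) : ℂ) = (errTail u : ℂ) := by
      rw [errTail, ← integral_complex_ofReal]
      refine setIntegral_congr_fun measurableSet_Ioi fun v _ => ?_
      push_cast; rfl
    rw [e1] at h
    have e2 : ‖(errTail u : ℂ)‖ = |errTail u| := Complex.norm_real _
    rw [← e2, ← norm_neg, ← h]
    have hb : ∀ v, u < v → ‖((∫ w in u..v, err w : ℝ) : ℂ) * ((-2 * v ^ (-3 : ℝ) : ℝ) : ℂ)‖ ≤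
        2 * c * exp (-(u / 2)) * (2 * v ^ (-3 : ℝ)) := by
      intro v hv
      have hv0 : 0 < v := hu0.trans hv
      rw [norm_mul, Complex.norm_real, Complex.norm_real, norm_eq_abs, norm_eq_abs, abs_mul,
        abs_neg, abs_two, abs_of_pos (rpow_pos_of_pos hv0 _)]
      refine mul_le_mul_of_nonneg_right ?_ (by positivity)
      rw [errInt_sub, show errInt v - errInt u = (W - errInt u) - (W - errInt v) by ring]
      have h1 := hV u hu
      have h2 := hV v (hu.trans hv.le)
      have hc : 0 ≤ c := by
        have := (abs_nonneg _).trans h1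
        exact nonneg_of_mul_nonneg_left this (exp_pos _)
      have h3 : exp (-(v / 2)) ≤ exp (-(u / 2)) := exp_le_exp.2 (by linarith)
      have h4 := mul_le_mul_of_nonneg_left h3 hc
      refine (abs_sub _ _).trans ?_
      linarith
    have := norm_integral_le_of_norm_le
        (((hi3 u hu0).const_mul 2).const_mul (2 * c * exp (-(u / 2))))
      ((ae_restrict_iff' measurableSet_Ioi).2 (.of_forall hb))
    rw [MeasureTheory.integral_const_mul, hI3 u hu0] at this
    refine this.trans (le_of_eq (by ring))
  · fun_prop
  · intro v hv
    exact ((hi3 v (hu0.trans hv)).const_mul (-2)).ofReal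
  · rw [← Complex.ofReal_zero]
    refine (Complex.continuous_ofReal.tendsto 0).comp ?_
    exact (tendsto_pow_atTop two_ne_zero).inv_tendsto_atTop
  · refine (integrable_err_div_sq hu0).congr ?_
    filter_upwards [ae_restrict_mem measurableSet_Ioi] with v hv
    have hv0 : 0 < v := hu0.trans hv
    rw [div_eq_mul_one_div, ← hI3 v hv0]
    congr 1
    refine setIntegral_congr_fun measurableSet_Ioi fun w hw => ?_
    rw [Complex.norm_real, norm_eq_abs, abs_mul, abs_neg, abs_two,
      abs_of_pos (rpow_pos_of_pos (hv0.trans hw) _)]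

theorem abs_err_le_of_errInt {W : ℝ}
    (hV : ∀ u, 3 ≤ u → |W - errInt u| ≤ 1 / 20 * exp (-(u / 2))) {u : ℝ} (hu : 19 / 5 ≤ u) :
    |err u| ≤ 1 / 2 * exp (-(u / 4)) := by
  set η := 1 / 2 * exp (-(u / 4)) with hη
  have hη0 : 0 < η := by positivity
  have hη2 : η ^ 2 = 1 / 4 * exp (-(u / 2)) := by
    rw [hη, mul_pow, ← exp_nat_mul]; norm_num; ring_nf
  have hηle : η ≤ 1 / 5 := by
    have h1 : exp (-(u / 4)) ≤ exp (-1) * exp (1 / 20) := by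
      rw [← Real.exp_add]; exact exp_le_exp.2 (by linarith)
    have h2 : exp (1 / 20) ≤ 20 / 19 := by
      have h := Real.add_one_le_exp (-(1 / 20 : ℝ))
      rw [Real.exp_neg] at h
      have := (le_inv_comm₀ (by norm_num) (exp_pos _)).1 h
      norm_num at this ⊢; linarith
    have h3 := exp_neg_one_lt_d9
    have h4 := mul_le_mul h3.le h2 (exp_pos _).le (by norm_num)
    rw [hη]; norm_num at h4; linarith
  have hexp : 0 < exp (-(u / 2)) := exp_pos _
  have hlin : ∀ a b k : ℝ, ∫ v in a..b, (k - v) = k * (b - a) - (b ^ 2 - a ^ 2) / 2 := by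
    intro a b k
    rw [intervalIntegral.integral_sub (by simp) (by simp), integral_id,
      intervalIntegral.integral_const]
    simp; ring
  rw [abs_le]
  constructor
  · by_contra! hlt
    have hV1 := abs_le.1 (hV u (by linarith))
    have hV2 := abs_le.1 (hV (u - η) (by linarith))
    have h1 : exp (-((u - η) / 2)) ≤ exp (-(u / 2)) * (10 / 9) := by
      have h := Real.add_one_le_exp (-(η / 2))
      have h9 : 9 / 10 ≤ exp (-(η / 2)) := by linarith
      rw [show -((u - η) / 2) = -(u / 2) - (-(η / 2)) by ring, Real.exp_sub, div_eq_mul_inv]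
      refine mul_le_mul_of_nonneg_left ?_ hexp.le
      rw [inv_le_comm₀ (exp_pos _) (by norm_num)]
      norm_num; linarith
    have hI : ∫ v in (u - η)..u, err v ≤ ∫ v in (u - η)..u, ((u - η) - v) := by
      refine integral_mono_on (by linarith) (err_intervalIntegrable _ _)
        ((by fun_prop : Continuous fun v : ℝ => (u - η) - v).intervalIntegrable _ _) fun v hv => ?_
      have := lamSum_mono hv.2
      simp only [err] at hlt ⊢
      linarith
    rw [hlin, errInt_sub] at hI
    nlinarith
  · by_contra! hlt
    have hV1 := abs_le.1 (hV u (by linarith))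
    have hV2 := abs_le.1 (hV (u + η) (by linarith))
    have h1 : exp (-((u + η) / 2)) ≤ exp (-(u / 2)) := exp_le_exp.2 (by linarith)
    have hI : ∫ v in u..(u + η), ((u + η) - v) ≤ ∫ v in u..(u + η), err v := by
      refine integral_mono_on (by linarith)
        ((by fun_prop : Continuous fun v : ℝ => (u + η) - v).intervalIntegrable _ _)
        (err_intervalIntegrable _ _) fun v hv => ?_
      have := lamSum_mono hv.1
      simp only [err] at hlt ⊢
      linarith
    rw [hlin, errInt_sub] at hI
    nlinarith

theorem log_one_add_sub_ge {q : ℝ} (hq : |q| ≤ 1 / 50) : -(53 / 100 * q ^ 2) ≤ log (1 + q) - q := by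
  have h := abs_log_sub_add_sum_range_le (x := -q) (by rw [abs_neg]; linarith) 2
  rw [abs_neg, Finset.sum_range_succ, Finset.sum_range_one, sub_neg_eq_add] at h
  have h1 := (abs_le.1 h).1
  have h2 : |q| ^ (2 + 1) / (1 - |q|) ≤ 3 / 100 * q ^ 2 := by
    rw [div_le_iff₀ (by linarith), pow_succ, sq_abs]
    nlinarith [sq_nonneg q]
  norm_num at h1
  linarith

theorem log_gammaP_pos {W : ℝ}
    (hV : ∀ u, 3 ≤ u → |W - errInt u| ≤ 1 / 20 * exp (-(u / 2))) {N : ℕ} (hN : 2048 ≤ N) :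
    0 < log (gammaP (Nat.primesLE N)) + γ₀ := by
  have hN' : (2048 : ℝ) ≤ N := by exact_mod_cast hN
  rw [log_gammaP (by omega)]
  set s := log N / 2 with hs
  have hu : log N = 2 * s := by rw [hs]; ring
  have hs38 : 19 / 5 ≤ s := by
    have h1 := log_le_log (by norm_num) hN'
    rw [show (2048 : ℝ) = 2 ^ 11 by norm_num, Real.log_pow] at h1
    have h2 := log_two_gt_d9
    push_cast at h1
    linarith
  set h := exp (s / 2) with hh
  set k := exp (s / 4) with hk
  have hkk : k ^ 2 = h := by rw [hk, hh, ← exp_nat_mul]; congr 1; push_cast; ring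
  have hE : exp s = h ^ 2 := by rw [hh, ← exp_nat_mul]; congr 1; push_cast; ring
  have hEN : (h ^ 2) ^ 2 = N := by rw [← hE]; exact exp_half_log (by omega)
  have hk0 : 0 < k := exp_pos _
  have hh0 : 0 < h := exp_pos _
  have hE45 : 45 ≤ h ^ 2 := by nlinarith [sq_nonneg h]
  have hh67 : 67 / 10 ≤ h := by nlinarith
  have hk258 : 258 / 100 ≤ k := by nlinarith
  have hε : ∀ v, s ≤ v → |err v| ≤ 1 / 2 * k⁻¹ := by
    intro v hv
    refine (abs_err_le_of_errInt hV (hs38.trans hv)).trans ?_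
    rw [hk, ← Real.exp_neg]
    have : exp (-(v / 4)) ≤ exp (-(s / 4)) := exp_le_exp.2 (by linarith)
    linarith
  have hkinv : k⁻¹ ≤ 388 / 1000 := by
    rw [inv_le_comm₀ hk0 (by norm_num)]; norm_num; linarith
  have hhinv : h⁻¹ ≤ 150 / 1000 := by
    rw [inv_le_comm₀ hh0 (by norm_num)]; norm_num; linarith
  have hhinv0 : 0 < h⁻¹ := by positivity
  have hs1 : (1 + s) * (h ^ 2)⁻¹ ≤ 111 / 1000 := by
    rw [← div_eq_mul_inv, div_le_iff₀ (by positivity), ← hE]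
    have h1 : exp s = exp 1 ^ 4 * exp (-(1 / 5)) * exp (s - 19 / 5) := by
      rw [← exp_nat_mul, ← Real.exp_add, ← Real.exp_add]; congr 1; push_cast; ring
    have h2 := Real.add_one_le_exp (s - 19 / 5)
    have h3 := Real.add_one_le_exp (-(1 / 5 : ℝ))
    have h4 : (2718 / 1000 : ℝ) ^ 4 ≤ exp 1 ^ 4 :=
      pow_le_pow_left₀ (by norm_num) (by linarith [exp_one_gt_d9]) 4
    have h5 : (2718 / 1000 : ℝ) ^ 4 * (4 / 5) ≤ exp 1 ^ 4 * exp (-(1 / 5)) :=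
      mul_le_mul h4 (by linarith) (by norm_num) (by positivity)
    have h6 : (2718 / 1000 : ℝ) ^ 4 * (4 / 5) * (s - 14 / 5) ≤ exp s := by
      rw [h1]
      exact mul_le_mul h5 (by linarith) (by linarith) (by positivity)
    norm_num at h6
    linarith
  have hpt : powTail N ≤ 460 / 1000 * h⁻¹ := by
    have h1 := powTail_le (by omega) hε
    rw [hE] at h1
    have hlam : lamSum s ≤ 1 + s := by
      have := (abs_le.1 (hε s le_rfl)).2
      have h3 := one_half_lt_eulerMascheroniConstant
      rw [err] at this
      linarith
    have hl4 : log 4 ≤ 1387 / 1000 := by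
      rw [show (4 : ℝ) = 2 ^ 2 by norm_num, Real.log_pow]
      have := log_two_lt_d9
      push_cast; linarith
    have a1 : log 4 / h ^ 2 ≤ 1387 / 1000 * (150 / 1000) * h⁻¹ := by
      rw [div_eq_mul_inv, pow_two, mul_inv, mul_assoc, ← mul_assoc]
      rw [← mul_assoc]
      gcongr
    have a2 : 2 * lamSum s / (h ^ 2) ^ 2 ≤ 2 * (111 / 1000) * (150 / 1000) * h⁻¹ := by
      have e : 2 * lamSum s / (h ^ 2) ^ 2 = 2 * (lamSum s * (h ^ 2)⁻¹) * h⁻¹ * h⁻¹ := by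
        field_simp
      rw [e]
      have : lamSum s * (h ^ 2)⁻¹ ≤ 111 / 1000 :=
        (mul_le_mul_of_nonneg_right hlam (by positivity)).trans hs1
      have hl0 : 0 ≤ lamSum s := lamSum_nonneg s
      gcongr
    have a3 : (1 + 2 * (1 / 2 * k⁻¹)) / (h ^ 2 - 1) ≤ 1388 / 1000 * (45 / 44) * (150 / 1000) *
        h⁻¹ := by
      have e : (h ^ 2 - 1)⁻¹ ≤ 45 / 44 * (h⁻¹ * h⁻¹) := by
        rw [← mul_inv, ← pow_two, ← div_eq_mul_inv, le_div_iff₀ (by positivity),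
          inv_mul_le_iff₀ (by linarith)]
        linarith
      have e2 : h⁻¹ * h⁻¹ ≤ 150 / 1000 * h⁻¹ := by gcongr
      have e0 : 0 < (h ^ 2 - 1)⁻¹ := inv_pos.2 (by linarith)
      rw [div_eq_mul_inv]
      calc (1 + 2 * (1 / 2 * k⁻¹)) * (h ^ 2 - 1)⁻¹ ≤ 1388 / 1000 *
          (45 / 44 * (150 / 1000 * h⁻¹)) := by
            refine mul_le_mul (by linarith) (by linarith) e0.le (by norm_num)
        _ = _ := by ring
    have : powTail N ≤ (1387 / 1000 * (150 / 1000) + 2 * (111 / 1000) * (150 / 1000) +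
      1388 / 1000 * (45 / 44) * (150 / 1000)) * h⁻¹ := by linarith
    refine this.trans (mul_le_mul_of_nonneg_right (by norm_num) hhinv0.le)
  have hpt0 := powTail_nonneg (N := N) (by omega)
  have herr : |err (2 * s)| ≤ 1 / 2 * h⁻¹ := by
    refine (abs_err_le_of_errInt hV (by linarith)).trans ?_
    rw [hh, ← Real.exp_neg]
    apply le_of_eq; ring_nf
  have hgain := gain_ge (by omega) hε
  have htail := abs_errTail_le_of_errInt (by norm_num) hV (u := 2 * s) (by linarith)
  have hEneg : exp (-s) = (h ^ 2)⁻¹ := by rw [Real.exp_neg, hE]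
  rw [← hs, hEneg] at hgain
  rw [show -(2 * s / 2) = -s by ring, hEneg] at htail
  rw [hu] at hgain ⊢
  set q := (err (2 * s) + powTail N) / (2 * s) with hq
  have herr' := abs_le.1 herr
  have hQ : |err (2 * s) + powTail N| ≤ 96 / 100 * h⁻¹ := by
    rw [abs_le]; constructor <;> linarith
  have hqle : |q| ≤ 1 / 50 := by
    rw [hq, abs_div, abs_of_pos (by linarith : 0 < 2 * s), div_le_iff₀ (by linarith)]
    linarith
  have hlog := log_one_add_sub_ge hqle
  have hq2 : (2 * s) ^ 2 * q ^ 2 ≤ (96 / 100) ^ 2 * (h ^ 2)⁻¹ := by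
    rw [hq, div_pow, mul_div_cancel₀ _ (by positivity), ← sq_abs, ← inv_pow, ← mul_pow]
    exact pow_le_pow_left₀ (abs_nonneg _) hQ 2
  have htail' : -(1 / 10 * (h ^ 2)⁻¹) ≤ (2 * s) ^ 2 * errTail (2 * s) := by
    have h1 := (abs_le.1 htail).1
    have h2 : 0 < (2 * s) ^ 2 := by positivity
    have h3 := mul_le_mul_of_nonneg_left h1 h2.le
    rw [mul_neg, mul_div_cancel₀ _ h2.ne'] at h3
    linarith
  have hG : 64 / 100 ≤ 1 - (1 + s) * (h ^ 2)⁻¹ - 2 * exp (-1) * (1 / 2 * k⁻¹) := by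
    have h3 := exp_neg_one_lt_d9
    have h4 := mul_le_mul h3.le hkinv (by positivity) (by norm_num)
    norm_num at h4
    linarith
  have hinv0 : 0 < (h ^ 2)⁻¹ := by positivity
  have hG' := mul_le_mul_of_nonneg_left hG hinv0.le
  have hfin : 0 < (2 * s) ^ 2 * (log (1 + q) - q + gain N + errTail (2 * s)) := by
    have h1 := mul_le_mul_of_nonneg_left hlog (sq_nonneg (2 * s))
    nlinarith
  exact (mul_pos_iff_of_pos_left (by positivity)).1 hfin

end Large

section Numerics

/-- Evaluates `x` before passing it on to `f` when reduced in the kernel. -/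
def force (x : ℕ) (f : ℕ → Bool) : Bool :=
  match x with
  | 0 => f 0
  | k + 1 => f (k + 1)

theorem force_eq (x : ℕ) (f : ℕ → Bool) : force x f = f x := by cases x <;> rfl

/-- Applies `f` to `c + ∑ i < k, 10 ^ 12 / (i + 1)`. -/
def harmonicFold (f : ℕ → Bool) : ℕ → ℕ → Bool
  | 0, c => f c
  | k + 1, c => force (c + 10 ^ 12 / (k + 1)) fun c' => harmonicFold f k c'

theorem harmonicFold_eq (f : ℕ → Bool) (k c : ℕ) :
    harmonicFold f k c = f (c + ∑ i ∈ Finset.range k, 10 ^ 12 / (i + 1)) := by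
  induction k generalizing c with
  | zero => rfl
  | succ k ih => rw [harmonicFold, force_eq, ih, Finset.sum_range_succ]; congr 1; ring

theorem sum_floor_le_harmonic (n : ℕ) :
    ((∑ k ∈ Finset.range n, 10 ^ 12 / (k + 1) : ℕ) : ℝ) ≤ 10 ^ 12 * (harmonic n : ℝ) := by
  rw [harmonic, Nat.cast_sum, Rat.cast_sum, Finset.mul_sum]
  refine Finset.sum_le_sum fun k _ => Nat.cast_div_le.trans (le_of_eq ?_)
  push_cast
  ring

theorem harmonic_le_sum_floor (n : ℕ) :
    10 ^ 12 * (harmonic n : ℝ) ≤ ((∑ k ∈ Finset.range n, 10 ^ 12 / (k + 1) : ℕ) : ℝ) + n := by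
  have : (n : ℝ) = ∑ _k ∈ Finset.range n, (1 : ℝ) := by simp
  rw [harmonic, Nat.cast_sum, Rat.cast_sum, Finset.mul_sum]
  conv_rhs => rw [this, ← Finset.sum_add_distrib]
  refine Finset.sum_le_sum fun k _ => ?_
  have h := (Nat.lt_div_mul_add (a := 10 ^ 12) (b := k + 1) (by omega)).le
  have h' : ((10 : ℝ) ^ 12) ≤ ((10 ^ 12 / (k + 1) : ℕ) : ℝ) * (k + 1) + (k + 1) := by
    exact_mod_cast h
  have hk : (0 : ℝ) < k + 1 := by positivity
  push_cast
  rw [← div_eq_mul_inv, div_le_iff₀ hk]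
  push_cast at h'
  linarith

theorem eulerMascheroniConstant_gt_of_harmonicFold {t n : ℕ}
    (h : harmonicFold (fun c => Nat.ble t c) n 0 = true) :
        (t : ℝ) / 10 ^ 12 - log (n + 1) < γ₀ := by
  rw [harmonicFold_eq, Nat.ble_eq, zero_add] at h
  refine lt_of_le_of_lt ?_ (eulerMascheroniSeq_lt_eulerMascheroniConstant n)
  have h2 := (Nat.cast_le (α := ℝ).2 h).trans (sum_floor_le_harmonic n)
  rw [eulerMascheroniSeq, sub_le_sub_iff_right, div_le_iff₀' (by norm_num)]
  exact h2

theorem eulerMascheroniConstant_lt_of_harmonicFold {t n : ℕ} (hn : n ≠ 0)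
    (h : harmonicFold (fun c => Nat.ble c t) n 0 = true) :
    γ₀ < ((t : ℝ) + n) / 10 ^ 12 - log n := by
  rw [harmonicFold_eq, Nat.ble_eq, zero_add] at h
  refine lt_of_lt_of_le (eulerMascheroniConstant_lt_eulerMascheroniSeq' n) ?_
  have h2 := (harmonic_le_sum_floor n).trans (add_le_add_left (Nat.cast_le (α := ℝ).2 h) _)
  rw [eulerMascheroniSeq', if_neg hn, sub_le_sub_iff_right, le_div_iff₀' (by norm_num)]
  exact h2

theorem harmonicFold_4095 : harmonicFold (fun c => Nat.ble 8894856169600 c) 4095 0 = true := by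
  decide +kernel

theorem harmonicFold_256 : harmonicFold (fun c => Nat.ble c 6124349999000) 256 0 = true := by
  decide +kernel

theorem eulerMascheroniConstant_gt : 57709 / 100000 < γ₀ := by
  have h1 := eulerMascheroniConstant_gt_of_harmonicFold harmonicFold_4095
  rw [show ((4095 : ℕ) : ℝ) + 1 = 2 ^ 12 by norm_num, Real.log_pow] at h1
  have h2 := log_two_lt_d9
  push_cast at h1
  linarith

theorem eulerMascheroniConstant_lt : γ₀ < 5792 / 10000 := by
  have h1 := eulerMascheroniConstant_lt_of_harmonicFold (by norm_num) harmonicFold_256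
  rw [show ((256 : ℕ) : ℝ) = 2 ^ 8 by norm_num, Real.log_pow] at h1
  have h2 := log_two_gt_d9
  push_cast at h1
  linarith

theorem exp_neg_eulerMascheroniConstant_lt : exp (-γ₀) < 56154 / 100000 := by
  have h1 : exp (-γ₀) < exp (-(57709 / 100000)) :=
    exp_lt_exp.2 (by linarith [eulerMascheroniConstant_gt])
  refine h1.trans_le ?_
  rw [Real.exp_neg, inv_le_comm₀ (exp_pos _) (by norm_num)]
  refine le_trans ?_ (Real.sum_le_exp_of_nonneg (by norm_num) 9)
  simp only [Finset.sum_range_succ, Finset.sum_range_zero, Nat.factorial]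
  norm_num

theorem log_four_pi_ge : 25298 / 10000 ≤ log (4 * π) := by
  have h1 : log (12 * (10471 / 10000)) ≤ log (4 * π) :=
    log_le_log (by norm_num) (by linarith [pi_gt_d4])
  rw [log_mul (by norm_num) (by norm_num), show (12 : ℝ) = 2 ^ 2 * 3 by norm_num,
    log_mul (by norm_num) (by norm_num), Real.log_pow] at h1
  have h2 := one_sub_inv_le_log_of_pos (x := 10471 / 10000) (by norm_num)
  have h3 := log_two_gt_d9
  have h4 := log_three_gt_d9
  norm_num at h1 h2
  linarith

theorem exists_abs_sub_errInt_le_exp (hRH : RiemannHypothesis) :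
    ∃ W : ℝ, ∀ u, 3 ≤ u → |W - errInt u| ≤ 1 / 20 * exp (-(u / 2)) := by
  obtain ⟨W, hW⟩ := exists_abs_sub_errInt_le hRH
  refine ⟨W, fun u hu => (hW u (by linarith)).trans ?_⟩
  have h1 : exp (-(3 * u)) ≤ exp (-(u / 2)) * (1 / 1000) := by
    have e : exp (-(3 * u)) = exp (-(u / 2)) * exp (-(5 / 2 * u)) := by
      rw [← Real.exp_add]; congr 1; ring
    have e2 : exp (-(5 / 2 * u)) ≤ exp (-1) ^ 7 := by
      rw [← exp_nat_mul]; exact exp_le_exp.2 (by push_cast; linarith)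
    have e3 : exp (-1) ^ 7 ≤ (37 / 100 : ℝ) ^ 7 :=
      pow_le_pow_left₀ (exp_pos _).le (by linarith [exp_neg_one_lt_d9]) 7
    rw [e]
    refine mul_le_mul_of_nonneg_left ((e2.trans e3).trans (by norm_num)) (exp_pos _).le
  have h2 : 2 * xiLog (1 / 2) ≤ 494 / 10000 := by
    rw [xiLog_half]
    linarith [log_four_pi_ge, eulerMascheroniConstant_lt]
  have h3 := mul_le_mul_of_nonneg_left h2 (exp_pos (-(u / 2))).le
  linarith [exp_pos (-(u / 2))]

theorem log_add_one_ge {n : ℕ} (hn : 1 ≤ n) :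
    log n + (2 / (2 * n + 1) + 2 / (3 * (2 * n + 1) ^ 3)) ≤ log ((n + 1 : ℕ) : ℝ) := by
  have hn0 : (0 : ℝ) < n := by exact_mod_cast hn
  have h := sum_le_hasSum (Finset.range 2) (fun k _ => by positivity) (hasSum_log_one_add_inv hn0)
  have e : ((n + 1 : ℕ) : ℝ) = n * (1 + (n : ℝ)⁻¹) := by push_cast; field_simp
  rw [e, log_mul hn0.ne' (by positivity)]
  rw [Finset.sum_range_succ, Finset.sum_range_one] at h
  refine add_le_add le_rfl (le_trans (le_of_eq ?_) h)
  push_cast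
  field_simp
  ring

theorem coprime_factorial_iff_prime {m : ℕ} (h2 : 2 ≤ m) (hm : m < 46 ^ 2) :
    Nat.gcd m (min (m - 1) 45).factorial = 1 ↔ m.Prime := by
  constructor
  · intro h
    by_contra hp
    have h1 := Nat.minFac_sq_le_self (by omega) hp
    have h3 := (Nat.minFac_prime (n := m) (by omega))
    have h4 : m.minFac < 46 := lt_of_pow_lt_pow_left₀ 2 (by norm_num) (h1.trans_lt hm)
    have h5 : m.minFac < m := (Nat.not_prime_iff_minFac_lt h2).1 hp
    have h6 := Nat.dvd_gcd (Nat.minFac_dvd m)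
        (h3.dvd_factorial.2 (by omega : m.minFac ≤ min (m - 1) 45))
    rw [h] at h6
    exact h3.one_lt.ne' (Nat.dvd_one.1 h6)
  · intro hp
    refine (Nat.Prime.coprime_iff_not_dvd hp).2 fun h => ?_
    have := hp.dvd_factorial.1 h
    omega

/-- Checks `gammaP (Nat.primesLE m) > 56154 / 100000` for `k` consecutive values `m` from `n` on.
Here `F` is `(min n 45)!`, and `L`, `A`, `B` are lower bounds, in units of `10 ^ (-12)`, for `log n`
and for the two factors of `gammaP`. -/
def checkGammaP : ℕ → ℕ → ℕ → ℕ → ℕ → ℕ → Bool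
  | 0, _, _, _, _, _ => true
  | k + 1, n, F, L, A, B =>
    cond (Nat.ble (561540000000 * 10 ^ 12) (A * B))
      (force (n + 1) fun m =>
        force (cond (Nat.ble m 45) (F * m) F) fun F' =>
          force (L + 2 * 10 ^ 12 / (2 * n + 1) + 2 * 10 ^ 12 / (3 * (2 * n + 1) ^ 3)) fun L' =>
            cond (Nat.beq (Nat.gcd m F) 1)
              (force (A + L' / n) fun A' => force (B * n / m) fun B' => checkGammaP k m F' L' A' B')
              (checkGammaP k m F' L' A B))
      false

theorem gammaP_gt_of_checkGammaP {k n F L A B : ℕ} (hn : 2 ≤ n) (hk : n + k ≤ 46 ^ 2)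
    (hF : F = (min n 45).factorial) (hL : (L : ℝ) ≤ 10 ^ 12 * log n)
    (hA : (A : ℝ) ≤ 10 ^ 12 * (γ₀ + ∑ p ∈ Nat.primesLE n, log p / ((p : ℝ) - 1)))
    (hB : (B : ℝ) ≤ 10 ^ 12 * ∏ p ∈ Nat.primesLE n, (1 - 1 / (p : ℝ)))
    (h : checkGammaP k n F L A B = true) {m : ℕ} (hm : n ≤ m) (hmk : m < n + k) :
    56154 / 100000 ≤ gammaP (Nat.primesLE m) := by
  induction k generalizing n F L A B with
  | zero => omega
  | succ k ih =>
    rw [checkGammaP] at h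
    simp only [force_eq, Bool.cond_eq_ite, Nat.ble_eq, Nat.beq_eq] at h
    have hn0 : (2 : ℝ) ≤ n := by exact_mod_cast hn
    have hlp : ∀ p ∈ Nat.primesLE n, (2 : ℝ) ≤ p := fun p hp => by
      exact_mod_cast (Nat.prime_of_mem_primesLE hp).two_le
    have hP0 : 0 ≤ ∏ p ∈ Nat.primesLE n, (1 - 1 / (p : ℝ)) := by
      refine Finset.prod_nonneg fun p hp => ?_
      have := hlp p hp
      rw [sub_nonneg, div_le_one (by linarith)]
      linarith
    by_cases h1 : 561540000000 * 10 ^ 12 ≤ A * B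
    swap
    · rw [if_neg h1] at h
      exact absurd h (by decide)
    rw [if_pos h1] at h
    rcases hm.eq_or_lt with rfl | hlt
    · have h1' : (561540000000 * 10 ^ 12 : ℝ) ≤ A * B := by exact_mod_cast h1
      have h3 := h1'.trans (mul_le_mul hA hB (Nat.cast_nonneg _) ((Nat.cast_nonneg _).trans hA))
      rw [gammaP]
      linarith
    have hL' : ((L + 2 * 10 ^ 12 / (2 * n + 1) + 2 * 10 ^ 12 / (3 * (2 * n + 1) ^ 3) : ℕ) : ℝ) ≤
        10 ^ 12 * log ((n + 1 : ℕ) : ℝ) := by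
      have h3 := log_add_one_ge (n := n) (by omega)
      have h4 : ((2 * 10 ^ 12 / (2 * n + 1) : ℕ) : ℝ) ≤ _ := Nat.cast_div_le
      have h5 : ((2 * 10 ^ 12 / (3 * (2 * n + 1) ^ 3) : ℕ) : ℝ) ≤ _ := Nat.cast_div_le
      push_cast at h3 h4 h5 ⊢
      have e4 : (2000000000000 / (2 * n + 1) : ℝ) = 10 ^ 12 * (2 / (2 * n + 1)) := by ring
      have e5 : (2000000000000 / (3 * (2 * n + 1) ^ 3) : ℝ) =
          10 ^ 12 * (2 / (3 * (2 * n + 1) ^ 3)) := by ring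
      rw [e4] at h4
      rw [e5] at h5
      linarith
    set L' := L + 2 * 10 ^ 12 / (2 * n + 1) + 2 * 10 ^ 12 / (3 * (2 * n + 1) ^ 3)
    have hF' : (if n + 1 ≤ 45 then F * (n + 1) else F) = (min (n + 1) 45).factorial := by
      split_ifs with h45
      · rw [hF, min_eq_left (by omega), min_eq_left h45, Nat.factorial_succ, mul_comm]
      · rw [hF, min_eq_right (by omega), min_eq_right (by omega)]
    have hprime : Nat.gcd (n + 1) F = 1 ↔ (n + 1).Prime := by
      rw [hF]
      exact coprime_factorial_iff_prime (m := n + 1) (by omega) (by omega)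
    by_cases h2 : (n + 1).Prime
    · rw [if_pos (hprime.2 h2)] at h
      have hnot : n + 1 ∉ Nat.primesLE n := fun h3 => by
        have := (Nat.mem_primesLE.1 h3).1
        omega
      have hLE : Nat.primesLE (n + 1) = insert (n + 1) (Nat.primesLE n) := by
        rw [Nat.primesLE_succ, if_pos h2]
      refine ih (by omega) (by omega) hF' hL' ?_ ?_ h (by omega) (by omega)
      · rw [hLE, Finset.sum_insert hnot]
        have h4 : ((L' / n : ℕ) : ℝ) ≤ L' / n := Nat.cast_div_le
        have h5 : (L' : ℝ) / n ≤ 10 ^ 12 * log ((n + 1 : ℕ) : ℝ) / n :=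
          div_le_div_of_nonneg_right hL' (by linarith)
        have e : (((n + 1 : ℕ) : ℝ) - 1) = n := by push_cast; ring
        rw [e, Nat.cast_add]
        rw [mul_div_assoc] at h5
        linarith
      · rw [hLE, Finset.prod_insert hnot]
        have h4 : ((B * n / (n + 1) : ℕ) : ℝ) ≤ _ := Nat.cast_div_le
        refine h4.trans ?_
        have e : (1 - 1 / ((n + 1 : ℕ) : ℝ)) = n / (n + 1) := by push_cast; field_simp; ring
        rw [e]
        push_cast
        rw [mul_div_assoc]
        have h5 := mul_le_mul_of_nonneg_right hB (by positivity : (0 : ℝ) ≤ n / (n + 1))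
        linarith
    · rw [if_neg (mt hprime.1 h2)] at h
      have hLE : Nat.primesLE (n + 1) = Nat.primesLE n := by
        rw [Nat.primesLE_succ, if_neg h2]
      refine ih (by omega) (by omega) hF' hL' ?_ ?_ h (by omega) (by omega)
      · rw [hLE]; exact hA
      · rw [hLE]; exact hB

theorem checkGammaP_eq_true :
    checkGammaP 2046 2 2 693147180300 (577090000000 + 693147180300) 500000000000 = true := by
  decide +kernel

theorem gammaP_gt_of_lt {m : ℕ} (h2 : 2 ≤ m) (hm : m < 2048) :
    exp (-γ₀) < gammaP (Nat.primesLE m) := by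
  refine exp_neg_eulerMascheroniConstant_lt.trans_le ?_
  have hP : Nat.primesLE 2 = {2} := by decide
  refine gammaP_gt_of_checkGammaP (n := 2) (by norm_num) (by norm_num) (by decide) ?_ ?_ ?_
    checkGammaP_eq_true h2 (by omega)
  · have := log_two_gt_d9
    push_cast
    linarith
  · rw [hP, Finset.sum_singleton]
    have := log_two_gt_d9
    have := eulerMascheroniConstant_gt
    norm_num
    linarith
  · rw [hP, Finset.prod_singleton]
    norm_num

theorem gammaR_gt (hRH : RiemannHypothesis) (r : ℕ) : exp (-γ₀) < gammaR r := by
  rcases r with - | r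
  · have h : gammaR 0 = γ₀ := by simp [gammaR, gammaP]
    rw [h]
    linarith [exp_neg_eulerMascheroniConstant_lt, eulerMascheroniConstant_gt]
  rw [gammaR_succ]
  set p := Nat.nth Nat.Prime r
  have hp : p.Prime := Nat.prime_nth_prime r
  rcases lt_or_ge p 2048 with h | h
  · exact gammaP_gt_of_lt hp.two_le h
  obtain ⟨W, hW⟩ := exists_abs_sub_errInt_le_exp hRH
  have h1 := log_gammaP_pos hW h
  rw [← lt_log_iff_exp_lt]
  · linarith
  · rw [gammaP]
    refine mul_pos (Finset.prod_pos fun q hq => ?_) (add_pos_of_pos_of_nonneg ?_ ?_)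
    · have : (1 : ℝ) < q := by exact_mod_cast (Nat.prime_of_mem_primesLE hq).one_lt
      rw [sub_pos, div_lt_one (by linarith)]
      exact this
    · linarith [one_half_lt_eulerMascheroniConstant]
    · refine Finset.sum_nonneg fun q hq => ?_
      have : (1 : ℝ) < q := by exact_mod_cast (Nat.prime_of_mem_primesLE hq).one_lt
      have := log_pos this
      have : (0 : ℝ) < q - 1 := by linarith
      positivity

end Numerics

end GammaRH

/-- RH is equivalent to the statement "`γ_r > e^{-γ}` for all `r ≥ 0`". -/
theorem RH_iff_gammaR_gt :
    RiemannHypothesis ↔ ∀ r : ℕ, Real.exp (-Real.eulerMascheroniConstant) < gammaR r :=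
  ⟨fun h r => GammaRH.gammaR_gt h r, fun h => GammaRH.riemannHypothesis_of_gammaR h⟩
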